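/- arXiv:1406.2803 — 3 statements merged into one kernel-verified Lean document; each statement's English description precedes it below -/
import Mathlib

section
/- Assume GRH for L(s,χ), χ primitive mod q > 1. Let t ≥ 2, 4 ≤ x ≤ t², σ₁ = 1/2 + 1/log x, and set M₃ = ∫_{1/2}^{σ₁} [(L'/L)(σ₁+it,χ) - (L'/L)(σ+it,χ)] dσ. Then |Im M₃| ≤ (π/4)·[1/(1 - (1/e)(1+1/e)ω')]·(log(q(t+1))/log x) + O((1/log x)·|∑_{n<x²} Λ_x(n)χ(n) n^{-(σ₁+it)}|) + O(1/log x), where ω' is a real number with -1 ≤ ω' ≤ 1 depending on t, x, χ, and the implied constants are absolute. -/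
open Complex Real ArithmeticFunction MeasureTheory

/-- The generalized Riemann hypothesis for the Dirichlet L-function of `χ`. -/
def GRH {q : ℕ} [NeZero q] (χ : DirichletCharacter ℂ q) : Prop :=
  ∀ ρ : ℂ, DirichletCharacter.LFunction χ ρ = 0 → 0 < ρ.re → ρ.re < 1 → ρ.re = 1 / 2

/-- Selberg's truncated von Mangoldt function `Λ_x`. -/
noncomputable def Lambdax (x : ℝ) (n : ℕ) : ℝ :=
  if (n : ℝ) ≤ x then vonMangoldt n
  else if (n : ℝ) ≤ x ^ 2 then vonMangoldt n * (Real.log (x ^ 2 / n) / Real.log x)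
  else 0

/-- The Dirichlet polynomial `∑_{n<x²} Λ_x(n) χ(n) n^{-s}`. -/
noncomputable def Dpoly {q : ℕ} (χ : DirichletCharacter ℂ q) (x : ℝ) (s : ℂ) : ℂ :=
  ∑ n ∈ Finset.filter (fun n : ℕ => (n : ℝ) < x ^ 2) (Finset.range (⌈x ^ 2⌉₊ + 1)),
    (Lambdax x n : ℂ) * χ n / (n : ℂ) ^ s

section

open Filter Topology

theorem Differentiable.exists_eq_pow_mul {f : ℂ → ℂ} (hf : Differentiable ℂ f) {a : ℂ}
    (h : analyticOrderAt f a ≠ ⊤) :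
    ∃ g : ℂ → ℂ, Differentiable ℂ g ∧ (∀ z, f z = (z - a) ^ analyticOrderNatAt f a * g z) ∧
      g a ≠ 0 := by
  obtain ⟨g₀, hg₀, hne, heq⟩ := (hf.analyticAt a).analyticOrderAt_ne_top.1 h
  set n := analyticOrderNatAt f a
  let g : ℂ → ℂ := fun z => if z = a then g₀ a else f z / (z - a) ^ n
  have hgg : g =ᶠ[𝓝 a] g₀ := by
    filter_upwards [heq] with z hz
    by_cases hza : z = a
    · simp [g, hza]
    · have : (z - a) ^ n ≠ 0 := pow_ne_zero _ (sub_ne_zero.2 hza)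
      simp only [g, hza, if_false, hz, smul_eq_mul]
      field_simp
  refine ⟨g, fun z => ?_, fun z => ?_, by simpa [g] using hne⟩
  · by_cases hza : z = a
    · subst hza
      exact hgg.symm.differentiableAt_iff.1 hg₀.differentiableAt
    · have hev : g =ᶠ[𝓝 z] fun z => f z / (z - a) ^ n := by
        filter_upwards [isOpen_ne.mem_nhds hza] with w hw
        simp [g, show w ≠ a from hw]
      refine hev.symm.differentiableAt_iff.1 ?_
      have : (z - a) ^ n ≠ 0 := pow_ne_zero _ (sub_ne_zero.2 hza)
      exact (hf z).div (by fun_prop) this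
  · by_cases hza : z = a
    · subst hza
      simpa [g] using heq.self_of_nhds
    · have : (z - a) ^ n ≠ 0 := pow_ne_zero _ (sub_ne_zero.2 hza)
      simp only [g, hza, if_false]
      field_simp

theorem Differentiable.exists_eq_prod_pow_mul {f : ℂ → ℂ} (hf : Differentiable ℂ f)
    (h : ∀ a, analyticOrderAt f a ≠ ⊤) (S : Finset ℂ) :
    ∃ g : ℂ → ℂ, Differentiable ℂ g ∧
      (∀ z, f z = (∏ ρ ∈ S, (z - ρ) ^ analyticOrderNatAt f ρ) * g z) ∧ ∀ ρ ∈ S, g ρ ≠ 0 := by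
  classical
  induction S using Finset.induction_on with
  | empty => exact ⟨f, hf, by simp, by simp⟩
  | insert a S ha ih =>
    obtain ⟨g, hg, hfg, hne⟩ := ih
    have hP : Differentiable ℂ (fun z => ∏ ρ ∈ S, (z - ρ) ^ analyticOrderNatAt f ρ) := by
      fun_prop
    have hPa : (∏ ρ ∈ S, (a - ρ) ^ analyticOrderNatAt f ρ) ≠ 0 :=
      Finset.prod_ne_zero_iff.2 fun ρ hρ => pow_ne_zero _
        (sub_ne_zero.2 fun h' => ha (h' ▸ hρ))
    have hord : analyticOrderAt f a = analyticOrderAt g a := by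
      have : f = (fun z => ∏ ρ ∈ S, (z - ρ) ^ analyticOrderNatAt f ρ) * g := funext hfg
      conv_lhs => rw [this]
      rw [analyticOrderAt_mul (hP.analyticAt a) (hg.analyticAt a),
        (hP.analyticAt a).analyticOrderAt_eq_zero.2 hPa, zero_add]
    obtain ⟨g', hg', hgg', hne'⟩ := hg.exists_eq_pow_mul (hord ▸ h a)
    refine ⟨g', hg', fun z => ?_, fun ρ hρ => ?_⟩
    · have hnat : analyticOrderNatAt f a = analyticOrderNatAt g a := by
        simp only [analyticOrderNatAt, hord]
      rw [Finset.prod_insert ha, hfg z, hgg' z, hnat]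
      ring
    · rcases Finset.mem_insert.1 hρ with rfl | hρ
      · exact hne'
      · intro h0
        exact hne ρ hρ (by rw [hgg' ρ, h0, mul_zero])

/-- Borel–Carathéodory together with Cauchy's estimate: the logarithmic derivative of a zero-free
function varies slowly when the function does not grow too fast. -/
theorem norm_logDeriv_sub_logDeriv_le {g : ℂ → ℂ} {c z : ℂ} {R M : ℝ} (hR : 0 < R) (hM : 0 < M)
    (hg : Differentiable ℂ g) (hne : ∀ w ∈ Metric.ball c R, g w ≠ 0)
    (hbd : ∀ w ∈ Metric.ball c R, ‖g w‖ ≤ ‖g c‖ * Real.exp M) (hz : ‖z - c‖ ≤ R / 8) :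
    ‖logDeriv g z - logDeriv g c‖ ≤ 128 * M / R ^ 2 * ‖z - c‖ := by
  have hgc : g c ≠ 0 := hne c (Metric.mem_ball_self hR)
  have hld : DifferentiableOn ℂ (logDeriv g) (Metric.ball c R) := by
    intro w hw
    have : DifferentiableAt ℂ (deriv g) w := (hg.analyticAt w).deriv.differentiableAt
    exact (this.div (hg w) (hne w hw)).differentiableWithinAt
  obtain ⟨l₀, hl₀⟩ := hld.isExactOn_ball
  set l : ℂ → ℂ := fun w => l₀ w - l₀ c with hl
  have hl' : ∀ w ∈ Metric.ball c R, HasDerivAt l (logDeriv g w) w := fun w hw =>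
    (hl₀ w hw).sub_const _
  have hexp : ∀ w ∈ Metric.ball c R, g w = g c * Complex.exp (l w) := by
    have hconst : ∀ w ∈ Metric.ball c R,
        HasDerivAt (fun w => g w * Complex.exp (-l w)) 0 w := by
      intro w hw
      have h1 : HasDerivAt (fun w => g w * Complex.exp (-l w)) _ w :=
        (hg w).hasDerivAt.mul ((hl' w hw).neg.cexp)
      refine h1.congr_deriv ?_
      have := hne w hw
      simp only [logDeriv_apply, Pi.neg_apply]
      field_simp
      ring
    intro w hw
    have h2 : (fun w => g w * Complex.exp (-l w)) w = (fun w => g w * Complex.exp (-l w)) c := by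
      refine (convex_ball c R).is_const_of_fderivWithin_eq_zero (𝕜 := ℂ)
        (fun w hw => (hconst w hw).differentiableAt.differentiableWithinAt) ?_ hw
        (Metric.mem_ball_self hR)
      intro w hw
      rw [fderivWithin_of_isOpen Metric.isOpen_ball hw]
      ext
      simpa using (hconst w hw).deriv
    simp only [hl, sub_self, neg_zero, Complex.exp_zero, mul_one] at h2
    rw [← h2, mul_assoc, ← Complex.exp_add]
    simp [hl]
  have hre : ∀ w ∈ Metric.ball c R, (l w).re ≤ M := by
    intro w hw
    have h1 := hbd w hw
    rw [hexp w hw, norm_mul, Complex.norm_exp] at h1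
    exact Real.exp_le_exp.1 (le_of_mul_le_mul_left h1 (norm_pos_iff.2 hgc))
  have hbc : ∀ w, ‖w - c‖ ≤ R / 2 → ‖l w‖ ≤ 2 * M := by
    intro w hw
    have hshift : ∀ v ∈ Metric.ball (0 : ℂ) R, v + c ∈ Metric.ball c R := by
      intro v hv
      simpa [Metric.mem_ball, dist_eq_norm] using hv
    have h1 := Complex.borelCaratheodory_zero (f := fun v => l (v + c)) (z := w - c) hM
      (R := R) (fun v hv => by
        have := (hl' _ (hshift v hv)).differentiableAt
        exact (this.comp v (by fun_prop : DifferentiableAt ℂ (fun v => v + c) v)).differentiableWithinAt)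
      (fun v hv => hre _ (hshift v hv)) hR (by simp; linarith) (by simp [hl])
    simp only [sub_add_cancel] at h1
    refine h1.trans ?_
    rw [div_le_iff₀ (by linarith)]
    nlinarith [norm_nonneg (w - c)]
  have hdl : ∀ w, ‖w - c‖ ≤ R / 4 → ‖logDeriv g w‖ ≤ 8 * M / R := by
    intro w hw
    have hsub : Metric.closedBall w (R / 4) ⊆ Metric.ball c R := by
      intro v hv
      simp only [Metric.mem_closedBall, Metric.mem_ball, dist_eq_norm] at hv ⊢
      have := norm_add_le (v - w) (w - c)
      rw [sub_add_sub_cancel] at this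
      linarith
    have hwb : w ∈ Metric.ball c R := hsub (Metric.mem_closedBall_self (by positivity))
    have h1 := norm_deriv_le_of_forall_mem_sphere_norm_le (c := w) (R := R / 4) (C := 2 * M)
      (f := l) (by positivity) (DifferentiableOn.diffContOnCl_ball (U := Metric.ball c R)
        (fun v hv => (hl' v hv).differentiableAt.differentiableWithinAt) hsub) (by
        intro v hv
        apply hbc
        simp only [mem_sphere_iff_norm] at hv
        have := norm_add_le (v - w) (w - c)
        rw [sub_add_sub_cancel] at this
        linarith)
    rw [(hl' w hwb).deriv] at h1
    refine h1.trans (le_of_eq ?_)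
    field_simp
    ring
  have hddl : ∀ w ∈ Metric.closedBall c (R / 8), ‖deriv (logDeriv g) w‖ ≤ 128 * M / R ^ 2 := by
    intro w hw
    have hw' : ‖w - c‖ ≤ R / 8 := by simpa [dist_eq_norm] using hw
    have hsub : Metric.closedBall w (R / 8) ⊆ Metric.ball c R := by
      intro v hv
      simp only [Metric.mem_closedBall, Metric.mem_ball, dist_eq_norm] at hv ⊢
      have := norm_add_le (v - w) (w - c)
      rw [sub_add_sub_cancel] at this
      linarith
    have h1 := norm_deriv_le_of_forall_mem_sphere_norm_le (c := w) (R := R / 8) (C := 8 * M / R)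
      (f := logDeriv g) (by positivity) (hld.diffContOnCl_ball hsub) (by
        intro v hv
        apply hdl
        simp only [mem_sphere_iff_norm] at hv
        have := norm_add_le (v - w) (w - c)
        rw [sub_add_sub_cancel] at this
        linarith)
    refine h1.trans ?_
    have : 8 * M / R / (R / 8) = 64 * M / R ^ 2 := by field_simp; ring
    rw [this]
    gcongr
    norm_num
  refine (convex_closedBall c (R / 8)).norm_image_sub_le_of_norm_deriv_le (f := logDeriv g)
    (fun w hw => ?_) hddl (Metric.mem_closedBall_self (by positivity)) ?_
  · refine hld.differentiableAt (Metric.isOpen_ball.mem_nhds ?_)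
    simp only [Metric.mem_closedBall, Metric.mem_ball] at hw ⊢
    linarith
  · simpa [dist_eq_norm] using hz

theorem Differentiable.analyticOrderAt_ne_top {f : ℂ → ℂ} (hf : Differentiable ℂ f) {c : ℂ}
    (hc : f c ≠ 0) (a : ℂ) : analyticOrderAt f a ≠ ⊤ := by
  refine AnalyticOnNhd.analyticOrderAt_ne_top_of_isPreconnected (U := Set.univ) (x := c)
    (fun z _ => hf.analyticAt z) isPreconnected_univ (Set.mem_univ _) (Set.mem_univ _) ?_
  rw [(hf.analyticAt c).analyticOrderAt_eq_zero.2 hc]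
  simp

theorem Differentiable.finite_zeros_closedBall {f : ℂ → ℂ} (hf : Differentiable ℂ f) {c : ℂ}
    (hc : f c ≠ 0) (R : ℝ) : {ρ | f ρ = 0 ∧ ‖ρ - c‖ ≤ R}.Finite := by
  have h1 : (f ⁻¹' {0})ᶜ ∈ codiscrete ℂ :=
    AnalyticOnNhd.preimage_zero_mem_codiscrete (fun z _ => hf.analyticAt z) hc
  have h2 : IsClosed (f ⁻¹' {0}) ∧ IsDiscrete (f ⁻¹' {0}) := by
    simpa using (mem_codiscrete'.mp h1)
  have h3 : (Metric.closedBall c R ∩ f ⁻¹' {0}).Finite :=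
    ((isCompact_closedBall c R).inter_right h2.1).finite (h2.2.mono Set.inter_subset_right)
  refine h3.subset fun ρ hρ => ⟨?_, hρ.1⟩
  simpa [dist_eq_norm] using hρ.2

/-- Truncated partial fraction expansion of the logarithmic derivative of an entire function. -/
theorem norm_sum_partialFraction_sub_le {f : ℂ → ℂ} (hf : Differentiable ℂ f) {c z : ℂ}
    (hc : f c ≠ 0) (hz : f z ≠ 0) {R A : ℝ} (hR : 0 < R)
    (hA : ∀ w, ‖w - c‖ ≤ 2 * R → ‖f w‖ ≤ Real.exp A) (hzR : ‖z - c‖ ≤ R / 8) :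
    ‖(∑ ρ ∈ (hf.finite_zeros_closedBall hc R).toFinset,
        (analyticOrderNatAt f ρ : ℂ) * (1 / (z - ρ) - 1 / (c - ρ)))
      - (logDeriv f z - logDeriv f c)‖
      ≤ 128 * (A - Real.log ‖f c‖ + 1) / R ^ 2 * ‖z - c‖ := by
  set S := (hf.finite_zeros_closedBall hc R).toFinset with hS
  have hmem : ∀ ρ, ρ ∈ S ↔ f ρ = 0 ∧ ‖ρ - c‖ ≤ R := by simp [hS]
  obtain ⟨g, hg, hfg, hgS⟩ := hf.exists_eq_prod_pow_mul (hf.analyticOrderAt_ne_top hc) S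
  set P : ℂ → ℂ := fun w => ∏ ρ ∈ S, (w - ρ) ^ analyticOrderNatAt f ρ with hP
  have hPd : Differentiable ℂ P := by fun_prop
  have hfg' : ∀ w, f w = P w * g w := hfg
  have hfc : 0 < ‖f c‖ := norm_pos_iff.2 hc
  have hgc : g c ≠ 0 := fun h => hc (by rw [hfg', h, mul_zero])
  have hPc : P c ≠ 0 := fun h => hc (by rw [hfg', h, zero_mul])
  have hlog : Real.log ‖f c‖ ≤ A := by
    rw [← Real.log_exp A]
    exact Real.log_le_log hfc (hA c (by simp; positivity))
  have hgne : ∀ w ∈ Metric.ball c R, g w ≠ 0 := by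
    intro w hw h0
    refine hgS w ((hmem w).2 ⟨by rw [hfg', h0, mul_zero], ?_⟩) h0
    rw [Metric.mem_ball, dist_eq_norm] at hw
    exact hw.le
  have hPle : ∀ w, ‖w - c‖ = 2 * R → ‖P c‖ ≤ ‖P w‖ := by
    intro w hw
    simp only [hP, norm_prod, norm_pow]
    refine Finset.prod_le_prod (fun _ _ => by positivity) fun ρ hρ => ?_
    refine pow_le_pow_left₀ (norm_nonneg _) ?_ _
    have h1 := ((hmem ρ).1 hρ).2
    have h2 := norm_sub_norm_le (w - c) (ρ - c)
    rw [sub_sub_sub_cancel_right] at h2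
    rw [norm_sub_rev c ρ]
    linarith
  have hbd : ∀ w ∈ Metric.ball c R, ‖g w‖ ≤ ‖g c‖ * Real.exp (A - Real.log ‖f c‖ + 1) := by
    intro w hw
    refine Complex.norm_le_of_forall_mem_frontier_norm_le (U := Metric.ball c (2 * R))
      Metric.isBounded_ball hg.diffContOnCl ?_ (subset_closure ?_)
    · intro v hv
      rw [frontier_ball c (by positivity), mem_sphere_iff_norm] at hv
      have h1 := hA v hv.le
      have h2 := hPle v hv
      have hPc' : 0 < ‖P c‖ := norm_pos_iff.2 hPc
      rw [hfg' v, norm_mul] at h1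
      have h3 : ‖P c‖ * ‖g v‖ ≤ Real.exp A :=
        (mul_le_mul_of_nonneg_right h2 (norm_nonneg _)).trans h1
      have h4 : ‖f c‖ = ‖P c‖ * ‖g c‖ := by rw [hfg' c, norm_mul]
      have h5 : Real.exp A ≤ ‖f c‖ * Real.exp (A - Real.log ‖f c‖ + 1) := by
        conv_rhs => rw [← Real.exp_log hfc, ← Real.exp_add]
        apply Real.exp_le_exp.2
        rw [Real.log_exp]
        linarith
      rw [h4, mul_assoc] at h5
      refine le_of_mul_le_mul_left (h3.trans (h5.trans ?_)) hPc'
      rw [← h4]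
    · rw [Metric.mem_ball] at hw ⊢
      linarith
  have hmain := norm_logDeriv_sub_logDeriv_le (z := z) hR (by linarith) hg hgne hbd hzR
  have hld : ∀ w, f w ≠ 0 → logDeriv f w =
      (∑ ρ ∈ S, (analyticOrderNatAt f ρ : ℂ) * (1 / (w - ρ))) + logDeriv g w := by
    intro w hw
    have hPw : P w ≠ 0 := fun h => hw (by rw [hfg', h, zero_mul])
    have hgw : g w ≠ 0 := fun h => hw (by rw [hfg', h, mul_zero])
    have : f = fun w => P w * g w := funext hfg'
    conv_lhs => rw [this]
    rw [logDeriv_mul w hPw hgw (hPd w) (hg w)]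
    congr 1
    rw [hP, logDeriv_prod]
    · refine Finset.sum_congr rfl fun ρ _ => ?_
      rw [logDeriv_fun_pow (by fun_prop)]
      simp [logDeriv_apply]
    · intro ρ hρ
      exact Finset.prod_ne_zero_iff.1 hPw ρ hρ
    · intro ρ hρ
      fun_prop
  rw [hld z hz, hld c hc]
  have : (∑ ρ ∈ S, (analyticOrderNatAt f ρ : ℂ) * (1 / (z - ρ) - 1 / (c - ρ))) =
      (∑ ρ ∈ S, (analyticOrderNatAt f ρ : ℂ) * (1 / (z - ρ))) -
      ∑ ρ ∈ S, (analyticOrderNatAt f ρ : ℂ) * (1 / (c - ρ)) := by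
    rw [← Finset.sum_sub_distrib]
    exact Finset.sum_congr rfl fun _ _ => by ring
  rw [this, ← norm_neg]
  refine (le_of_eq (congrArg norm ?_)).trans hmain
  ring

/-- Partial fraction expansion of the logarithmic derivative of an entire function of order less
than two, as a limit of finite sums over zeros. -/
theorem tendsto_sum_partialFraction {f : ℂ → ℂ} (hf : Differentiable ℂ f) {c z : ℂ}
    (hc : f c ≠ 0) (hz : f z ≠ 0) {A : ℝ → ℝ}
    (hA : ∀ R, 0 < R → ∀ w, ‖w - c‖ ≤ R → ‖f w‖ ≤ Real.exp (A R))
    (hlim : Tendsto (fun R => A R / R ^ 2) atTop (𝓝 0)) :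
    Tendsto (fun R : ℝ => ∑ ρ ∈ (hf.finite_zeros_closedBall hc R).toFinset,
        (analyticOrderNatAt f ρ : ℂ) * (1 / (z - ρ) - 1 / (c - ρ))) atTop
      (𝓝 (logDeriv f z - logDeriv f c)) := by
  rw [tendsto_iff_norm_sub_tendsto_zero]
  have hlim2 : Tendsto (fun R : ℝ => A (2 * R) / (2 * R) ^ 2) atTop (𝓝 0) :=
    hlim.comp (tendsto_id.const_mul_atTop (by norm_num : (0 : ℝ) < 2))
  have hinv : Tendsto (fun R : ℝ => 1 / R ^ 2) atTop (𝓝 0) := by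
    simpa using tendsto_pow_neg_atTop (𝕜 := ℝ) (n := 2) (by norm_num)
  have hB : Tendsto (fun R : ℝ => 128 * (A (2 * R) - Real.log ‖f c‖ + 1) / R ^ 2 * ‖z - c‖)
      atTop (𝓝 0) := by
    have := ((hlim2.const_mul 512).add (hinv.const_mul (128 * (1 - Real.log ‖f c‖)))).mul_const
      ‖z - c‖
    simp only [mul_zero, add_zero, zero_mul] at this
    refine this.congr' ?_
    filter_upwards [eventually_gt_atTop 0] with R hR
    field_simp
    ring
  refine squeeze_zero' (Eventually.of_forall fun _ => norm_nonneg _) ?_ hB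
  filter_upwards [eventually_gt_atTop 0, eventually_ge_atTop (8 * ‖z - c‖)] with R hR hR2
  exact norm_sum_partialFraction_sub_le hf hc hz hR (hA (2 * R) (by positivity)) (by linarith)

theorem tendsto_sum_of_summable_of_support {E : Type*} [NormedAddCommGroup E] [CompleteSpace E]
    {g : ℂ → E} (hg : Summable fun ρ => ‖g ρ‖) {S : ℝ → Finset ℂ} {c : ℂ}
    (hS : ∀ R ρ, g ρ ≠ 0 → ‖ρ - c‖ ≤ R → ρ ∈ S R) :
    Tendsto (fun R => ∑ ρ ∈ S R, g ρ) atTop (𝓝 (∑' ρ, g ρ)) := by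
  have h1 : ∀ R, ∑ ρ ∈ S R, g ρ = ∑' ρ, (S R : Set ℂ).indicator g ρ := fun R =>
    (sum_eq_tsum_indicator g (S R))
  simp_rw [h1]
  refine tendsto_tsum_of_dominated_convergence hg (fun ρ => ?_) (Eventually.of_forall fun R ρ => ?_)
  · by_cases h0 : g ρ = 0
    · have : ∀ R, (S R : Set ℂ).indicator g ρ = 0 := fun R => by
        simp [Set.indicator_apply, h0]
      simp [this, h0]
    · refine tendsto_const_nhds.congr' ?_
      filter_upwards [eventually_ge_atTop ‖ρ - c‖] with R hR
      rw [Set.indicator_of_mem]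
      exact hS R ρ h0 hR
  · exact norm_indicator_le_norm_self g ρ

section CriticalLine

variable {f : ℂ → ℂ} (hf : Differentiable ℂ f) {c : ℂ} (hc : f c ≠ 0) {A : ℝ → ℝ}
  (hA : ∀ R, 0 < R → ∀ w, ‖w - c‖ ≤ R → ‖f w‖ ≤ Real.exp (A R))
  (hlim : Tendsto (fun R => A R / R ^ 2) atTop (𝓝 0))
  (hzero : ∀ ρ, f ρ = 0 → ρ.re = 1 / 2) (hcre : c.re = 1 / 2) (hc' : (logDeriv f c).re = 0)
include hzero

theorem ne_zero_of_half_lt_re {s : ℂ} (hs : 1 / 2 < s.re) : f s ≠ 0 := fun h =>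
  hs.ne' (hzero s h)

theorem re_mul_one_div_sub {s ρ : ℂ} :
    ((analyticOrderNatAt f ρ : ℂ) * (1 / (s - ρ))).re =
      (s.re - 1 / 2) * (analyticOrderNatAt f ρ / ‖s - ρ‖ ^ 2) := by
  by_cases h : analyticOrderNatAt f ρ = 0
  · simp [h]
  · have h1 := hzero ρ (apply_eq_zero_of_analyticOrderNatAt_ne_zero h)
    rw [one_div, ← Complex.ofReal_natCast, Complex.re_ofReal_mul, Complex.inv_re,
      Complex.sub_re, h1, Complex.normSq_eq_norm_sq]
    ring

theorem norm_sub_ge_of_order_ne_zero {s ρ : ℂ} (h : analyticOrderNatAt f ρ ≠ 0) :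
    s.re - 1 / 2 ≤ ‖s - ρ‖ := by
  have h1 := hzero ρ (apply_eq_zero_of_analyticOrderNatAt_ne_zero h)
  have := Complex.re_le_norm (s - ρ)
  rw [Complex.sub_re, h1] at this
  exact this

include hf hc hA hlim hcre hc'

theorem tendsto_sum_order_div_norm_sq {s : ℂ} (hs : 1 / 2 < s.re) :
    Tendsto (fun R : ℝ => ∑ ρ ∈ (hf.finite_zeros_closedBall hc R).toFinset,
        (s.re - 1 / 2) * (analyticOrderNatAt f ρ / ‖s - ρ‖ ^ 2)) atTop
      (𝓝 (logDeriv f s).re) := by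
  have h1 := (Complex.continuous_re.tendsto _).comp
    (tendsto_sum_partialFraction hf hc (ne_zero_of_half_lt_re hzero hs) hA hlim)
  rw [Complex.sub_re, hc', sub_zero] at h1
  refine h1.congr fun R => ?_
  simp only [Function.comp, Complex.re_sum]
  refine Finset.sum_congr rfl fun ρ _ => ?_
  rw [mul_sub, Complex.sub_re, re_mul_one_div_sub hzero, re_mul_one_div_sub hzero, hcre]
  ring

theorem summable_order_div_norm_sq {s : ℂ} (hs : 1 / 2 < s.re) :
    Summable fun ρ => (analyticOrderNatAt f ρ : ℝ) / ‖s - ρ‖ ^ 2 := by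
  have hpos : 0 < s.re - 1 / 2 := by linarith
  suffices Summable fun ρ => (s.re - 1 / 2) * ((analyticOrderNatAt f ρ : ℝ) / ‖s - ρ‖ ^ 2) from
    (summable_mul_left_iff hpos.ne').1 this
  refine summable_of_sum_le (c := (logDeriv f s).re) (fun ρ => mul_nonneg hpos.le (by positivity)) fun u => ?_
  refine ge_of_tendsto (tendsto_sum_order_div_norm_sq hf hc hA hlim hzero hcre hc' hs) ?_
  filter_upwards [eventually_ge_atTop (∑ ρ ∈ u, ‖ρ - c‖)] with R hR
  rw [← Finset.sum_filter_ne_zero]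
  refine Finset.sum_le_sum_of_subset_of_nonneg (fun ρ hρ => ?_)
    (fun _ _ _ => mul_nonneg hpos.le (by positivity))
  obtain ⟨hρ, hne⟩ := Finset.mem_filter.1 hρ
  rw [Set.Finite.mem_toFinset]
  refine ⟨apply_eq_zero_of_analyticOrderNatAt_ne_zero fun h => hne (by simp [h]), ?_⟩
  exact (Finset.single_le_sum (f := fun ρ => ‖ρ - c‖) (fun _ _ => norm_nonneg _) hρ).trans hR

theorem re_logDeriv_eq_tsum {s : ℂ} (hs : 1 / 2 < s.re) :
    (logDeriv f s).re = (s.re - 1 / 2) * ∑' ρ, (analyticOrderNatAt f ρ : ℝ) / ‖s - ρ‖ ^ 2 := by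
  rw [← tsum_mul_left]
  refine tendsto_nhds_unique
    (tendsto_sum_order_div_norm_sq hf hc hA hlim hzero hcre hc' hs) ?_
  refine tendsto_sum_of_summable_of_support (c := c)
    ((summable_order_div_norm_sq hf hc hA hlim hzero hcre hc' hs).mul_left _).norm ?_
  intro R ρ hne hR
  rw [Set.Finite.mem_toFinset]
  exact ⟨apply_eq_zero_of_analyticOrderNatAt_ne_zero fun h => hne (by simp [h]), hR⟩

theorem summable_norm_partialFraction {s z : ℂ} (hs : 1 / 2 < s.re) (hz : 1 / 2 < z.re) :
    Summable fun ρ => ‖(analyticOrderNatAt f ρ : ℂ) * (1 / (z - ρ) - 1 / (s - ρ))‖ := by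
  have h1 := summable_order_div_norm_sq hf hc hA hlim hzero hcre hc' hs
  have h2 := summable_order_div_norm_sq hf hc hA hlim hzero hcre hc' hz
  refine Summable.of_nonneg_of_le (fun _ => norm_nonneg _) (fun ρ => ?_)
    ((h1.add h2).mul_left ‖s - z‖)
  by_cases h : analyticOrderNatAt f ρ = 0
  · simp [h]
  · have hsρ : 0 < ‖s - ρ‖ := by
      have := norm_sub_ge_of_order_ne_zero hzero (s := s) h
      linarith
    have hzρ : 0 < ‖z - ρ‖ := by
      have := norm_sub_ge_of_order_ne_zero hzero (s := z) h
      linarith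
    have e : 1 / (z - ρ) - 1 / (s - ρ) = (s - z) / ((z - ρ) * (s - ρ)) := by
      rw [div_sub_div _ _ (norm_pos_iff.1 hzρ) (norm_pos_iff.1 hsρ)]
      ring
    rw [e, norm_mul, norm_div, norm_mul, Complex.norm_natCast]
    have h3 : 1 / (‖z - ρ‖ * ‖s - ρ‖) ≤ 1 / ‖s - ρ‖ ^ 2 + 1 / ‖z - ρ‖ ^ 2 := by
      rw [div_add_div _ _ (by positivity) (by positivity), div_le_div_iff₀ (by positivity)
        (by positivity)]
      nlinarith [mul_pos hsρ hzρ, sq_nonneg (‖s - ρ‖ - ‖z - ρ‖)]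
    calc (analyticOrderNatAt f ρ : ℝ) * (‖s - z‖ / (‖z - ρ‖ * ‖s - ρ‖))
        = analyticOrderNatAt f ρ * ‖s - z‖ * (1 / (‖z - ρ‖ * ‖s - ρ‖)) := by ring
      _ ≤ analyticOrderNatAt f ρ * ‖s - z‖ * (1 / ‖s - ρ‖ ^ 2 + 1 / ‖z - ρ‖ ^ 2) := by gcongr
      _ = _ := by ring

theorem hasSum_partialFraction {s z : ℂ} (hs : 1 / 2 < s.re) (hz : 1 / 2 < z.re) :
    HasSum (fun ρ => (analyticOrderNatAt f ρ : ℂ) * (1 / (z - ρ) - 1 / (s - ρ)))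
      (logDeriv f z - logDeriv f s) := by
  have h1 := summable_norm_partialFraction hf hc hA hlim hzero hcre hc' hs hz
  rw [h1.of_norm.hasSum_iff]
  refine tendsto_nhds_unique (f := fun R : ℝ =>
    ∑ ρ ∈ (hf.finite_zeros_closedBall hc R).toFinset,
        (analyticOrderNatAt f ρ : ℂ) * (1 / (z - ρ) - 1 / (s - ρ))) (l := atTop)
    (tendsto_sum_of_summable_of_support (c := c) h1 ?_) ?_
  · intro R ρ hne hR
    rw [Set.Finite.mem_toFinset]
    exact ⟨apply_eq_zero_of_analyticOrderNatAt_ne_zero fun h => hne (by simp [h]), hR⟩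
  · have h2 := tendsto_sum_partialFraction hf hc (ne_zero_of_half_lt_re hzero hs) hA hlim
    have h3 := tendsto_sum_partialFraction hf hc (ne_zero_of_half_lt_re hzero hz) hA hlim
    have h4 := h3.sub h2
    rw [sub_sub_sub_cancel_right] at h4
    refine h4.congr fun R => ?_
    rw [← Finset.sum_sub_distrib]
    exact Finset.sum_congr rfl fun _ _ => by ring

end CriticalLine

theorem norm_GammaSeq_le {s : ℂ} (hs : 0 < s.re) {n : ℕ} (hn : n ≠ 0) :
    ‖Complex.GammaSeq s n‖ ≤ Real.Gamma s.re := by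
  rw [Complex.GammaSeq_eq_approx_Gamma_integral hs hn, Real.Gamma_eq_integral hs]
  rw [intervalIntegral.integral_of_le (Nat.cast_nonneg n)]
  refine (norm_integral_le_of_norm_le (μ := volume.restrict (Set.Ioc 0 (n : ℝ)))
    (g := fun x => Real.exp (-x) * x ^ (s.re - 1)) ?_ ?_).trans ?_
  · exact (Real.GammaIntegral_convergent hs).mono_set Set.Ioc_subset_Ioi_self
  · refine (ae_restrict_iff' measurableSet_Ioc).2 (Eventually.of_forall fun x hx => ?_)
    rw [norm_mul, Complex.norm_cpow_eq_rpow_re_of_pos hx.1, Complex.sub_re, Complex.one_re,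
      Complex.norm_real, Real.norm_eq_abs]
    have h1 : (0 : ℝ) ≤ 1 - x / n := by
      rw [sub_nonneg]; exact div_le_one_of_le₀ hx.2 (Nat.cast_nonneg n)
    rw [abs_of_nonneg (pow_nonneg h1 n)]
    gcongr
    · exact Real.rpow_nonneg hx.1.le _
    · exact Real.one_sub_div_pow_le_exp_neg hx.2
  · refine setIntegral_mono_set (Real.GammaIntegral_convergent hs) ?_
      Set.Ioc_subset_Ioi_self.eventuallyLE
    refine (ae_restrict_iff' measurableSet_Ioi).2 (Eventually.of_forall fun x hx => ?_)
    have : (0 : ℝ) < x := hx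
    positivity

theorem add_natCast_ne_zero_of_re_pos {s : ℂ} (hs : 0 < s.re) (j : ℕ) : s + j ≠ 0 := fun h => by
  have := congrArg Complex.re h
  simp at this
  have hj : (0 : ℝ) ≤ j := Nat.cast_nonneg j
  linarith

theorem differentiableAt_GammaSeq {s : ℂ} (hs : 0 < s.re) {n : ℕ} (hn : n ≠ 0) :
    DifferentiableAt ℂ (fun z => Complex.GammaSeq z n) s := by
  unfold Complex.GammaSeq
  refine DifferentiableAt.div ?_ (by fun_prop) (Finset.prod_ne_zero_iff.2 fun j _ =>
    add_natCast_ne_zero_of_re_pos hs j)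
  exact (differentiableAt_id.const_cpow (Or.inl (Nat.cast_ne_zero.2 hn))).mul_const _

theorem logDeriv_GammaSeq {s : ℂ} (hs : 0 < s.re) {n : ℕ} (hn : n ≠ 0) :
    logDeriv (fun z => Complex.GammaSeq z n) s =
      Real.log n - ∑ j ∈ Finset.range (n + 1), 1 / (s + j) := by
  unfold Complex.GammaSeq
  have hn' : (n : ℂ) ≠ 0 := Nat.cast_ne_zero.2 hn
  have hd : DifferentiableAt ℂ (fun z : ℂ => (n : ℂ) ^ z) s :=
    differentiableAt_id.const_cpow (Or.inl hn')
  have hfac : ((n.factorial : ℕ) : ℂ) ≠ 0 := Nat.cast_ne_zero.2 n.factorial_ne_zero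
  have hc : (n : ℂ) ^ s ≠ 0 := by simp [Complex.cpow_eq_zero_iff, hn]
  rw [logDeriv_div (f := fun z : ℂ => (n : ℂ) ^ z * (n.factorial : ℂ)) s (_root_.mul_ne_zero hc hfac) (Finset.prod_ne_zero_iff.2 fun j _ =>
    add_natCast_ne_zero_of_re_pos hs j) (hd.mul_const _) (by fun_prop)]
  congr 1
  · rw [logDeriv_mul_const s _ hfac, logDeriv_apply]
    have : HasDerivAt (fun z : ℂ => (n : ℂ) ^ z) ((n : ℂ) ^ s * Complex.log n * 1) s :=
      (hasDerivAt_id s).const_cpow (Or.inl hn')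
    rw [this.deriv, mul_one, mul_div_cancel_left₀ _ hc, Complex.natCast_log]
  · rw [logDeriv_prod]
    · refine Finset.sum_congr rfl fun j _ => ?_
      simp [logDeriv_apply]
    · exact fun j _ => add_natCast_ne_zero_of_re_pos hs j
    · exact fun j _ => by fun_prop

theorem tendsto_deriv_GammaSeq {s : ℂ} (hs : 0 < s.re) :
    Tendsto (fun n : ℕ => deriv (fun z => Complex.GammaSeq z n) s) atTop
      (𝓝 (deriv Complex.Gamma s)) := by
  set r := s.re / 2 with hr
  have hr0 : 0 < r := by positivity
  have hball : ∀ z ∈ Metric.closedBall s r, 0 < z.re := by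
    intro z hz
    rw [Metric.mem_closedBall, dist_eq_norm] at hz
    have := (Complex.abs_re_le_norm (z - s)).trans hz
    rw [Complex.sub_re, abs_le] at this
    linarith
  have hG : ∀ z : ℂ, 0 < z.re → DifferentiableAt ℂ Complex.Gamma z := fun z hz =>
    Complex.differentiableAt_Gamma z fun m h => by
      rw [h] at hz
      simp at hz
      have : (0 : ℝ) ≤ m := Nat.cast_nonneg m
      linarith
  have hcauchy : ∀ f : ℂ → ℂ, (∀ z, 0 < z.re → DifferentiableAt ℂ f z) →
      deriv f s = (2 * π * I)⁻¹ • ∮ z in C(s, r), (1 / (z - s) ^ 2) • f z := by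
    intro f hf
    rw [DiffContOnCl.deriv_eq_smul_circleIntegral hr0 (f := f),
      inv_smul_smul₀ Complex.two_pi_I_ne_zero]
    refine DifferentiableOn.diffContOnCl_ball (U := Metric.closedBall s r)
      (fun z hz => (hf z (hball z hz)).differentiableWithinAt) subset_rfl
  rw [hcauchy _ hG]
  refine Tendsto.congr' (f₁ := fun n : ℕ => (2 * π * I : ℂ)⁻¹ • ∮ z in C(s, r),
    (1 / (z - s) ^ 2) • Complex.GammaSeq z n) ?_ ?_
  · filter_upwards [eventually_ne_atTop 0] with n hn
    exact (hcauchy _ fun z hz => differentiableAt_GammaSeq hz hn).symm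
  refine Tendsto.const_smul ?_ _
  unfold circleIntegral
  have hmem : ∀ θ, circleMap s r θ ∈ Metric.closedBall s r := fun θ =>
    circleMap_mem_closedBall s hr0.le θ
  have hne : ∀ θ, circleMap s r θ - s ≠ 0 := fun θ => by
    simp [circleMap, hr0.ne']
  refine intervalIntegral.tendsto_integral_filter_of_dominated_convergence
    (fun θ => ‖deriv (circleMap s r) θ‖ * (‖1 / (circleMap s r θ - s) ^ 2‖ *
      Real.Gamma (circleMap s r θ).re)) ?_ ?_ ?_ ?_
  · filter_upwards [eventually_ne_atTop 0] with n hn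
    have hc : Continuous fun θ => Complex.GammaSeq (circleMap s r θ) n := by
      rw [continuous_iff_continuousAt]
      intro θ
      exact (differentiableAt_GammaSeq (hball _ (hmem θ)) hn).continuousAt.comp
        (f := circleMap s r) (continuous_circleMap s r).continuousAt
    refine Continuous.aestronglyMeasurable ?_
    simp only [deriv_circleMap]
    refine Continuous.smul ((continuous_circleMap 0 r).mul continuous_const)
      (Continuous.smul (f := fun θ => 1 / (circleMap s r θ - s) ^ 2) ?_ hc)
    exact Continuous.div continuous_const
      (((continuous_circleMap s r).sub continuous_const).pow 2) fun θ => pow_ne_zero _ (hne θ)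
  · filter_upwards [eventually_ne_atTop 0] with n hn
    refine Eventually.of_forall fun θ _ => ?_
    rw [norm_smul, norm_smul]
    gcongr
    exact norm_GammaSeq_le (hball _ (hmem θ)) hn
  · refine Continuous.intervalIntegrable ?_ _ _
    simp only [deriv_circleMap]
    refine Continuous.mul ((continuous_circleMap 0 r).mul continuous_const).norm
      (Continuous.mul ?_ ?_)
    · exact (Continuous.div continuous_const
        (((continuous_circleMap s r).sub continuous_const).pow 2) fun θ => pow_ne_zero _ (hne θ)).norm
    · rw [continuous_iff_continuousAt]
      intro θ
      refine ContinuousAt.comp (f := fun θ => (circleMap s r θ).re) (g := Real.Gamma) ?_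
        (Complex.continuous_re.comp (continuous_circleMap s r)).continuousAt
      refine (Real.differentiableAt_Gamma fun m h => ?_).continuousAt
      have h1 := hball _ (hmem θ)
      have : (0 : ℝ) ≤ m := Nat.cast_nonneg m
      linarith
  · refine Eventually.of_forall fun θ _ => ?_
    exact ((Complex.GammaSeq_tendsto_Gamma _).const_smul _).const_smul _

theorem tendsto_digamma {s : ℂ} (hs : 0 < s.re) :
    Tendsto (fun n : ℕ => (Real.log n : ℂ) - ∑ j ∈ Finset.range (n + 1), 1 / (s + j)) atTop
      (𝓝 (Complex.digamma s)) := by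
  have h1 := (tendsto_deriv_GammaSeq hs).div (Complex.GammaSeq_tendsto_Gamma s)
    (Complex.Gamma_ne_zero_of_re_pos hs)
  rw [Complex.digamma_def, logDeriv_apply]
  refine h1.congr' ?_
  filter_upwards [eventually_ne_atTop 0] with n hn
  exact logDeriv_GammaSeq hs hn

theorem norm_one_div_add_sub_le {z w : ℂ} (hz : 1 / 4 ≤ z.re) (hw : 1 / 4 ≤ w.re) (j : ℕ) :
    ‖1 / (z + j) - 1 / (w + j)‖ ≤ ‖w - z‖ * (1 / ((j : ℝ) + 1 / 4) ^ 2) := by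
  have hj : (0 : ℝ) ≤ j := Nat.cast_nonneg j
  have key : ∀ v : ℂ, 1 / 4 ≤ v.re → (j : ℝ) + 1 / 4 ≤ ‖v + j‖ := fun v hv => by
    have := Complex.re_le_norm (v + j)
    simp at this
    linarith
  have h1 := key z hz
  have h2 := key w hw
  have hz0 := add_natCast_ne_zero_of_re_pos (s := z) (by linarith) j
  have hw0 := add_natCast_ne_zero_of_re_pos (s := w) (by linarith) j
  have e : 1 / (z + j) - 1 / (w + j) = (w - z) / ((z + j) * (w + j)) := by
    rw [div_sub_div _ _ hz0 hw0]
    ring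
  rw [e, norm_div, norm_mul, div_eq_mul_one_div, sq]
  gcongr

theorem summable_one_div_add_quarter_sq :
    Summable fun j : ℕ => 1 / ((j : ℝ) + 1 / 4) ^ 2 := by
  have := (Real.summable_one_div_nat_add_rpow (1 / 4) 2).2 (by norm_num)
  refine this.congr fun j => ?_
  have hj : (0 : ℝ) ≤ j := Nat.cast_nonneg j
  rw [abs_of_nonneg (by positivity)]
  norm_cast

theorem hasSum_digamma_sub {z w : ℂ} (hz : 1 / 4 ≤ z.re) (hw : 1 / 4 ≤ w.re) :
    HasSum (fun j : ℕ => 1 / (z + j) - 1 / (w + j)) (Complex.digamma w - Complex.digamma z) := by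
  have hsum : Summable fun j : ℕ => 1 / (z + j) - 1 / (w + j) :=
    Summable.of_norm_bounded (summable_one_div_add_quarter_sq.mul_left ‖w - z‖)
      (norm_one_div_add_sub_le hz hw)
  rw [hsum.hasSum_iff]
  refine tendsto_nhds_unique
    ((hsum.hasSum.tendsto_sum_nat).comp (tendsto_add_atTop_nat 1)) ?_
  have h := (tendsto_digamma (s := w) (by linarith)).sub (tendsto_digamma (s := z) (by linarith))
  refine h.congr fun n => ?_
  simp only [Function.comp, Finset.sum_sub_distrib]
  ring

theorem norm_digamma_sub_le {z w : ℂ} (hz : 1 / 4 ≤ z.re) (hw : 1 / 4 ≤ w.re) :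
    ‖Complex.digamma w - Complex.digamma z‖ ≤
      ‖w - z‖ * ∑' j : ℕ, 1 / ((j : ℝ) + 1 / 4) ^ 2 := by
  rw [← (hasSum_digamma_sub hz hw).tsum_eq, ← tsum_mul_left]
  exact tsum_of_norm_bounded (summable_one_div_add_quarter_sq.mul_left ‖w - z‖).hasSum
    (norm_one_div_add_sub_le hz hw)

theorem re_digamma_le {z : ℂ} (hz : 1 / 4 ≤ z.re) :
    (Complex.digamma z).re ≤ Real.log ‖z‖ + ∑' j : ℕ, 1 / ((j : ℝ) + 1 / 4) ^ 2 := by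
  have hlim := (Complex.continuous_re.tendsto _).comp (tendsto_digamma (s := z) (by linarith))
  refine le_of_tendsto hlim ?_
  filter_upwards [eventually_ne_atTop 0] with n hn
  have hge : ∀ j : ℕ, (j : ℝ) + 1 / 4 ≤ ‖z + j‖ := fun j => by
    have := Complex.re_le_norm (z + j)
    simp at this
    linarith
  have hterm : ∀ j : ℕ, Real.log ‖z + (j + 1 : ℕ)‖ - Real.log ‖z + j‖
      - 1 / ((j : ℝ) + 1 / 4) ^ 2 ≤ (1 / (z + j)).re := by
    intro j
    have hj : (0 : ℝ) ≤ j := Nat.cast_nonneg j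
    have h0 : 0 < ‖z + j‖ := by linarith [hge j]
    have h1 : 0 < ‖z + (j + 1 : ℕ)‖ := by
      have := hge (j + 1)
      push_cast at this ⊢
      linarith
    have hsq : ∀ k : ℕ, ‖z + k‖ ^ 2 = (z.re + k) ^ 2 + z.im ^ 2 := fun k => by
      rw [← Complex.normSq_eq_norm_sq, Complex.normSq_apply]
      simp
      ring
    have h2 : 2 * Real.log (‖z + (j + 1 : ℕ)‖ / ‖z + j‖) ≤
        ‖z + (j + 1 : ℕ)‖ ^ 2 / ‖z + j‖ ^ 2 - 1 := by
      have := Real.log_le_sub_one_of_pos (x := (‖z + (j + 1 : ℕ)‖ / ‖z + j‖) ^ 2) (by positivity)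
      rw [Real.log_pow, div_pow] at this
      exact_mod_cast this
    rw [Real.log_div h1.ne' h0.ne'] at h2
    have h3 : ‖z + (j + 1 : ℕ)‖ ^ 2 / ‖z + j‖ ^ 2 - 1 =
        2 * ((z.re + j) / ‖z + j‖ ^ 2) + 1 / ‖z + j‖ ^ 2 := by
      field_simp
      rw [hsq, hsq]
      push_cast
      ring
    have h4 : (1 / (z + j)).re = (z.re + j) / ‖z + j‖ ^ 2 := by
      rw [one_div, Complex.inv_re, Complex.normSq_eq_norm_sq]
      simp
    have h5 : 1 / ‖z + j‖ ^ 2 ≤ 1 / ((j : ℝ) + 1 / 4) ^ 2 := by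
      gcongr
      exact hge j
    have h6 : 0 ≤ 1 / ((j : ℝ) + 1 / 4) ^ 2 := by positivity
    rw [h4]
    linarith
  have hsum := Finset.sum_le_sum fun j (_ : j ∈ Finset.range (n + 1)) => hterm j
  rw [Finset.sum_sub_distrib, Finset.sum_range_sub (fun j : ℕ => Real.log ‖z + j‖)] at hsum
  have htail := summable_one_div_add_quarter_sq.sum_le_tsum (Finset.range (n + 1))
    fun _ _ => by positivity
  have hlog : Real.log n ≤ Real.log ‖z + (n + 1 : ℕ)‖ := by
    refine Real.log_le_log (by positivity) ?_
    have := hge (n + 1)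
    push_cast at this ⊢
    linarith
  simp only [Function.comp, Complex.sub_re, Complex.ofReal_re, Complex.re_sum]
  simp only [Nat.cast_zero, add_zero] at hsum
  linarith

theorem norm_sum_range_dirichletCharacter_le {q : ℕ} [NeZero q] {χ : DirichletCharacter ℂ q}
    (hχ : χ ≠ 1) (n : ℕ) : ‖∑ k ∈ Finset.range n, χ k‖ ≤ q := by
  induction n using Nat.strong_induction_on with
  | _ n ih =>
    rcases lt_or_ge n q with h | h
    · refine (norm_sum_le_of_le (f := fun k : ℕ => χ k) (n := fun _ => 1) (Finset.range n)
        fun k _ => χ.norm_le_one _).trans ?_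
      simpa using h.le
    · obtain ⟨m, rfl⟩ := Nat.exists_eq_add_of_le h
      have h0 : ∑ k ∈ Finset.range q, χ (k : ZMod q) = 0 := by
        rw [← MulChar.sum_eq_zero_of_ne_one hχ]
        refine Finset.sum_nbij' (fun k => (k : ZMod q)) ZMod.val ?_ ?_ ?_ ?_ ?_
        · simp
        · intro a _
          simpa using ZMod.val_lt a
        · intro a ha
          exact ZMod.val_cast_of_lt (Finset.mem_range.1 ha)
        · intro a _
          exact ZMod.natCast_zmod_val a
        · simp
      rw [Finset.sum_range_add, h0, zero_add]
      simp only [Nat.cast_add, CharP.cast_eq_zero, zero_add]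
      exact ih m (by have := NeZero.pos q; omega)

theorem sum_Icc_dirichletCharacter_eq {q : ℕ} [NeZero q] (hq : 1 < q) (χ : DirichletCharacter ℂ q)
    (n : ℕ) : ∑ k ∈ Finset.Icc 1 n, χ k = ∑ k ∈ Finset.range (n + 1), χ k := by
  rw [Finset.sum_range_succ', Finset.range_eq_Ico, Finset.sum_Ico_add' (fun k : ℕ => χ k) 0 n 1]
  have : χ ((0 : ℕ) : ZMod q) = 0 := by
    have : Fact (1 < q) := ⟨hq⟩
    rw [Nat.cast_zero]
    exact χ.map_zero
  rw [this, add_zero]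
  rfl

theorem norm_sum_Icc_dirichletCharacter_le {q : ℕ} [NeZero q] (hq : 1 < q)
    {χ : DirichletCharacter ℂ q} (hχ : χ ≠ 1) (n : ℕ) :
    ‖∑ k ∈ Finset.Icc 1 n, χ k‖ ≤ q := by
  rw [sum_Icc_dirichletCharacter_eq hq]
  exact norm_sum_range_dirichletCharacter_le hχ _

theorem LFunction_eq_mul_integral {q : ℕ} [NeZero q] (hq : 1 < q) {χ : DirichletCharacter ℂ q}
    (hχ : χ ≠ 1) {s : ℂ} (hs : 0 < s.re) :
    DirichletCharacter.LFunction χ s =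
      s * ∫ t in Set.Ioi (1 : ℝ), (∑ k ∈ Finset.Icc 1 ⌊t⌋₊, χ k) * (t : ℂ) ^ (-(s + 1)) := by
  set S : ℝ → ℂ := (Set.Ioi (1 : ℝ)).indicator fun t => ∑ k ∈ Finset.Icc 1 ⌊t⌋₊, χ k with hS
  have hSb : ∀ t, ‖S t‖ ≤ q := fun t => by
    rw [hS]
    exact (norm_indicator_le_norm_self _ _).trans (norm_sum_Icc_dirichletCharacter_le hq hχ _)
  have hmeas : Measurable S :=
    ((measurable_from_nat (f := fun n : ℕ => ∑ k ∈ Finset.Icc 1 n, χ k)).comp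
      Nat.measurable_floor).indicator measurableSet_Ioi
  have hmellin : ∀ z : ℂ, mellin S (-z) =
      ∫ t in Set.Ioi (1 : ℝ), (∑ k ∈ Finset.Icc 1 ⌊t⌋₊, χ k) * (t : ℂ) ^ (-(z + 1)) := by
    intro z
    unfold mellin
    rw [← integral_indicator measurableSet_Ioi, ← integral_indicator measurableSet_Ioi]
    refine integral_congr_ae (Eventually.of_forall fun t => ?_)
    by_cases h1 : 1 < t
    · have h0 : 0 < t := by linarith
      simp only [hS, Set.indicator, Set.mem_Ioi, h1, h0, if_true, smul_eq_mul]
      rw [mul_comm, show -z - 1 = -(z + 1) by ring]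
    · simp [hS, Set.indicator, h1]
  have hdiff : DifferentiableOn ℂ (fun z => z * mellin S (-z)) {z : ℂ | 0 < z.re} := by
    intro z hz
    refine DifferentiableAt.differentiableWithinAt ?_
    refine differentiableAt_id.mul (DifferentiableAt.comp (g := mellin S) z ?_ differentiableAt_id.neg)
    refine mellin_differentiableAt_of_isBigO_rpow (a := 0) (b := -z.re - 1) ?_ ?_ ?_ ?_ ?_
    · refine LocallyIntegrable.locallyIntegrableOn ?_ _
      refine (locallyIntegrable_const (q : ℝ)).mono hmeas.aestronglyMeasurable
        (Eventually.of_forall fun t => ?_)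
      rw [Real.norm_natCast]
      exact hSb t
    · simp only [neg_zero, Real.rpow_zero]
      refine Asymptotics.IsBigO.of_bound q (Eventually.of_forall fun t => ?_)
      simpa using hSb t
    · simpa using hz
    · refine Asymptotics.IsBigO.of_bound 1 ?_
      have : ∀ᶠ t : ℝ in 𝓝[>] 0, t < 1 :=
        nhdsWithin_le_nhds (Iio_mem_nhds (by norm_num))
      filter_upwards [this] with t ht
      simp [hS, ht.le.not_gt]
    · simp
  have hopen : IsOpen {z : ℂ | 0 < z.re} := isOpen_lt continuous_const Complex.continuous_re
  have hEq := AnalyticOnNhd.eqOn_of_preconnected_of_eventuallyEq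
    (((DirichletCharacter.differentiable_LFunction hχ).differentiableOn).analyticOnNhd hopen)
    (hdiff.analyticOnNhd hopen)
    ((convex_halfSpace_re_gt 0).isPreconnected) (z₀ := 2) (by simp) ?_
  · rw [hEq hs, ← hmellin]
  · have : {z : ℂ | 1 < z.re} ∈ 𝓝 (2 : ℂ) :=
      (isOpen_lt continuous_const Complex.continuous_re).mem_nhds (by simp)
    filter_upwards [this] with z hz
    rw [DirichletCharacter.LFunction_eq_LSeries χ hz, hmellin,
      LSeries_eq_mul_integral (fun n => χ n) le_rfl (lt_trans zero_lt_one hz)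
        (DirichletCharacter.LSeriesSummable_of_one_lt_re χ hz)]
    refine Asymptotics.IsBigO.of_bound q (Eventually.of_forall fun n => ?_)
    simpa using norm_sum_Icc_dirichletCharacter_le hq hχ n

theorem norm_LFunction_le {q : ℕ} [NeZero q] (hq : 1 < q) {χ : DirichletCharacter ℂ q}
    (hχ : χ ≠ 1) {s : ℂ} (hs : 0 < s.re) :
    ‖DirichletCharacter.LFunction χ s‖ ≤ ‖s‖ * (q / s.re) := by
  rw [LFunction_eq_mul_integral hq hχ hs, norm_mul]
  gcongr
  have hi : IntegrableOn (fun t : ℝ => q * t ^ (-s.re - 1)) (Set.Ioi 1) :=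
    (integrableOn_Ioi_rpow_of_lt (by linarith) zero_lt_one).const_mul _
  refine (norm_integral_le_of_norm_le hi ?_).trans ?_
  · refine (ae_restrict_iff' measurableSet_Ioi).2 (Eventually.of_forall fun t ht => ?_)
    have ht0 : (0 : ℝ) < t := lt_trans zero_lt_one ht
    rw [norm_mul, Complex.norm_cpow_eq_rpow_re_of_pos ht0]
    rw [show (-(s + 1)).re = -s.re - 1 by simp; ring]
    gcongr
    exact norm_sum_Icc_dirichletCharacter_le hq hχ _
  · rw [integral_const_mul, integral_Ioi_rpow_of_lt (by linarith) zero_lt_one]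
    simp [div_eq_mul_inv]

theorem Real_Gamma_le_factorial {y : ℝ} (hy : 1 / 4 ≤ y) {n : ℕ} (hn : y + 1 ≤ n) :
    Real.Gamma y ≤ 4 * (n.factorial : ℝ) := by
  have h1 : Real.Gamma (y + 2) = (y + 1) * (y * Real.Gamma y) := by
    rw [show y + 2 = (y + 1) + 1 by ring, Real.Gamma_add_one (by linarith),
      Real.Gamma_add_one (by linarith)]
  have h2 : Real.Gamma (y + 2) ≤ n.factorial := by
    rw [← Real.Gamma_nat_eq_factorial]
    refine Real.Gamma_strictMonoOn_Ici.monotoneOn ?_ ?_ (by linarith)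
    · simp; linarith
    · simp; linarith
  have h3 := Real.Gamma_pos_of_pos (show 0 < y by linarith)
  rw [h1] at h2
  nlinarith [mul_le_mul_of_nonneg_right hy h3.le]

theorem norm_Gamma_le {z : ℂ} (hz : 0 < z.re) : ‖Complex.Gamma z‖ ≤ Real.Gamma z.re := by
  rw [Complex.Gamma_eq_integral hz, Real.Gamma_eq_integral hz, Complex.GammaIntegral]
  refine norm_integral_le_of_norm_le (Real.GammaIntegral_convergent hz) ?_
  refine (ae_restrict_iff' measurableSet_Ioi).2 (Eventually.of_forall fun x hx => ?_)
  rw [norm_mul, Complex.norm_cpow_eq_rpow_re_of_pos hx, Complex.sub_re, Complex.one_re,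
      Complex.norm_real, Real.norm_eq_abs, abs_of_pos (Real.exp_pos _)]

theorem conj_ofReal_cpow {a : ℝ} (ha : 0 ≤ a) (z : ℂ) :
    (starRingEnd ℂ) ((a : ℂ) ^ z) = (a : ℂ) ^ ((starRingEnd ℂ) z) := by
  rw [Complex.cpow_conj _ _ (by rw [Complex.arg_ofReal_of_nonneg ha]; exact Real.pi_pos.ne),
    Complex.conj_ofReal]

theorem conj_natCast_cpow (n : ℕ) (z : ℂ) :
    (starRingEnd ℂ) ((n : ℂ) ^ z) = (n : ℂ) ^ ((starRingEnd ℂ) z) := by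
  simpa using conj_ofReal_cpow n.cast_nonneg z

section Xi

variable {q : ℕ}

open scoped Classical in
/-- The parity of a Dirichlet character: `0` if it is even and `1` if it is odd. -/
noncomputable def parity (χ : DirichletCharacter ℂ q) : ℝ := if χ.Even then 0 else 1

theorem parity_nonneg (χ : DirichletCharacter ℂ q) : 0 ≤ parity χ := by
  unfold parity; split_ifs <;> norm_num

theorem parity_le_one (χ : DirichletCharacter ℂ q) : parity χ ≤ 1 := by
  unfold parity; split_ifs <;> norm_num

theorem gammaFactor_eq (χ : DirichletCharacter ℂ q) (s : ℂ) :
    DirichletCharacter.gammaFactor χ s = Gammaℝ (s + parity χ) := by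
  unfold DirichletCharacter.gammaFactor parity
  split_ifs <;> simp

variable [NeZero q]

/-- The completed `L`-function normalised by the conductor. -/
noncomputable def xiFun (χ : DirichletCharacter ℂ q) (s : ℂ) : ℂ :=
  (q : ℂ) ^ (s / 2) * DirichletCharacter.completedLFunction χ s

omit [NeZero q] in
theorem parity_inv (χ : DirichletCharacter ℂ q) : parity χ⁻¹ = parity χ := by
  have : χ⁻¹.Even ↔ χ.Even := by
    unfold DirichletCharacter.Even
    rw [MulChar.inv_apply_eq_inv', inv_eq_one]
  by_cases h : χ.Even
  · simp [parity, h, this.2 h]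
  · simp [parity, h, mt this.1 h]

theorem DirichletCharacter.IsPrimitive.ne_one' {χ : DirichletCharacter ℂ q} (hq : 1 < q)
    (hχ : χ.IsPrimitive) : χ ≠ 1 := fun h => by
  rw [h, DirichletCharacter.isPrimitive_def, DirichletCharacter.conductor_one] at hχ
  omega

omit [NeZero q] in
theorem gammaFactor_ne_zero (χ : DirichletCharacter ℂ q) {s : ℂ} (hs : 0 < s.re) :
    DirichletCharacter.gammaFactor χ s ≠ 0 := by
  rw [gammaFactor_eq]
  refine Gammaℝ_ne_zero_of_re_pos ?_
  have := parity_nonneg χ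
  simp; linarith

theorem xiFun_eq {χ : DirichletCharacter ℂ q} (hq : 1 < q) {s : ℂ} (hs : 0 < s.re) :
    xiFun χ s = (q : ℂ) ^ (s / 2) *
      (DirichletCharacter.LFunction χ s * Gammaℝ (s + parity χ)) := by
  rw [DirichletCharacter.LFunction_eq_completed_div_gammaFactor χ s (Or.inr hq.ne'),
    ← gammaFactor_eq, div_mul_cancel₀ _ (gammaFactor_ne_zero χ hs), xiFun]

theorem differentiable_xiFun {χ : DirichletCharacter ℂ q} (hχ : χ ≠ 1) :
    Differentiable ℂ (xiFun χ) := by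
  have hq : (q : ℂ) ≠ 0 := NeZero.ne _
  intro s
  exact ((differentiableAt_id.div_const 2).const_cpow (Or.inl hq)).mul
    (DirichletCharacter.differentiable_completedLFunction hχ s)

theorem xiFun_one_sub {χ : DirichletCharacter ℂ q} (hχ : χ.IsPrimitive) (s : ℂ) :
    xiFun χ (1 - s) = DirichletCharacter.rootNumber χ * xiFun χ⁻¹ s := by
  have hq : (q : ℂ) ≠ 0 := NeZero.ne _
  unfold xiFun
  rw [hχ.completedLFunction_one_sub, show s / 2 = (1 - s) / 2 + (s - 1 / 2) by ring,
    Complex.cpow_add _ _ hq]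
  ring

theorem xiFun_inv_eq_conj {χ : DirichletCharacter ℂ q} (hq : 1 < q) (hχ : χ ≠ 1) (s : ℂ) :
    xiFun χ⁻¹ s = (starRingEnd ℂ) (xiFun χ ((starRingEnd ℂ) s)) := by
  have hχ' : χ⁻¹ ≠ 1 := inv_ne_one.2 hχ
  have h1 : Differentiable ℂ (⇑(starRingEnd ℂ) ∘ xiFun χ ∘ ⇑(starRingEnd ℂ)) := fun z =>
    differentiableAt_conj_conj_iff.2 (differentiable_xiFun hχ _)
  refine congrFun (AnalyticOnNhd.eq_of_eventuallyEq (𝕜 := ℂ) (z₀ := 2)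
    ((differentiable_xiFun hχ').differentiableOn.analyticOnNhd isOpen_univ)
    (h1.differentiableOn.analyticOnNhd isOpen_univ) ?_) s
  have : {z : ℂ | 1 < z.re} ∈ 𝓝 (2 : ℂ) :=
    (isOpen_lt continuous_const Complex.continuous_re).mem_nhds (by simp)
  filter_upwards [this] with z hz
  have hz' : 1 < z.re := hz
  have hzc : 1 < ((starRingEnd ℂ) z).re := by simpa using hz'
  have h2 : (starRingEnd ℂ) (2 : ℂ) = 2 := map_ofNat _ 2
  simp only [Function.comp]
  rw [xiFun_eq hq (by linarith), xiFun_eq hq (by linarith), map_mul, map_mul, parity_inv]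
  congr 1
  · rw [conj_natCast_cpow]
    simp [h2]
  congr 1
  · rw [DirichletCharacter.LFunction_eq_LSeries _ hz', DirichletCharacter.LFunction_eq_LSeries _ hzc]
    unfold LSeries
    rw [Complex.conj_tsum]
    refine tsum_congr fun n => ?_
    unfold LSeries.term
    split_ifs with hn
    · simp
    · rw [map_div₀, conj_natCast_cpow]
      simp [← MulChar.star_apply']
  · unfold Gammaℝ
    rw [map_mul, ← Complex.Gamma_conj, conj_ofReal_cpow Real.pi_pos.le]
    simp [h2]

theorem xiFun_reflection {χ : DirichletCharacter ℂ q} (hq : 1 < q) (hχ : χ.IsPrimitive) (s : ℂ) :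
    xiFun χ s = DirichletCharacter.rootNumber χ *
      (starRingEnd ℂ) (xiFun χ (1 - (starRingEnd ℂ) s)) := by
  have := xiFun_one_sub hχ (1 - s)
  rw [sub_sub_cancel, xiFun_inv_eq_conj hq (hχ.ne_one' hq)] at this
  simpa using this

theorem re_logDeriv_xiFun_eq_zero {χ : DirichletCharacter ℂ q} (hq : 1 < q) (hχ : χ.IsPrimitive)
    {c : ℂ} (hc : c.re = 1 / 2) (hne : xiFun χ c ≠ 0) : (logDeriv (xiFun χ) c).re = 0 := by
  set f := xiFun χ with hf
  set W := DirichletCharacter.rootNumber χ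
  have hd : HasDerivAt f (deriv f c) c := (differentiable_xiFun (hχ.ne_one' hq) c).hasDerivAt
  have href : (1 - (starRingEnd ℂ) c) = c := by
    apply Complex.ext
    · simp [hc]; norm_num
    · simp
  have h1 : HasDerivAt (fun y : ℝ => f (c + y * I)) (deriv f c * I) 0 := by
    have h2 : HasDerivAt (fun y : ℝ => c + y * I) I 0 := by
      simpa using ((Complex.ofRealCLM.hasDerivAt (x := 0)).mul_const I).const_add c
    have h3 : HasDerivAt f (deriv f c) (c + (0 : ℝ) * I) := by simpa using hd
    exact h3.comp (0 : ℝ) h2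
  have h4 : HasDerivAt (fun y : ℝ => W * (starRingEnd ℂ) (f (c + y * I)))
      (W * (starRingEnd ℂ) (deriv f c * I)) 0 := h1.star.const_mul W
  have h5 : (fun y : ℝ => W * (starRingEnd ℂ) (f (c + y * I))) = fun y : ℝ => f (c + y * I) := by
    funext y
    have h6 : 1 - (starRingEnd ℂ) (c + y * I) = c + y * I := by
      rw [map_add, sub_add_eq_sub_sub, href]
      simp
    conv_rhs => rw [hf, xiFun_reflection hq hχ (c + y * I), h6]
  rw [h5] at h4
  have h6 := h1.unique h4
  have h7 : f c = W * (starRingEnd ℂ) (f c) := by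
    conv_lhs => rw [hf, xiFun_reflection hq hχ c, href]
  have hW : W * (starRingEnd ℂ) (f c) ≠ 0 := h7 ▸ hne
  have h8 : deriv f c * I / f c = (starRingEnd ℂ) (deriv f c * I / f c) := by
    conv_lhs => rw [h6, h7]
    rw [map_div₀, mul_div_mul_left _ _ (left_ne_zero_of_mul hW)]
  have h9 := Complex.conj_eq_iff_im.1 h8.symm
  rw [logDeriv_apply]
  rw [mul_div_right_comm] at h9
  simpa using h9

theorem LFunction_eq_zero_of_xiFun_eq_zero {χ : DirichletCharacter ℂ q} (hq : 1 < q) {z : ℂ}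
    (hz : 0 < z.re) (h : xiFun χ z = 0) : DirichletCharacter.LFunction χ z = 0 := by
  have hq0 : (q : ℂ) ≠ 0 := NeZero.ne _
  rw [xiFun_eq hq hz, ← gammaFactor_eq] at h
  rcases _root_.mul_eq_zero.1 h with h | h
  · simp [Complex.cpow_eq_zero_iff, hq0] at h
  · exact (_root_.mul_eq_zero.1 h).resolve_right (gammaFactor_ne_zero χ hz)

theorem xiFun_ne_zero_of_one_le_re {χ : DirichletCharacter ℂ q} (hq : 1 < q) (hχ : χ ≠ 1) {z : ℂ}
    (hz : 1 ≤ z.re) : xiFun χ z ≠ 0 := fun h =>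
  DirichletCharacter.LFunction_ne_zero_of_one_le_re χ (Or.inl hχ) hz
    (LFunction_eq_zero_of_xiFun_eq_zero hq (by linarith) h)

theorem xiFun_eq_zero_re {χ : DirichletCharacter ℂ q} (hq : 1 < q) (hχ : χ.IsPrimitive)
    (hG : ∀ ρ : ℂ, DirichletCharacter.LFunction χ ρ = 0 → 0 < ρ.re → ρ.re < 1 → ρ.re = 1 / 2)
    {ρ : ℂ} (h : xiFun χ ρ = 0) : ρ.re = 1 / 2 := by
  have h1 := hχ.ne_one' hq
  rcases le_or_gt ρ.re 0 with h0 | h0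
  · exfalso
    have hW : DirichletCharacter.rootNumber χ ≠ 0 := fun hW => by
      refine xiFun_ne_zero_of_one_le_re hq h1 (z := 1) (by simp) ?_
      rw [xiFun_reflection hq hχ, hW, zero_mul]
    rw [xiFun_reflection hq hχ ρ, _root_.mul_eq_zero, map_eq_zero] at h
    refine xiFun_ne_zero_of_one_le_re hq h1 ?_ (h.resolve_left hW)
    simpa using h0
  · refine hG ρ (LFunction_eq_zero_of_xiFun_eq_zero hq h0 h) h0 ?_
    by_contra! h3
    exact xiFun_ne_zero_of_one_le_re hq h1 h3 h

end Xi

theorem norm_Gammaℝ_le {z : ℂ} (hz : 1 / 2 ≤ z.re) {R : ℝ} (hR : z.re ≤ R + 1) (hR0 : 0 ≤ R) :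
    ‖Gammaℝ z‖ ≤ 4 * Real.exp ((R + 3) * Real.log (R + 3)) := by
  set n := ⌈R⌉₊ + 2
  have hn1 : R ≤ ⌈R⌉₊ := Nat.le_ceil R
  have hn2 : (⌈R⌉₊ : ℝ) < R + 1 := Nat.ceil_lt_add_one hR0
  have hn : (n : ℝ) = ⌈R⌉₊ + 2 := by push_cast [n]; ring
  have hre : (z / 2).re = z.re / 2 := by simp
  unfold Gammaℝ
  rw [norm_mul, Complex.norm_cpow_eq_rpow_re_of_pos Real.pi_pos]
  have h1 : π ^ (-z / 2).re ≤ 1 := by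
    refine Real.rpow_le_one_of_one_le_of_nonpos (by linarith [Real.two_le_pi]) ?_
    simp; linarith
  have h2 : ‖Complex.Gamma (z / 2)‖ ≤ 4 * (n.factorial : ℝ) := by
    refine (norm_Gamma_le (by rw [hre]; linarith)).trans (Real_Gamma_le_factorial ?_ ?_)
    · rw [hre]; linarith
    · rw [hre, hn]; linarith
  have h3 : (n.factorial : ℝ) ≤ Real.exp ((R + 3) * Real.log (R + 3)) := by
    have h4 : (n.factorial : ℝ) ≤ (n : ℝ) ^ n := by exact_mod_cast Nat.factorial_le_pow n
    have hnpos : (0 : ℝ) < n := by rw [hn]; positivity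
    have h5 : (n : ℝ) ^ n = Real.exp (n * Real.log n) := by
      rw [Real.exp_nat_mul, Real.exp_log hnpos]
    rw [h5] at h4
    refine h4.trans (Real.exp_le_exp.2 ?_)
    have hn3 : (n : ℝ) ≤ R + 3 := by rw [hn]; linarith
    have hlog : 0 ≤ Real.log n := Real.log_nonneg (by rw [hn]; linarith)
    gcongr
  calc _ ≤ 1 * (4 * (n.factorial : ℝ)) := by gcongr
    _ ≤ _ := by linarith

section

variable {q : ℕ} [NeZero q]

theorem norm_xiFun_le_of_half_le_re {χ : DirichletCharacter ℂ q} (hq : 1 < q) (hχ : χ ≠ 1) {s : ℂ}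
    (hs : 1 / 2 ≤ s.re) {R : ℝ} (hR : ‖s‖ ≤ R) :
    ‖xiFun χ s‖ ≤ Real.exp (R * Real.log q + (R + 2 * q + (4 + (R + 3) * Real.log (R + 3)))) := by
  have hR0 : 0 ≤ R := (norm_nonneg s).trans hR
  have hsR : s.re ≤ R := (Complex.re_le_norm s).trans hR
  have hq0 : (0 : ℝ) < q := by exact_mod_cast NeZero.pos q
  have hlogq : 0 ≤ Real.log q := Real.log_natCast_nonneg q
  rw [xiFun_eq hq (by linarith), norm_mul, norm_mul, Real.exp_add, Real.exp_add, Real.exp_add]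
  have h0 := parity_nonneg χ
  have h0' := parity_le_one χ
  gcongr
  · rw [show (q : ℂ) = ((q : ℝ) : ℂ) by simp, Complex.norm_cpow_eq_rpow_re_of_pos hq0,
      Real.rpow_def_of_pos hq0, Real.exp_le_exp, mul_comm]
    gcongr
    simp; linarith
  · refine (norm_LFunction_le hq hχ (by linarith)).trans ?_
    gcongr
    · exact (hR.trans (by linarith)).trans (Real.add_one_le_exp R)
    · refine le_trans ?_ ((by linarith : 2 * (q : ℝ) ≤ 2 * q + 1).trans (Real.add_one_le_exp _))
      rw [div_le_iff₀ (by linarith)]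
      nlinarith
  · refine (norm_Gammaℝ_le (R := R) ?_ ?_ hR0).trans ?_
    · simp; linarith
    · simp; linarith
    · rw [Real.exp_add]
      refine mul_le_mul_of_nonneg_right ?_ (Real.exp_pos _).le
      linarith [Real.add_one_le_exp 4]

theorem norm_xiFun_le {χ : DirichletCharacter ℂ q} (hq : 1 < q) (hχ : χ.IsPrimitive) {s : ℂ}
    {R : ℝ} (hR : ‖s‖ + 1 ≤ R) :
    ‖xiFun χ s‖ ≤ Real.exp (‖DirichletCharacter.rootNumber χ‖ +
      (R * Real.log q + (R + 2 * q + (4 + (R + 3) * Real.log (R + 3))))) := by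
  have h1 := hχ.ne_one' hq
  rcases le_or_gt (1 / 2) s.re with h | h
  · refine (norm_xiFun_le_of_half_le_re hq h1 h (R := R) (by linarith)).trans
      (Real.exp_le_exp.2 ?_)
    linarith [norm_nonneg (DirichletCharacter.rootNumber χ)]
  · rw [xiFun_reflection hq hχ, norm_mul, Complex.norm_conj, Real.exp_add]
    gcongr
    · linarith [Real.add_one_le_exp ‖DirichletCharacter.rootNumber χ‖]
    · refine norm_xiFun_le_of_half_le_re hq h1 ?_ ?_
      · simp; linarith
      · refine (norm_sub_le _ _).trans ?_
        rw [Complex.norm_conj, norm_one]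
        linarith

theorem exists_growth_xiFun {χ : DirichletCharacter ℂ q} (hq : 1 < q) (hχ : χ.IsPrimitive) (c : ℂ) :
    ∃ A : ℝ → ℝ, (∀ R, 0 < R → ∀ w, ‖w - c‖ ≤ R → ‖xiFun χ w‖ ≤ Real.exp (A R)) ∧
      Tendsto (fun R => A R / R ^ 2) atTop (𝓝 0) := by
  set k := ‖c‖ + 1 with hk
  refine ⟨fun R => ‖DirichletCharacter.rootNumber χ‖ +
      ((R + k) * Real.log q + ((R + k) + 2 * q + (4 + (R + k + 3) * Real.log (R + k + 3)))),
    fun R hR w hw => norm_xiFun_le hq hχ ?_, ?_⟩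
  · have := norm_sub_norm_le w c
    linarith
  · rw [← Asymptotics.isLittleO_iff_tendsto' (by
      filter_upwards [eventually_gt_atTop 0] with R hR h
      exact absurd h (by positivity))]
    have hconst : ∀ a : ℝ, (fun _ : ℝ => a) =o[atTop] fun R : ℝ => R := fun a =>
      Asymptotics.isLittleO_const_id_atTop a
    have hsq : (fun R : ℝ => R) =o[atTop] fun R : ℝ => R ^ 2 := by
      simpa using Asymptotics.isLittleO_pow_pow_atTop_of_lt (𝕜 := ℝ) (show 1 < 2 by norm_num)
    have hadd : ∀ a : ℝ, (fun R : ℝ => R + a) =O[atTop] fun R : ℝ => R := fun a =>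
      (Asymptotics.isBigO_refl _ _).add (hconst a).isBigO
    have hlog : (fun R : ℝ => Real.log (R + k + 3)) =o[atTop] fun R : ℝ => R := by
      have h1 : Tendsto (fun R : ℝ => R + (k + 3)) atTop atTop :=
        tendsto_atTop_add_const_right _ _ tendsto_id
      have h2 := (Real.isLittleO_log_id_atTop.comp_tendsto h1).trans_isBigO (hadd (k + 3))
      simpa [Function.comp_def, add_assoc] using h2
    have hc2 : ∀ a : ℝ, (fun _ : ℝ => a) =o[atTop] fun R : ℝ => R ^ 2 := fun a =>
      (hconst a).trans hsq
    refine (hc2 _).add (Asymptotics.IsLittleO.add ?_ (((((hadd k).trans_isLittleO hsq).add (hc2 _))).add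
      ((hc2 _).add ?_)))
    · exact (((hadd k).trans_isLittleO hsq).const_mul_left (Real.log q)).congr_left
        fun R => mul_comm _ _
    · have := (hadd (k + 3)).mul_isLittleO hlog
      simpa [pow_two, add_assoc] using this

end

section

variable {q : ℕ} [NeZero q]

theorem exists_xiFun_ne_zero {χ : DirichletCharacter ℂ q} (hq : 1 < q) (hχ : χ ≠ 1) :
    ∃ c : ℂ, c.re = 1 / 2 ∧ xiFun χ c ≠ 0 := by
  by_contra! H
  have h1 : xiFun χ = fun _ => 0 := by
    refine AnalyticOnNhd.eq_of_frequently_eq (𝕜 := ℂ) (z₀ := (1 / 2 : ℂ))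
      ((differentiable_xiFun hχ).differentiableOn.analyticOnNhd isOpen_univ)
      (fun _ _ => analyticAt_const) ?_
    have h2 : Tendsto (fun n : ℕ => (1 / 2 : ℂ) + ((1 / ((n : ℝ) + 1) : ℝ) : ℂ) * I) atTop
        (𝓝[≠] (1 / 2 : ℂ)) := by
      refine tendsto_nhdsWithin_iff.2 ⟨?_, Eventually.of_forall fun n => ?_⟩
      · have := ((Complex.continuous_ofReal.tendsto 0).comp
          tendsto_one_div_add_atTop_nhds_zero_nat).mul_const I |>.const_add (1 / 2 : ℂ)
        simpa using this
      · have : ((1 / ((n : ℝ) + 1) : ℝ) : ℂ) ≠ 0 := by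
          rw [Complex.ofReal_ne_zero]; positivity
        simpa using this
    refine h2.frequently (Eventually.of_forall fun n => H _ ?_).frequently
    simp
  refine xiFun_ne_zero_of_one_le_re hq hχ (z := 1) (by simp) ?_
  rw [h1]

omit [NeZero q] in
theorem half_parity_re {χ : DirichletCharacter ℂ q} {s : ℂ} (hs : 1 / 2 < s.re) :
    1 / 4 ≤ ((s + parity χ) / 2).re := by
  have := parity_nonneg χ
  simp; linarith

theorem logDeriv_Gammaℝ {z : ℂ} (hz : 0 < z.re) :
    logDeriv Gammaℝ z = -(Real.log π / 2 : ℝ) + Complex.digamma (z / 2) / 2 := by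
  have hπ : (π : ℂ) ≠ 0 := by exact_mod_cast Real.pi_ne_zero
  have hre : 0 < (z / 2).re := by simpa using hz
  have hG : DifferentiableAt ℂ Complex.Gamma (z / 2) :=
    Complex.differentiableAt_Gamma _ fun m h => by
      rw [h] at hre
      have : (0 : ℝ) ≤ m := Nat.cast_nonneg m
      simp at hre
      linarith
  have h1 : HasDerivAt (fun s : ℂ => (π : ℂ) ^ (-s / 2))
      ((π : ℂ) ^ (-z / 2) * Complex.log π * (-1 / 2)) z :=
    (((hasDerivAt_id z).neg).div_const 2).const_cpow (Or.inl hπ)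
  have h2 : HasDerivAt (fun s : ℂ => Complex.Gamma (s / 2)) (deriv Complex.Gamma (z / 2) * (1 / 2))
      z := hG.hasDerivAt.comp z ((hasDerivAt_id z).div_const 2)
  have hc : (π : ℂ) ^ (-z / 2) ≠ 0 := by simp [Complex.cpow_eq_zero_iff, hπ]
  have hΓ := Complex.Gamma_ne_zero_of_re_pos hre
  have h3 : Gammaℝ = fun s : ℂ => (π : ℂ) ^ (-s / 2) * Complex.Gamma (s / 2) := by
    funext s; rw [Gammaℝ]
  rw [h3, logDeriv_mul z hc hΓ h1.differentiableAt h2.differentiableAt, logDeriv_apply,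
    logDeriv_apply, h1.deriv, h2.deriv, Complex.digamma_def, logDeriv_apply,
    ← Complex.ofReal_log Real.pi_pos.le]
  push_cast
  field_simp

theorem logDeriv_xiFun {χ : DirichletCharacter ℂ q} (hq : 1 < q) (hχ : χ ≠ 1) {s : ℂ}
    (hs : 0 < s.re) (hL : DirichletCharacter.LFunction χ s ≠ 0) :
    logDeriv (xiFun χ) s = (Real.log q / 2 - Real.log π / 2 : ℝ) +
      Complex.digamma ((s + parity χ) / 2) / 2 +
      logDeriv (DirichletCharacter.LFunction χ) s := by
  have hq0 : (q : ℂ) ≠ 0 := NeZero.ne _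
  have h0 := parity_nonneg χ
  have hre : 0 < (s + parity χ).re := by simp; linarith
  have hev : xiFun χ =ᶠ[𝓝 s] fun s => (q : ℂ) ^ (s / 2) *
      (DirichletCharacter.LFunction χ s * Gammaℝ (s + parity χ)) := by
    filter_upwards [(isOpen_lt continuous_const Complex.continuous_re).mem_nhds hs] with z hz
    exact xiFun_eq hq hz
  have h1 : HasDerivAt (fun s : ℂ => (q : ℂ) ^ (s / 2))
      ((q : ℂ) ^ (s / 2) * Complex.log q * (1 / 2)) s :=
    ((hasDerivAt_id s).div_const 2).const_cpow (Or.inl hq0)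
  have hc : (q : ℂ) ^ (s / 2) ≠ 0 := by simp [Complex.cpow_eq_zero_iff, hq0]
  have hGd : DifferentiableAt ℂ Gammaℝ (s + parity χ) := by
    have := differentiable_Gammaℝ_inv (s + parity χ)
    have h2 := this.inv (inv_ne_zero (Gammaℝ_ne_zero_of_re_pos hre))
    simpa [Pi.inv_def] using h2
  have hG0 := Gammaℝ_ne_zero_of_re_pos hre
  have hG1 : HasDerivAt (fun z : ℂ => Gammaℝ (z + parity χ)) (deriv Gammaℝ (s + parity χ) * 1) s :=
    hGd.hasDerivAt.comp (h := fun z : ℂ => z + parity χ) s ((hasDerivAt_id s).add_const _)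
  have hLd := DirichletCharacter.differentiable_LFunction hχ s
  have hG2 : logDeriv (fun z : ℂ => Gammaℝ (z + parity χ)) s = logDeriv Gammaℝ (s + parity χ) := by
    rw [logDeriv_apply, logDeriv_apply, hG1.deriv, mul_one]
  rw [logDeriv_apply, hev.deriv_eq, hev.eq_of_nhds, ← logDeriv_apply,
    logDeriv_mul (f := fun s : ℂ => (q : ℂ) ^ (s / 2))
      (g := fun s => DirichletCharacter.LFunction χ s * Gammaℝ (s + parity χ)) s hc
      (_root_.mul_ne_zero hL hG0) h1.differentiableAt (hLd.mul hG1.differentiableAt),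
    logDeriv_mul (g := fun s => Gammaℝ (s + parity χ)) s hL hG0 hLd hG1.differentiableAt, hG2,
    logDeriv_Gammaℝ hre, logDeriv_apply, h1.deriv, mul_assoc, mul_div_cancel_left₀ _ hc,
    ← Complex.natCast_log]
  push_cast
  ring

/-- The multiplicity of `ρ` as a zero of the completed `L`-function. -/
noncomputable def zeroMult (χ : DirichletCharacter ℂ q) (ρ : ℂ) : ℕ :=
  analyticOrderNatAt (xiFun χ) ρ

variable {χ : DirichletCharacter ℂ q} (hq : 1 < q) (hχ : χ.IsPrimitive)
  (hG : ∀ ρ : ℂ, DirichletCharacter.LFunction χ ρ = 0 → 0 < ρ.re → ρ.re < 1 → ρ.re = 1 / 2)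
include hq hχ hG

theorem LFunction_ne_zero_of_half_lt_re {s : ℂ} (hs : 1 / 2 < s.re) :
    DirichletCharacter.LFunction χ s ≠ 0 := fun h => by
  refine hs.ne' (hG s h (by linarith) ?_)
  by_contra! h1
  exact DirichletCharacter.LFunction_ne_zero_of_one_le_re χ (Or.inl (hχ.ne_one' hq)) h1 h

theorem re_eq_half_of_zeroMult_ne_zero {ρ : ℂ} (h : zeroMult χ ρ ≠ 0) : ρ.re = 1 / 2 :=
  xiFun_eq_zero_re hq hχ hG (apply_eq_zero_of_analyticOrderNatAt_ne_zero h)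

theorem summable_zeroMult_div {s : ℂ} (hs : 1 / 2 < s.re) :
    Summable fun ρ => (zeroMult χ ρ : ℝ) / ‖s - ρ‖ ^ 2 := by
  obtain ⟨c, hc1, hc2⟩ := exists_xiFun_ne_zero hq (hχ.ne_one' hq)
  obtain ⟨A, hA1, hA2⟩ := exists_growth_xiFun hq hχ c
  exact summable_order_div_norm_sq (differentiable_xiFun (hχ.ne_one' hq)) hc2 hA1 hA2
    (fun ρ h => xiFun_eq_zero_re hq hχ hG h) hc1 (re_logDeriv_xiFun_eq_zero hq hχ hc1 hc2) hs

theorem mul_tsum_zeroMult_eq {s : ℂ} (hs : 1 / 2 < s.re) :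
    (s.re - 1 / 2) * ∑' ρ, (zeroMult χ ρ : ℝ) / ‖s - ρ‖ ^ 2 =
      Real.log q / 2 - Real.log π / 2 + (Complex.digamma ((s + parity χ) / 2)).re / 2 +
        (logDeriv (DirichletCharacter.LFunction χ) s).re := by
  obtain ⟨c, hc1, hc2⟩ := exists_xiFun_ne_zero hq (hχ.ne_one' hq)
  obtain ⟨A, hA1, hA2⟩ := exists_growth_xiFun hq hχ c
  have h1 := re_logDeriv_eq_tsum (differentiable_xiFun (hχ.ne_one' hq)) hc2 hA1 hA2
    (fun ρ h => xiFun_eq_zero_re hq hχ hG h) hc1 (re_logDeriv_xiFun_eq_zero hq hχ hc1 hc2) hs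
  unfold zeroMult
  rw [← h1, logDeriv_xiFun hq (hχ.ne_one' hq) (by linarith)
    (LFunction_ne_zero_of_half_lt_re hq hχ hG hs)]
  rw [Complex.add_re, Complex.add_re, Complex.ofReal_re]
  simp

theorem hasSum_zeroMult_sub {s z : ℂ} (hs : 1 / 2 < s.re) (hz : 1 / 2 < z.re) :
    HasSum (fun ρ => (zeroMult χ ρ : ℂ) * (1 / (z - ρ) - 1 / (s - ρ)))
      ((Complex.digamma ((z + parity χ) / 2) - Complex.digamma ((s + parity χ) / 2)) / 2 +
        (logDeriv (DirichletCharacter.LFunction χ) z -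
          logDeriv (DirichletCharacter.LFunction χ) s)) := by
  obtain ⟨c, hc1, hc2⟩ := exists_xiFun_ne_zero hq (hχ.ne_one' hq)
  obtain ⟨A, hA1, hA2⟩ := exists_growth_xiFun hq hχ c
  have h1 := hasSum_partialFraction (differentiable_xiFun (hχ.ne_one' hq)) hc2 hA1 hA2
    (fun ρ h => xiFun_eq_zero_re hq hχ hG h) hc1 (re_logDeriv_xiFun_eq_zero hq hχ hc1 hc2) hs hz
  rw [logDeriv_xiFun hq (hχ.ne_one' hq) (by linarith)
    (LFunction_ne_zero_of_half_lt_re hq hχ hG hs), logDeriv_xiFun hq (hχ.ne_one' hq) (by linarith)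
    (LFunction_ne_zero_of_half_lt_re hq hχ hG hz)] at h1
  refine (congrArg (HasSum _) ?_).mp h1
  ring

end

theorem eq_zero_of_mellin_eq_zero {f : ℝ → ℂ} (hf : Continuous f) {σ : ℝ}
    (hconv : MellinConvergent f σ) (h0 : ∀ z : ℂ, z.re = σ → mellin f z = 0) {x : ℝ} (hx : 0 < x) :
    f x = 0 := by
  have h1 : ∀ y : ℝ, mellin f (σ + y * I) = 0 := fun y => h0 _ (by simp)
  have hv : Complex.VerticalIntegrable (mellin f) σ := by
    unfold Complex.VerticalIntegrable
    simp only [h1]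
    exact integrable_zero _ _ _
  rw [← mellinInv_mellin_eq σ f hx hconv hv hf.continuousAt]
  unfold mellinInv
  simp [h1]

theorem mellin_tsum_of_le {ι : Type*} [Countable ι] {k : ι → ℝ → ℂ} {B : ι → ℝ}
    (hk : ∀ i, Continuous (k i)) (hk0 : ∀ i, ∀ u ≤ 1, k i u = 0)
    (hB : ∀ i, ∀ u : ℝ, 1 ≤ u → ‖k i u‖ ≤ B i * u ^ 2) (hsum : Summable B) :
    (Continuous fun u => ∑' i, k i u) ∧ ∀ z : ℂ, z.re = -3 →
      (∀ i, MellinConvergent (k i) z) ∧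
      MellinConvergent (fun u => ∑' i, k i u) z ∧
      HasSum (fun i => mellin (k i) z) (mellin (fun u => ∑' i, k i u) z) := by
  have hB0 : ∀ i, 0 ≤ B i := fun i => by simpa using (norm_nonneg _).trans (hB i 1 le_rfl)
  have hB' : ∀ U : ℝ, 1 ≤ U → ∀ i, ∀ u : ℝ, u ≤ U → ‖k i u‖ ≤ B i * U ^ 2 := fun U hU i u hu => by
    rcases le_total u 1 with h | h
    · rw [hk0 i u h, norm_zero]
      exact mul_nonneg (hB0 i) (by positivity)
    · refine (hB i u h).trans ?_
      have := hB0 i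
      gcongr
  have hsumk : ∀ u, Summable fun i => k i u := fun u =>
    Summable.of_norm_bounded (hsum.mul_right ((max u 1) ^ 2))
      fun i => hB' _ (le_max_right _ _) i u (le_max_left _ _)
  have hcont : Continuous fun u => ∑' i, k i u := by
    rw [continuous_iff_continuousAt]
    intro u
    have h1 : ContinuousOn (fun u => ∑' i, k i u) (Set.Iio (max u 1 + 1)) :=
      continuousOn_tsum (fun i => (hk i).continuousOn) (hsum.mul_right ((max u 1 + 1) ^ 2))
        fun i v hv => hB' _ (by linarith [le_max_right u 1]) i v (le_of_lt hv)
    exact h1.continuousAt (Iio_mem_nhds (by linarith [le_max_left u 1]))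
  have hbd : ∀ (f : ℝ → ℂ) (b : ℝ), (∀ u ≤ 1, f u = 0) → (∀ u : ℝ, 1 ≤ u → ‖f u‖ ≤ b * u ^ 2) →
      ∀ z : ℂ, z.re = -3 → ∀ u ∈ Set.Ioi (0 : ℝ), ‖(u : ℂ) ^ (z - 1) • f u‖ ≤
        b * (Set.Ioi (1 : ℝ)).indicator (fun u => u ^ (-2 : ℝ)) u := by
    intro f b h0 hb z hz u hu
    have hu' : 0 < u := hu
    rcases le_or_gt u 1 with h | h
    · simp [h0 u h, h.not_gt]
    · rw [norm_smul, Complex.norm_cpow_eq_rpow_re_of_pos hu', Complex.sub_re, hz,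
        Set.indicator_of_mem (Set.mem_Ioi.2 h)]
      calc u ^ ((-3 : ℝ) - (1 : ℂ).re) * ‖f u‖ ≤ u ^ ((-3 : ℝ) - (1 : ℂ).re) * (b * u ^ (2 : ℝ)) := by
            gcongr
            simpa using hb u h.le
        _ = b * (u ^ ((-3 : ℝ) - (1 : ℂ).re) * u ^ (2 : ℝ)) := by ring
        _ = b * u ^ (-2 : ℝ) := by
            rw [← Real.rpow_add hu']
            norm_num
  have hInt : Integrable ((Set.Ioi (1 : ℝ)).indicator (fun u : ℝ => u ^ (-2 : ℝ)))
      (volume.restrict (Set.Ioi 0)) :=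
    (integrable_indicator_iff measurableSet_Ioi).2
      (integrableOn_Ioi_rpow_of_lt (by norm_num) zero_lt_one) |>.restrict
  have hmeas : ∀ (f : ℝ → ℂ), Continuous f → ∀ z : ℂ, AEStronglyMeasurable
      (fun u : ℝ => (u : ℂ) ^ (z - 1) • f u) (volume.restrict (Set.Ioi 0)) := fun f hf z => by
    refine ContinuousOn.aestronglyMeasurable ?_ measurableSet_Ioi
    refine ContinuousOn.smul (f := fun u : ℝ => (u : ℂ) ^ (z - 1)) (fun u hu => ?_) hf.continuousOn
    exact (Complex.continuousAt_ofReal_cpow_const u _ (Or.inr (ne_of_gt hu))).continuousWithinAt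
  have hconv : ∀ (f : ℝ → ℂ) (b : ℝ), Continuous f → (∀ u ≤ 1, f u = 0) →
      (∀ u : ℝ, 1 ≤ u → ‖f u‖ ≤ b * u ^ 2) → ∀ z : ℂ, z.re = -3 → MellinConvergent f z := by
    intro f b hf h0 hb z hz
    exact (hInt.const_mul b).mono' (hmeas f hf z)
      ((ae_restrict_iff' measurableSet_Ioi).2 (Eventually.of_forall (hbd f b h0 hb z hz)))
  refine ⟨hcont, fun z hz => ⟨fun i => hconv _ (B i) (hk i) (hk0 i) (hB i) z hz,
    hconv _ (∑' i, B i) hcont ?_ ?_ z hz, ?_⟩⟩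
  · intro u hu
    simp [hk0 _ u hu]
  · intro u hu
    rw [← tsum_mul_right]
    exact tsum_of_norm_bounded (hsum.mul_right _).hasSum fun i => hB i u hu
  · unfold mellin
    refine hasSum_integral_of_dominated_convergence
      (fun i u => B i * (Set.Ioi (1 : ℝ)).indicator (fun u => u ^ (-2 : ℝ)) u) ?_ ?_ ?_ ?_ ?_
    · exact fun i => hmeas _ (hk i) z
    · exact fun i => (ae_restrict_iff' measurableSet_Ioi).2
        (Eventually.of_forall (hbd _ _ (hk0 i) (hB i) z hz))
    · exact Eventually.of_forall fun u => hsum.mul_right _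
    · simp only [tsum_mul_right]
      exact hInt.const_mul _
    · exact Eventually.of_forall fun u => (hsumk u).hasSum.const_smul _

theorem mellin_log_sub {n : ℝ} (hn : 1 ≤ n) {z : ℂ} (hz : z.re = -3) :
    mellin (fun u : ℝ => ((max 0 (Real.log (max u 1) - Real.log n) : ℝ) : ℂ)) z =
      (n : ℂ) ^ z / z ^ 2 := by
  have hz0 : z ≠ 0 := fun h => by simp [h] at hz
  have hn0 : 0 < n := by linarith
  have h1 : mellin (fun u : ℝ => ((max 0 (Real.log (max u 1) - Real.log n) : ℝ) : ℂ)) z =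
      ∫ u in Set.Ioi n, (u : ℂ) ^ (z - 1) * ((Real.log u - Real.log n : ℝ) : ℂ) := by
    unfold mellin
    rw [← integral_indicator measurableSet_Ioi, ← integral_indicator measurableSet_Ioi]
    refine integral_congr_ae (Eventually.of_forall fun u => ?_)
    by_cases h : n < u
    · have h2 : 0 < u := by linarith
      have h3 : Real.log n ≤ Real.log u := Real.log_le_log hn0 h.le
      simp only [Set.indicator, Set.mem_Ioi, h, h2, if_true, smul_eq_mul]
      rw [max_eq_left (by linarith : 1 ≤ u), max_eq_right (by linarith)]
    · by_cases h2 : 0 < u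
      · simp only [Set.indicator, Set.mem_Ioi, h, h2, if_true, if_false, smul_eq_mul]
        have : Real.log (max u 1) ≤ Real.log n :=
          Real.log_le_log (by positivity) (max_le (not_lt.1 h) hn)
        rw [max_eq_left (by linarith)]
        simp
      · simp [Set.indicator, h, h2]
  have hderiv : ∀ u : ℝ, 0 < u → HasDerivAt (fun u : ℝ => (u : ℂ) ^ z *
      (((Real.log u - Real.log n : ℝ) : ℂ) / z - 1 / z ^ 2))
      ((u : ℂ) ^ (z - 1) * ((Real.log u - Real.log n : ℝ) : ℂ)) u := by
    intro u hu
    have hu0 : (u : ℂ) ≠ 0 := by exact_mod_cast hu.ne'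
    have h2 : HasDerivAt (fun u : ℝ => (u : ℂ) ^ z) (z * (u : ℂ) ^ (z - 1)) u := by
      have := (hasDerivAt_id (u : ℂ)).cpow_const (c := z) (Or.inl hu)
      simpa using this.comp_ofReal
    have h3 : HasDerivAt (fun u : ℝ => ((Real.log u - Real.log n : ℝ) : ℂ) / z - 1 / z ^ 2)
        (((u⁻¹ : ℝ) : ℂ) / z) u :=
      ((((Real.hasDerivAt_log hu.ne').sub_const _).ofReal_comp).div_const z).sub_const _
    refine (h2.mul h3).congr_deriv ?_
    have h4 : (u : ℂ) ^ z = (u : ℂ) ^ (z - 1) * u := by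
      rw [Complex.cpow_sub _ _ hu0, Complex.cpow_one, div_mul_cancel₀ _ hu0]
    rw [h4]
    push_cast
    field_simp
    ring
  have hlim : Tendsto (fun u : ℝ => (u : ℂ) ^ z *
      (((Real.log u - Real.log n : ℝ) : ℂ) / z - 1 / z ^ 2)) atTop (𝓝 0) := by
    have h2 : Tendsto (fun u : ℝ => u ^ (-3 : ℝ)) atTop (𝓝 0) :=
      tendsto_rpow_neg_atTop (by norm_num)
    have h3 : Tendsto (fun u : ℝ => u ^ (-3 : ℝ) * Real.log u) atTop (𝓝 0) := by
      have := (isLittleO_log_rpow_atTop (r := 3) (by norm_num)).tendsto_div_nhds_zero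
      refine this.congr' ?_
      filter_upwards [eventually_gt_atTop 0] with u hu
      rw [Real.rpow_neg hu.le, div_eq_inv_mul]
    rw [tendsto_zero_iff_norm_tendsto_zero]
    refine squeeze_zero' (Eventually.of_forall fun _ => norm_nonneg _)
      (g := fun u : ℝ => (u ^ (-3 : ℝ) * Real.log u) * (1 / ‖z‖) +
        u ^ (-3 : ℝ) * (Real.log n / ‖z‖ + 1 / ‖z‖ ^ 2)) ?_ ?_
    · filter_upwards [eventually_ge_atTop 1] with u hu
      have hlu : 0 ≤ Real.log u := Real.log_nonneg hu
      have hln : 0 ≤ Real.log n := Real.log_nonneg hn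
      rw [norm_mul, Complex.norm_cpow_eq_rpow_re_of_pos (by linarith), hz]
      have h4 : ‖((Real.log u - Real.log n : ℝ) : ℂ) / z - 1 / z ^ 2‖ ≤
          (Real.log u + Real.log n) / ‖z‖ + 1 / ‖z‖ ^ 2 := by
        refine (norm_sub_le _ _).trans ?_
        rw [norm_div, norm_div, norm_pow, norm_one, Complex.norm_real, Real.norm_eq_abs]
        gcongr
        rw [abs_le]; constructor <;> linarith
      calc _ ≤ u ^ (-3 : ℝ) * ((Real.log u + Real.log n) / ‖z‖ + 1 / ‖z‖ ^ 2) := by gcongr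
        _ = _ := by ring
    · have h4 := (h3.mul_const (1 / ‖z‖)).add
        (h2.mul_const (Real.log n / ‖z‖ + 1 / ‖z‖ ^ 2))
      rw [zero_mul, zero_mul, add_zero] at h4
      exact h4
  have hInt : IntegrableOn (fun u : ℝ => (u : ℂ) ^ (z - 1) * ((Real.log u - Real.log n : ℝ) : ℂ))
      (Set.Ioi n) := by
    refine Integrable.mono' (g := fun u : ℝ => u ^ (-3 : ℝ))
      (integrableOn_Ioi_rpow_of_lt (by norm_num) hn0) ?_ ?_
    · refine ContinuousOn.aestronglyMeasurable (fun u hu => ?_) measurableSet_Ioi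
      have hu0 : u ≠ 0 := (hn0.trans hu).ne'
      refine ContinuousAt.continuousWithinAt (ContinuousAt.mul
        (Complex.continuousAt_ofReal_cpow_const u _ (Or.inr hu0)) ?_)
      exact Complex.continuous_ofReal.continuousAt.comp
        ((Real.continuousAt_log hu0).sub continuousAt_const)
    · refine (ae_restrict_iff' measurableSet_Ioi).2 (Eventually.of_forall fun u hu => ?_)
      have hu0 : 0 < u := hn0.trans hu
      have h3 : Real.log n ≤ Real.log u := Real.log_le_log hn0 (le_of_lt hu)
      rw [norm_mul, Complex.norm_cpow_eq_rpow_re_of_pos hu0, Complex.norm_real, Real.norm_eq_abs,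
        abs_of_nonneg (by linarith), Complex.sub_re, hz]
      have h5 : Real.log u - Real.log n ≤ u := by
        linarith [Real.log_le_self hu0.le, Real.log_nonneg hn]
      calc u ^ ((-3 : ℝ) - (1 : ℂ).re) * (Real.log u - Real.log n)
          ≤ u ^ ((-3 : ℝ) - (1 : ℂ).re) * u ^ (1 : ℝ) := by
            rw [Real.rpow_one]; gcongr
        _ = u ^ (-3 : ℝ) := by rw [← Real.rpow_add hu0]; norm_num
  rw [h1, integral_Ioi_of_hasDerivAt_of_tendsto (hderiv n hn0).continuousAt.continuousWithinAt
    (fun u hu => hderiv u (hn0.trans hu)) hInt hlim]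
  simp [div_eq_mul_inv]

theorem mellin_one_sub_cpow {b : ℂ} (hb : 0 < b.re) {z : ℂ} (hz : z.re = -3) :
    mellin (fun u : ℝ => 1 - ((max u 1 : ℝ) : ℂ) ^ (-b)) z = 1 / (z - b) - 1 / z := by
  have h1 : mellin (fun u : ℝ => 1 - ((max u 1 : ℝ) : ℂ) ^ (-b)) z =
      ∫ u in Set.Ioi (1 : ℝ), ((u : ℂ) ^ (z - 1) - (u : ℂ) ^ (z - b - 1)) := by
    unfold mellin
    rw [← integral_indicator measurableSet_Ioi, ← integral_indicator measurableSet_Ioi]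
    refine integral_congr_ae (Eventually.of_forall fun u => ?_)
    by_cases h : 1 < u
    · have h2 : 0 < u := by linarith
      have hu0 : (u : ℂ) ≠ 0 := by exact_mod_cast h2.ne'
      simp only [Set.indicator, Set.mem_Ioi, h, h2, if_true, smul_eq_mul]
      rw [max_eq_left h.le, mul_sub, mul_one, ← Complex.cpow_add _ _ hu0]
      congr 2
      ring
    · have : max u 1 = 1 := max_eq_right (not_lt.1 h)
      simp [Set.indicator, h, this]
  have h2 : (z - 1).re < -1 := by simp [hz]; norm_num
  have h3 : (z - b - 1).re < -1 := by simp [hz]; linarith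
  rw [h1, integral_sub (integrableOn_Ioi_cpow_of_lt h2 zero_lt_one)
    (integrableOn_Ioi_cpow_of_lt h3 zero_lt_one), integral_Ioi_cpow_of_lt h2 zero_lt_one,
    integral_Ioi_cpow_of_lt h3 zero_lt_one]
  simp
  ring

theorem explicit_formula_of_hasSum {ι : Type*} [Countable ι] {a : ℕ → ℂ} {b m : ι → ℂ} {F₀ : ℂ}
    (ha0 : a 0 = 0) (ha : Summable fun n : ℕ => ‖a n‖ / (n : ℝ) ^ 2) (hb : ∀ i, 0 < (b i).re)
    (hm : Summable fun i => ‖m i‖ / ‖b i‖ ^ 2)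
    (hF : ∀ w : ℂ, w.re = 3 →
      HasSum (fun i => m i * (1 / (w + b i) - 1 / b i)) (F₀ - ∑' n, a n * (n : ℂ) ^ (-w)))
    {u : ℝ} (hu : 1 ≤ u) :
    ∑' n : ℕ, a n * ((max 0 (Real.log u - Real.log n) : ℝ) : ℂ) =
      F₀ * Real.log u + ∑' i, m i / b i ^ 2 * (1 - (u : ℂ) ^ (-b i)) := by
  set g : ℕ → ℝ → ℂ := fun n u => a n * ((max 0 (Real.log (max u 1) - Real.log n) : ℝ) : ℂ) with hg
  set l : Unit → ℝ → ℂ := fun _ u => F₀ * ((max 0 (Real.log (max u 1) - Real.log 1) : ℝ) : ℂ)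
    with hl
  set k : ι → ℝ → ℂ := fun i u => m i / b i ^ 2 * (1 - ((max u 1 : ℝ) : ℂ) ^ (-b i)) with hk
  have hlogc : ∀ n : ℝ, Continuous fun u : ℝ =>
      ((max 0 (Real.log (max u 1) - Real.log n) : ℝ) : ℂ) := fun n =>
    Complex.continuous_ofReal.comp (continuous_const.max
      (((continuous_id.max continuous_const).log fun u => by
        have : (0 : ℝ) < max u 1 := by positivity
        exact this.ne').sub continuous_const))
  have hlog0 : ∀ n : ℝ, 1 ≤ n → ∀ u ≤ (1 : ℝ), max 0 (Real.log (max u 1) - Real.log n) = 0 := by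
    intro n hn u hu
    rw [max_eq_right hu, Real.log_one, max_eq_left]
    linarith [Real.log_nonneg hn]
  have hlogb : ∀ n : ℝ, 1 ≤ n → ∀ u : ℝ, 1 ≤ u →
      ‖((max 0 (Real.log (max u 1) - Real.log n) : ℝ) : ℂ)‖ ≤ 1 / n ^ 2 * u ^ 2 := by
    intro n hn u hu
    rw [Complex.norm_real, Real.norm_eq_abs, abs_of_nonneg (le_max_left _ _), max_eq_left hu]
    have hn0 : 0 < n := by linarith
    rw [one_div_mul_eq_div, ← div_pow]
    refine max_le (by positivity) ?_
    rw [← Real.log_div (by positivity) (by positivity)]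
    have h1 := Real.log_le_sub_one_of_pos (show 0 < u / n by positivity)
    nlinarith [sq_nonneg (u / n - 1)]
  have Hg := mellin_tsum_of_le (k := g) (B := fun n => ‖a n‖ / (n : ℝ) ^ 2)
    (fun n => continuous_const.mul (hlogc n)) ?_ ?_ ha
  rotate_left
  · intro n u hu
    rcases Nat.eq_zero_or_pos n with rfl | hn
    · simp [hg, ha0]
    · simp only [hg]
      rw [hlog0 n (by exact_mod_cast hn) u hu]
      simp
  · intro n u hu
    rcases Nat.eq_zero_or_pos n with rfl | hn
    · simp [hg, ha0]
    · simp only [hg, norm_mul]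
      rw [div_mul_eq_mul_div, mul_div_assoc]
      gcongr
      have := hlogb n (by exact_mod_cast hn) u hu
      rwa [one_div_mul_eq_div] at this
  have Hl := mellin_tsum_of_le (k := l) (B := fun _ => ‖F₀‖)
    (fun _ => continuous_const.mul (hlogc 1)) ?_ ?_ (Summable.of_finite)
  rotate_left
  · intro _ u hu
    simp only [hl]
    rw [hlog0 1 le_rfl u hu]
    simp
  · intro _ u hu
    simp only [hl, norm_mul]
    gcongr
    simpa using hlogb 1 le_rfl u hu
  have Hk := mellin_tsum_of_le (k := k) (B := fun i => ‖m i‖ / ‖b i‖ ^ 2 * 2)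
    ?_ ?_ ?_ (hm.mul_right 2)
  rotate_left
  · intro i
    refine continuous_const.mul (continuous_const.sub ?_)
    refine Continuous.cpow (Complex.continuous_ofReal.comp
      (continuous_id.max continuous_const)) continuous_const fun u => Or.inl ?_
    show 0 < (((max u 1 : ℝ) : ℂ)).re
    rw [Complex.ofReal_re]
    positivity
  · intro i u hu
    simp [hk, max_eq_right hu]
  · intro i u hu
    have hu0 : 0 < u := by linarith
    simp only [hk, norm_mul, norm_div, norm_pow, max_eq_left hu]
    rw [mul_assoc]
    gcongr
    refine (norm_sub_le _ _).trans ?_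
    rw [norm_one, Complex.norm_cpow_eq_rpow_re_of_pos hu0]
    have h1 : u ^ (-b i).re ≤ 1 := by
      refine Real.rpow_le_one_of_one_le_of_nonpos hu ?_
      simp [(hb i).le]
    nlinarith
  set Φ : ℝ → ℂ := fun u => (∑' n, g n u) - (∑' i, l i u) - ∑' i, k i u with hΦ
  have hΦu : Φ u = 0 := by
    refine eq_zero_of_mellin_eq_zero ((Hg.1.sub Hl.1).sub Hk.1) (σ := -3) ?_ ?_ (by linarith)
    · have h3 : (((-3 : ℝ) : ℂ)).re = -3 := Complex.ofReal_re _
      exact (hasMellin_sub (hasMellin_sub (Hg.2 _ h3).2.1 (Hl.2 _ h3).2.1).1 (Hk.2 _ h3).2.1).1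
    · intro z hz
      obtain ⟨-, hg1, hg2⟩ := Hg.2 z hz
      obtain ⟨-, hl1, hl2⟩ := Hl.2 z hz
      obtain ⟨-, hk1, hk2⟩ := Hk.2 z hz
      have hz0 : z ≠ 0 := fun h => by simp [h] at hz
      have e1 : mellin Φ z = mellin (fun u => ∑' n, g n u) z - mellin (fun u => ∑' n, l n u) z -
          mellin (fun u => ∑' n, k n u) z := by
        have h1 := hasMellin_sub hg1 hl1
        have h2 := hasMellin_sub h1.1 hk1
        rw [h2.2, h1.2]
      have e2 : mellin (fun u => ∑' n, g n u) z = (∑' n, a n * (n : ℂ) ^ z) / z ^ 2 := by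
        rw [← hg2.tsum_eq, ← tsum_div_const]
        refine tsum_congr fun n => ?_
        rcases Nat.eq_zero_or_pos n with rfl | hn
        · simp [hg, ha0, mellin]
        · have := mellin_log_sub (n := n) (by exact_mod_cast hn) hz
          simp only [hg]
          rw [show (fun u : ℝ => a n * ((max 0 (Real.log (max u 1) - Real.log n) : ℝ) : ℂ)) =
            fun u : ℝ => a n • ((max 0 (Real.log (max u 1) - Real.log n) : ℝ) : ℂ) from rfl,
            mellin_const_smul, this, smul_eq_mul, mul_div_assoc, Complex.ofReal_natCast]
      have e3 : mellin (fun u => ∑' n, l n u) z = F₀ / z ^ 2 := by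
        rw [← hl2.tsum_eq]
        have := mellin_log_sub (n := 1) le_rfl hz
        simp only [hl, tsum_fintype, Finset.univ_unique, Finset.sum_const, Finset.card_singleton,
          one_smul]
        rw [show (fun u : ℝ => F₀ * ((max 0 (Real.log (max u 1) - Real.log 1) : ℝ) : ℂ)) =
            fun u : ℝ => F₀ • ((max 0 (Real.log (max u 1) - Real.log 1) : ℝ) : ℂ) from rfl,
            mellin_const_smul, this, smul_eq_mul]
        simp [div_eq_mul_inv]
      have e4 : mellin (fun u => ∑' n, k n u) z =
          (∑' n, a n * (n : ℂ) ^ z - F₀) / z ^ 2 := by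
        have h1 := ((hF (-z) (by simp [hz])).mul_left (-1 / z ^ 2))
        rw [neg_neg] at h1
        rw [← hk2.tsum_eq]
        refine (Eq.trans (tsum_congr fun i => ?_) h1.tsum_eq).trans ?_
        · have hbi := hb i
          have hb0 : b i ≠ 0 := fun h => by simp [h] at hbi
          have hzb : z - b i ≠ 0 := fun h => by
            have := congrArg Complex.re h
            simp [hz] at this
            linarith
          have hzb' : -z + b i ≠ 0 := fun h => hzb (by linear_combination -h)
          simp only [hk]
          rw [show (fun u : ℝ => m i / b i ^ 2 * (1 - ((max u 1 : ℝ) : ℂ) ^ (-b i))) =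
            fun u : ℝ => (m i / b i ^ 2) • (1 - ((max u 1 : ℝ) : ℂ) ^ (-b i)) from rfl,
            mellin_const_smul, mellin_one_sub_cpow hbi hz, smul_eq_mul]
          rw [show -z + b i = -(z - b i) by ring]
          field_simp
          ring
        · ring
      change mellin Φ z = 0
      rw [e1, e2, e3, e4]
      ring
  have h1 : Φ u = (∑' n : ℕ, a n * ((max 0 (Real.log u - Real.log n) : ℝ) : ℂ)) -
      F₀ * Real.log u - ∑' i, m i / b i ^ 2 * (1 - (u : ℂ) ^ (-b i)) := by
    simp only [hΦ, hg, hl, hk, max_eq_left hu]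
    simp [max_eq_right (Real.log_nonneg hu)]
  rw [h1] at hΦu
  linear_combination hΦu

section


theorem tsum_mul_max_log_eq_sum (a : ℕ → ℂ) (ha0 : a 0 = 0) {x u : ℝ} (hu : 0 < u) (hux : u ≤ x) :
    ∑' n : ℕ, a n * ((max 0 (Real.log u - Real.log n) : ℝ) : ℂ) =
      ∑ n ∈ Finset.filter (fun n : ℕ => (n : ℝ) < x) (Finset.range (⌈x⌉₊ + 1)),
        a n * ((max 0 (Real.log u - Real.log n) : ℝ) : ℂ) := by
  refine tsum_eq_sum fun n hn => ?_
  rcases Nat.eq_zero_or_pos n with rfl | hn0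
  · rw [ha0, zero_mul]
  have hxn : x ≤ n := by
    by_contra! h
    refine hn (Finset.mem_filter.2 ⟨Finset.mem_range.2 ?_, h⟩)
    have := h.trans_le (Nat.le_ceil x)
    have : n < ⌈x⌉₊ := by exact_mod_cast this
    omega
  rw [max_eq_left]
  · simp
  · linarith [Real.log_le_log hu (hux.trans hxn)]

theorem Dpoly_mul_log_eq {q : ℕ} (χ : DirichletCharacter ℂ q) {x : ℝ} (hx : 1 < x) (s : ℂ) :
    Dpoly χ x s * Real.log x =
      ∑' n : ℕ, (Λ n : ℂ) * χ n / (n : ℂ) ^ s *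
        ((max 0 (Real.log (x ^ 2) - Real.log n) : ℝ) : ℂ) -
      ∑' n : ℕ, (Λ n : ℂ) * χ n / (n : ℂ) ^ s *
        ((max 0 (Real.log x - Real.log n) : ℝ) : ℂ) := by
  have hx0 : 0 < x := by linarith
  have hl : 0 < Real.log x := Real.log_pos hx
  rw [tsum_mul_max_log_eq_sum (fun n : ℕ => (Λ n : ℂ) * χ n / (n : ℂ) ^ s) (by simp)
      (x := x ^ 2) (by positivity) le_rfl,
    tsum_mul_max_log_eq_sum (fun n : ℕ => (Λ n : ℂ) * χ n / (n : ℂ) ^ s) (by simp)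
      (x := x ^ 2) hx0 (by nlinarith), ← Finset.sum_sub_distrib, Dpoly, Finset.sum_mul]
  refine Finset.sum_congr rfl fun n hn => ?_
  have hn2 := (Finset.mem_filter.1 hn).2
  rcases Nat.eq_zero_or_pos n with rfl | hn0
  · simp [Lambdax, hx0.le]
  have hnR : (0 : ℝ) < n := by exact_mod_cast hn0
  have hle : Real.log n ≤ Real.log (x ^ 2) := Real.log_le_log hnR hn2.le
  have key : Lambdax x n * Real.log x = Λ n * (max 0 (Real.log (x ^ 2) - Real.log n) -
      max 0 (Real.log x - Real.log n)) := by
    rw [max_eq_right (by linarith)]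
    unfold Lambdax
    split_ifs with h1 h2
    · rw [max_eq_right (by linarith [Real.log_le_log hnR h1]), Real.log_pow]
      push_cast; ring
    · rw [max_eq_left (by linarith [Real.log_le_log hx0 (not_le.1 h1).le]),
        Real.log_div (by positivity) hnR.ne']
      field_simp
      ring
    · exact absurd hn2.le h2
  have key' : (Lambdax x n : ℂ) * Real.log x = Λ n *
      (((max 0 (Real.log (x ^ 2) - Real.log n) : ℝ) : ℂ) -
        ((max 0 (Real.log x - Real.log n) : ℝ) : ℂ)) := by
    exact_mod_cast congrArg (fun r : ℝ => (r : ℂ)) key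
  linear_combination (χ n / (n : ℂ) ^ s) * key'

theorem hasSum_one_div_add_two_mul_sub {z w : ℂ} (hz : 1 / 4 ≤ (z / 2).re)
    (hw : 1 / 4 ≤ (w / 2).re) :
    HasSum (fun j : ℕ => 1 / (z + 2 * j) - 1 / (w + 2 * j))
      ((Complex.digamma (w / 2) - Complex.digamma (z / 2)) / 2) := by
  refine ((hasSum_digamma_sub hz hw).div_const 2).congr_fun fun j => ?_
  have h1 : ∀ z : ℂ, 1 / (z + 2 * j) = 1 / (z / 2 + j) / 2 := fun z => by
    rw [div_div]
    congr 1
    ring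
  rw [h1, h1, sub_div]

variable {q : ℕ} [NeZero q] {χ : DirichletCharacter ℂ q} (hq : 1 < q) (hχ : χ.IsPrimitive)
  (hG : ∀ ρ : ℂ, DirichletCharacter.LFunction χ ρ = 0 → 0 < ρ.re → ρ.re < 1 → ρ.re = 1 / 2)

theorem tsum_vonMangoldt_mul_eq {s w : ℂ} (h : 1 < (s + w).re) :
    ∑' n : ℕ, (Λ n : ℂ) * χ n / (n : ℂ) ^ s * (n : ℂ) ^ (-w) =
      -logDeriv (DirichletCharacter.LFunction χ) (s + w) := by
  rw [logDeriv_apply, DirichletCharacter.deriv_LFunction_eq_deriv_LSeries _ h,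
    DirichletCharacter.LFunction_eq_LSeries _ h, ← neg_div,
    ← DirichletCharacter.LSeries_twist_vonMangoldt_eq _ h, LSeries]
  refine tsum_congr fun n => ?_
  rcases Nat.eq_zero_or_pos n with rfl | hn0
  · simp
  · have hn : (n : ℂ) ≠ 0 := by exact_mod_cast hn0.ne'
    rw [LSeries.term_of_ne_zero hn0.ne', Complex.cpow_add _ _ hn, Complex.cpow_neg, Pi.mul_apply]
    have h1 : (n : ℂ) ^ s ≠ 0 := by simp [Complex.cpow_eq_zero_iff, hn]
    have h2 : (n : ℂ) ^ w ≠ 0 := by simp [Complex.cpow_eq_zero_iff, hn]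
    field_simp

omit [NeZero q] in
theorem summable_norm_vonMangoldt_mul {s : ℂ} (h : 1 / 2 < s.re) :
    Summable fun n : ℕ => ‖(Λ n : ℂ) * χ n / (n : ℂ) ^ s‖ / (n : ℝ) ^ 2 := by
  have h1 := (DirichletCharacter.LSeriesSummable_twist_vonMangoldt χ
    (s := s + 2) (by simp; linarith)).norm
  refine h1.congr fun n => ?_
  rcases Nat.eq_zero_or_pos n with rfl | hn0
  · simp
  · have hn : (n : ℂ) ≠ 0 := by exact_mod_cast hn0.ne'
    rw [LSeries.term_of_ne_zero hn0.ne', Complex.cpow_add _ _ hn, Pi.mul_apply, norm_div, norm_div,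
      norm_mul, norm_mul, norm_mul, div_div, Complex.cpow_ofNat, norm_pow, Complex.norm_natCast,
      mul_comm ‖χ n‖]

/-- The shifts `s - ρ` by the zeros of `L(·, χ)`, trivial zeros included. -/
noncomputable def zeroShift (χ : DirichletCharacter ℂ q) (s : ℂ) :
    {ρ : ℂ // zeroMult χ ρ ≠ 0} ⊕ ℕ → ℂ :=
  Sum.elim (fun ρ => s - ρ) fun k => s + parity χ + 2 * k

/-- The multiplicities of the zeros of `L(·, χ)`, trivial zeros included. -/
noncomputable def zeroWeight (χ : DirichletCharacter ℂ q) :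
    {ρ : ℂ // zeroMult χ ρ ≠ 0} ⊕ ℕ → ℂ :=
  Sum.elim (fun ρ => zeroMult χ ρ) fun _ => 1

omit [NeZero q] in
theorem norm_add_parity_ge {s : ℂ} (hs : 1 / 2 < s.re) (k : ℕ) :
    2 * ((k : ℝ) + 1 / 4) ≤ ‖s + parity χ + 2 * k‖ := by
  refine le_trans ?_ (Complex.re_le_norm _)
  have := parity_nonneg χ
  simp; linarith

include hq hχ hG

theorem hasSum_zeroMult_subtype {s : ℂ} (hs : 1 / 2 < s.re) :
    HasSum (fun ρ : {ρ : ℂ // zeroMult χ ρ ≠ 0} => (zeroMult χ ρ : ℝ) / ‖s - ρ‖ ^ 2)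
      (∑' ρ, (zeroMult χ ρ : ℝ) / ‖s - ρ‖ ^ 2) := by
  have := (hasSum_subtype_iff_of_support_subset (s := {ρ : ℂ | zeroMult χ ρ ≠ 0}) ?_).2
    (summable_zeroMult_div hq hχ hG hs).hasSum
  · exact this
  · intro ρ hρ h
    exact hρ (by simp [h])

theorem countable_zeroMult_ne_zero : Countable {ρ : ℂ // zeroMult χ ρ ≠ 0} := by
  have h1 := (summable_zeroMult_div hq hχ hG (s := 1) (by norm_num)).countable_support
  refine (h1.mono fun ρ hρ => ?_).to_subtype
  have h2 := re_eq_half_of_zeroMult_ne_zero hq hχ hG hρ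
  have h3 : (1 : ℂ) - ρ ≠ 0 := fun h => by
    have := congrArg Complex.re h
    simp [h2] at this
    norm_num at this
  have h4 : (zeroMult χ ρ : ℝ) ≠ 0 := by exact_mod_cast hρ
  exact div_ne_zero h4 (pow_ne_zero _ (norm_ne_zero_iff.2 h3))

theorem zeroShift_re_pos {s : ℂ} (hs : 1 / 2 < s.re) (i) : 0 < (zeroShift χ s i).re := by
  rcases i with ρ | k
  · simp [zeroShift, re_eq_half_of_zeroMult_ne_zero hq hχ hG ρ.2]; linarith
  · have := parity_nonneg χ
    simp only [zeroShift, Sum.elim_inr]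
    simp; linarith [Nat.cast_nonneg (α := ℝ) k]

theorem summable_zeroWeight_div {s : ℂ} (hs : 1 / 2 < s.re) :
    Summable fun i => ‖zeroWeight χ i‖ / ‖zeroShift χ s i‖ ^ 2 := by
  refine Summable.sum _ ?_ ?_
  · refine (hasSum_zeroMult_subtype hq hχ hG hs).summable.congr fun ρ => ?_
    simp [zeroWeight, zeroShift]
  · refine Summable.of_nonneg_of_le (fun k => by rw [Function.comp]; positivity) (fun k => ?_)
      (summable_one_div_add_quarter_sq.mul_left (1 / 4))
    simp only [zeroWeight, zeroShift, Function.comp, Sum.elim_inr, norm_one]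
    calc 1 / ‖s + parity χ + 2 * (k : ℂ)‖ ^ 2 ≤ 1 / (2 * ((k : ℝ) + 1 / 4)) ^ 2 := by
          gcongr; exact norm_add_parity_ge hs k
      _ = _ := by field_simp; ring

theorem hasSum_zeroWeight {s w : ℂ} (hs : 1 / 2 < s.re) (hw : 0 < w.re) :
    HasSum (fun i => zeroWeight χ i * (1 / (w + zeroShift χ s i) - 1 / zeroShift χ s i))
      (logDeriv (DirichletCharacter.LFunction χ) (s + w) -
        logDeriv (DirichletCharacter.LFunction χ) s) := by
  have hsw : 1 / 2 < (s + w).re := by simp; linarith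
  have h1 := hasSum_zeroMult_sub hq hχ hG hs hsw
  rw [← hasSum_subtype_iff_of_support_subset (s := {ρ : ℂ | zeroMult χ ρ ≠ 0})
    (fun ρ hρ h => hρ (by simp [h]))] at h1
  have h2 := hasSum_one_div_add_two_mul_sub (half_parity_re (χ := χ) hsw)
    (half_parity_re (χ := χ) hs)
  have h3 := HasSum.sum (f := fun i => zeroWeight χ i *
    (1 / (w + zeroShift χ s i) - 1 / zeroShift χ s i)) (h1.congr_fun fun ρ => ?_) (h2.congr_fun fun k => ?_)
  · convert h3 using 1
    ring
  · simp only [Function.comp, zeroWeight, zeroShift, Sum.elim_inl]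
    congr 3
    ring
  · simp only [Function.comp, zeroWeight, zeroShift, Sum.elim_inr, one_mul]
    congr 2
    ring

theorem tsum_vonMangoldt_max_log {s : ℂ} (hs : 1 / 2 < s.re) {u : ℝ} (hu : 1 ≤ u) :
    ∑' n : ℕ, (Λ n : ℂ) * χ n / (n : ℂ) ^ s * ((max 0 (Real.log u - Real.log n) : ℝ) : ℂ) =
      -logDeriv (DirichletCharacter.LFunction χ) s * Real.log u +
        ∑' i, zeroWeight χ i / zeroShift χ s i ^ 2 * (1 - (u : ℂ) ^ (-zeroShift χ s i)) := by
  have := countable_zeroMult_ne_zero hq hχ hG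
  refine explicit_formula_of_hasSum (a := fun n : ℕ => (Λ n : ℂ) * χ n / (n : ℂ) ^ s) (by simp)
    (summable_norm_vonMangoldt_mul hs) (zeroShift_re_pos hq hχ hG hs)
    (summable_zeroWeight_div hq hχ hG hs) (fun w hw => ?_) hu
  convert hasSum_zeroWeight hq hχ hG hs (w := w) (by linarith) using 1
  rw [tsum_vonMangoldt_mul_eq (by simp; linarith)]
  ring

theorem norm_logDeriv_add_Dpoly_le {x : ℝ} (hx : 1 < x) {s : ℂ} (hs : 1 / 2 < s.re) :
    ‖logDeriv (DirichletCharacter.LFunction χ) s + Dpoly χ x s‖ * Real.log x ≤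
      x ^ (1 / 2 - s.re) * (1 + x ^ (1 / 2 - s.re)) *
        (∑' ρ, (zeroMult χ ρ : ℝ) / ‖s - ρ‖ ^ 2) +
      1 / 2 * ∑' j : ℕ, 1 / ((j : ℝ) + 1 / 4) ^ 2 := by
  have hx0 : 0 < x := by linarith
  have hl : 0 < Real.log x := Real.log_pos hx
  have hsum := summable_zeroWeight_div hq hχ hG hs
  have hpos := zeroShift_re_pos hq hχ hG hs
  have hnorm : ∀ i, ‖(x : ℂ) ^ (-zeroShift χ s i)‖ = x ^ (-zeroShift χ s i).re := fun i =>
    Complex.norm_cpow_eq_rpow_re_of_pos hx0 _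
  have hle1 : ∀ i, ‖(x : ℂ) ^ (-zeroShift χ s i)‖ ≤ 1 := fun i => by
    rw [hnorm]
    exact Real.rpow_le_one_of_one_le_of_nonpos hx.le (by simpa using (hpos i).le)
  have hsq : ∀ i, ((x ^ 2 : ℝ) : ℂ) ^ (-zeroShift χ s i) = ((x : ℂ) ^ (-zeroShift χ s i)) ^ 2 :=
    fun i => by
      rw [sq x, Complex.ofReal_mul, Complex.mul_cpow_ofReal_nonneg hx0.le hx0.le, sq]
  have hs1 : Summable fun i => zeroWeight χ i / zeroShift χ s i ^ 2 *
      (1 - (x : ℂ) ^ (-zeroShift χ s i)) := by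
    refine Summable.of_norm_bounded (hsum.mul_right 2) fun i => ?_
    rw [norm_mul, norm_div, norm_pow]
    gcongr
    refine (norm_sub_le _ _).trans ?_
    rw [norm_one]
    linarith [hle1 i]
  have hs2 : Summable fun i => zeroWeight χ i / zeroShift χ s i ^ 2 *
      (1 - ((x ^ 2 : ℝ) : ℂ) ^ (-zeroShift χ s i)) := by
    refine Summable.of_norm_bounded (hsum.mul_right 2) fun i => ?_
    rw [norm_mul, norm_div, norm_pow, hsq]
    gcongr
    refine (norm_sub_le _ _).trans ?_
    rw [norm_one, norm_pow]
    have := pow_le_one₀ (n := 2) (norm_nonneg _) (hle1 i)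
    linarith
  have key : (logDeriv (DirichletCharacter.LFunction χ) s + Dpoly χ x s) * Real.log x =
      ∑' i, zeroWeight χ i / zeroShift χ s i ^ 2 * ((x : ℂ) ^ (-zeroShift χ s i) *
        (1 - (x : ℂ) ^ (-zeroShift χ s i))) := by
    rw [add_mul, Dpoly_mul_log_eq χ hx, tsum_vonMangoldt_max_log hq hχ hG hs hx.le,
      tsum_vonMangoldt_max_log hq hχ hG hs (by nlinarith), Real.log_pow]
    have h1 := hs2.tsum_sub hs1
    have h2 : (∑' i, zeroWeight χ i / zeroShift χ s i ^ 2 * ((x : ℂ) ^ (-zeroShift χ s i) *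
        (1 - (x : ℂ) ^ (-zeroShift χ s i)))) = ∑' i, (zeroWeight χ i / zeroShift χ s i ^ 2 *
      (1 - ((x ^ 2 : ℝ) : ℂ) ^ (-zeroShift χ s i)) - zeroWeight χ i / zeroShift χ s i ^ 2 *
      (1 - (x : ℂ) ^ (-zeroShift χ s i))) := by
      refine tsum_congr fun i => ?_
      rw [hsq]
      ring
    rw [h2, h1]
    push_cast
    ring
  have hlog : ‖(Real.log x : ℂ)‖ = Real.log x := by
    rw [Complex.norm_real, Real.norm_eq_abs, abs_of_pos hl]
  rw [← hlog, ← norm_mul, key]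
  refine tsum_of_norm_bounded (g := Sum.elim
    (fun ρ : {ρ : ℂ // zeroMult χ ρ ≠ 0} => x ^ (1 / 2 - s.re) * (1 + x ^ (1 / 2 - s.re)) *
      ((zeroMult χ ρ : ℝ) / ‖s - ρ‖ ^ 2))
    (fun k : ℕ => 1 / 2 * (1 / ((k : ℝ) + 1 / 4) ^ 2)))
    (HasSum.sum ((hasSum_zeroMult_subtype hq hχ hG hs).mul_left _)
      (summable_one_div_add_quarter_sq.hasSum.mul_left _)) ?_
  rintro (ρ | k)
  · have h1 := hnorm (Sum.inl ρ)
    have h2 : (-zeroShift χ s (Sum.inl ρ)).re = 1 / 2 - s.re := by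
      simp [zeroShift, re_eq_half_of_zeroMult_ne_zero hq hχ hG ρ.2]
    rw [h2] at h1
    rw [norm_mul, norm_mul, norm_div, norm_pow, h1, mul_comm]
    simp only [zeroWeight, Sum.elim_inl, Complex.norm_natCast]
    have h3 : ‖1 - (x : ℂ) ^ (-zeroShift χ s (Sum.inl ρ))‖ ≤ 1 + x ^ (1 / 2 - s.re) := by
      refine (norm_sub_le _ _).trans ?_
      rw [norm_one, h1]
    have h4 : zeroShift χ s (Sum.inl ρ) = s - ρ := rfl
    rw [h4] at h3 ⊢
    gcongr
  · rw [norm_mul, norm_mul, norm_div, norm_pow]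
    simp only [zeroWeight, Sum.elim_inr, norm_one]
    have h3 : ‖1 - (x : ℂ) ^ (-zeroShift χ s (Sum.inr k))‖ ≤ 2 := by
      refine (norm_sub_le _ _).trans ?_
      rw [norm_one]
      linarith [hle1 (Sum.inr k)]
    have h5 := norm_add_parity_ge (χ := χ) hs k
    have h4 : zeroShift χ s (Sum.inr k) = s + parity χ + 2 * k := rfl
    have h6 := hle1 (Sum.inr k)
    rw [h4] at h3 h6 ⊢
    calc _ ≤ 1 / (2 * ((k : ℝ) + 1 / 4)) ^ 2 * (1 * 2) := by gcongr
      _ = _ := by field_simp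

end

section

theorem lintegral_abs_div_sq_add_sq_le (a h y : ℝ) (hh : 0 ≤ h) :
    ∫⁻ σ in Set.Ioc a (a + h), ENNReal.ofReal (|y| / ((σ - a) ^ 2 + y ^ 2)) ≤
      ENNReal.ofReal (π / 2) := by
  rcases eq_or_ne y 0 with rfl | hy
  · simp
  have hy' : 0 < |y| := abs_pos.2 hy
  have hden : ∀ σ : ℝ, (σ - a) ^ 2 + y ^ 2 ≠ 0 := fun σ => by positivity
  have hcont : Continuous fun σ : ℝ => |y| / ((σ - a) ^ 2 + y ^ 2) :=
    continuous_const.div (by fun_prop) hden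
  have hderiv : ∀ σ : ℝ, HasDerivAt (fun σ : ℝ => Real.arctan ((σ - a) / |y|))
      (|y| / ((σ - a) ^ 2 + y ^ 2)) σ := fun σ => by
    refine (((hasDerivAt_id σ).sub_const a).div_const |y|).arctan.congr_deriv ?_
    have h1 := hden σ
    rw [← sq_abs y] at h1 ⊢
    have h2 : 1 + ((σ - a) / |y|) ^ 2 ≠ 0 := by positivity
    have h3 : |y| ^ 2 + (σ - a) ^ 2 ≠ 0 := by positivity
    simp only [id]
    field_simp
    ring
  rw [← ofReal_integral_eq_lintegral_ofReal (hcont.integrableOn_Icc.mono_set Set.Ioc_subset_Icc_self)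
    (Eventually.of_forall fun σ => by positivity)]
  refine ENNReal.ofReal_le_ofReal ?_
  rw [← intervalIntegral.integral_of_le (by linarith),
    intervalIntegral.integral_eq_sub_of_hasDerivAt (fun σ _ => hderiv σ)
      (hcont.intervalIntegrable _ _)]
  simp [(Real.arctan_lt_pi_div_two _).le]

theorem abs_im_one_div_sub_one_div_le {s z ρ : ℂ} (h1 : ρ.re ≤ z.re) (h2 : z.re ≤ s.re)
    (him : z.im = s.im) :
    |(1 / (z - ρ) - 1 / (s - ρ)).im| ≤ (s.re - ρ.re) ^ 2 / ‖s - ρ‖ ^ 2 *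
      (|s.im - ρ.im| / ((z.re - ρ.re) ^ 2 + (s.im - ρ.im) ^ 2)) := by
  rcases eq_or_ne (s.im - ρ.im) 0 with h0 | h0
  · simp [him, h0]
  have hs : ‖s - ρ‖ ^ 2 = (s.re - ρ.re) ^ 2 + (s.im - ρ.im) ^ 2 := by
    rw [Complex.sq_norm, Complex.normSq_apply, Complex.sub_re, Complex.sub_im]
    ring
  have h3 : (1 / (z - ρ) - 1 / (s - ρ)).im = -((s.im - ρ.im) *
      ((s.re - ρ.re) ^ 2 - (z.re - ρ.re) ^ 2)) / (((s.re - ρ.re) ^ 2 + (s.im - ρ.im) ^ 2) *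
        ((z.re - ρ.re) ^ 2 + (s.im - ρ.im) ^ 2)) := by
    have e1 : (s.re - ρ.re) ^ 2 + (s.im - ρ.im) ^ 2 ≠ 0 := by positivity
    have e2 : (z.re - ρ.re) ^ 2 + (s.im - ρ.im) ^ 2 ≠ 0 := by positivity
    rw [Complex.sub_im, one_div, one_div, Complex.inv_im, Complex.inv_im, Complex.normSq_apply,
      Complex.normSq_apply]
    simp only [Complex.sub_re, Complex.sub_im, him, ← sq]
    field_simp
    ring
  rw [h3, hs, abs_div, abs_neg, abs_mul, div_mul_div_comm]
  rw [abs_of_nonneg (a := ((s.re - ρ.re) ^ 2 + (s.im - ρ.im) ^ 2) * _) (by positivity), mul_comm |_|]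
  gcongr
  rw [abs_of_nonneg (by nlinarith)]
  nlinarith [sq_nonneg (z.re - ρ.re)]

theorem one_div_exp_one_mul_lt : 1 / Real.exp 1 * (1 + 1 / Real.exp 1) < 1 := by
  have h1 := Real.exp_one_gt_d9
  have h2 : 1 / Real.exp 1 ≤ 1 / 2 := one_div_le_one_div_of_le (by norm_num) (by linarith)
  have h3 : 0 < 1 / Real.exp 1 := by positivity
  nlinarith

variable {q : ℕ} [NeZero q] {χ : DirichletCharacter ℂ q} (hq : 1 < q) (hχ : χ.IsPrimitive)
  (hG : ∀ ρ : ℂ, DirichletCharacter.LFunction χ ρ = 0 → 0 < ρ.re → ρ.re < 1 → ρ.re = 1 / 2)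
include hq hχ hG

theorem abs_im_logDeriv_sub_le {s z : ℂ} (hz : 1 / 2 < z.re) (hzs : z.re ≤ s.re)
    (hs1 : s.re ≤ 3 / 2) (him : z.im = s.im) :
    ENNReal.ofReal |(logDeriv (DirichletCharacter.LFunction χ) s -
        logDeriv (DirichletCharacter.LFunction χ) z).im| ≤
      ∑' ρ : {ρ : ℂ // zeroMult χ ρ ≠ 0}, ENNReal.ofReal
        ((s.re - 1 / 2) ^ 2 * ((zeroMult χ ρ : ℝ) / ‖s - ρ‖ ^ 2)) * ENNReal.ofReal
          (|s.im - (ρ : ℂ).im| / ((z.re - 1 / 2) ^ 2 + (s.im - (ρ : ℂ).im) ^ 2)) +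
      ENNReal.ofReal (1 / 4 * ∑' j : ℕ, 1 / ((j : ℝ) + 1 / 4) ^ 2) := by
  have hs : 1 / 2 < s.re := by linarith
  have hre : ∀ ρ : {ρ : ℂ // zeroMult χ ρ ≠ 0}, (ρ : ℂ).re = 1 / 2 := fun ρ =>
    re_eq_half_of_zeroMult_ne_zero hq hχ hG ρ.2
  have h1 := hasSum_zeroMult_sub hq hχ hG hs hz
  rw [← hasSum_subtype_iff_of_support_subset (s := {ρ : ℂ | zeroMult χ ρ ≠ 0})
    (fun ρ hρ h => hρ (by simp [h]))] at h1
  set f : {ρ : ℂ // zeroMult χ ρ ≠ 0} → ℝ := fun ρ =>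
    (s.re - 1 / 2) ^ 2 * ((zeroMult χ ρ : ℝ) / ‖s - ρ‖ ^ 2) *
      (|s.im - (ρ : ℂ).im| / ((z.re - 1 / 2) ^ 2 + (s.im - (ρ : ℂ).im) ^ 2)) with hf
  have hf0 : ∀ ρ, 0 ≤ f ρ := fun ρ => by positivity
  have hfs : Summable f := by
    refine Summable.of_nonneg_of_le hf0 (fun ρ => ?_)
      (((hasSum_zeroMult_subtype hq hχ hG hs).summable.mul_left ((s.re - 1 / 2) ^ 2)).mul_right
        (1 / (z.re - 1 / 2)))
    have hu : 0 < z.re - 1 / 2 := by linarith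
    refine mul_le_mul_of_nonneg_left ?_ (by positivity)
    rw [div_le_div_iff₀ (by positivity) hu]
    nlinarith [sq_nonneg (z.re - 1 / 2 - |s.im - (ρ : ℂ).im|), sq_abs (s.im - (ρ : ℂ).im),
      abs_nonneg (s.im - (ρ : ℂ).im)]
  have h2 : HasSum (fun ρ : {ρ : ℂ // zeroMult χ ρ ≠ 0} => (((fun ρ => (zeroMult χ ρ : ℂ) *
      (1 / (z - ρ) - 1 / (s - ρ))) ∘ Subtype.val) ρ).im) _ := Complex.hasSum_im h1
  have h3 : |∑' ρ : {ρ : ℂ // zeroMult χ ρ ≠ 0}, (((fun ρ => (zeroMult χ ρ : ℂ) *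
      (1 / (z - ρ) - 1 / (s - ρ))) ∘ Subtype.val) ρ).im| ≤ ∑' ρ, f ρ := by
    rw [← Real.norm_eq_abs]
    refine tsum_of_norm_bounded hfs.hasSum fun ρ => ?_
    have h4 := abs_im_one_div_sub_one_div_le (s := s) (z := z) (ρ := ρ)
      (by rw [hre]; exact hz.le) hzs him
    rw [hre] at h4
    simp only [Function.comp, hf]
    rw [← Complex.ofReal_natCast, Complex.im_ofReal_mul, Real.norm_eq_abs, abs_mul,
      abs_of_nonneg (Nat.cast_nonneg _)]
    refine (mul_le_mul_of_nonneg_left h4 (Nat.cast_nonneg _)).trans_eq ?_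
    ring
  rw [h2.tsum_eq, Complex.add_im] at h3
  have h5 : |((Complex.digamma ((z + parity χ) / 2) -
      Complex.digamma ((s + parity χ) / 2)) / 2).im| ≤
      1 / 4 * ∑' j : ℕ, 1 / ((j : ℝ) + 1 / 4) ^ 2 := by
    refine (Complex.abs_im_le_norm _).trans ?_
    have h6 := norm_digamma_sub_le (half_parity_re (χ := χ) hs) (half_parity_re (χ := χ) hz)
    have h7 : ‖(z + parity χ) / 2 - (s + parity χ) / 2‖ ≤ 1 / 2 := by
      rw [show (z + parity χ) / 2 - (s + parity χ) / 2 = ((-((s.re - z.re) / 2) : ℝ) : ℂ) by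
        apply Complex.ext <;> simp [him]
        ring]
      rw [Complex.norm_real, Real.norm_eq_abs, abs_neg, abs_of_nonneg (by linarith)]
      linarith
    have h8 : 0 ≤ ∑' j : ℕ, 1 / ((j : ℝ) + 1 / 4) ^ 2 := tsum_nonneg fun j => by positivity
    rw [norm_div, Complex.norm_ofNat]
    nlinarith
  have h9 : |(logDeriv (DirichletCharacter.LFunction χ) s -
        logDeriv (DirichletCharacter.LFunction χ) z).im| ≤
      ∑' ρ, f ρ + 1 / 4 * ∑' j : ℕ, 1 / ((j : ℝ) + 1 / 4) ^ 2 := by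
    rw [← abs_neg, ← Complex.neg_im, neg_sub]
    rw [abs_le] at *
    constructor <;> linarith [h3.1, h3.2, h5.1, h5.2]
  refine (ENNReal.ofReal_le_ofReal h9).trans ?_
  rw [ENNReal.ofReal_add (tsum_nonneg hf0) (mul_nonneg (by norm_num)
    (tsum_nonneg fun j => by positivity)), ENNReal.ofReal_tsum_of_nonneg hf0 hfs]
  gcongr with ρ
  rw [hf, ENNReal.ofReal_mul (by positivity)]

theorem abs_im_integral_logDeriv_sub_le {h : ℝ} (hh : 0 < h) (hh1 : h ≤ 1) (t : ℝ) :
    |(∫ σ in (1 / 2 : ℝ)..(1 / 2 + h : ℝ),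
        (logDeriv (DirichletCharacter.LFunction χ) ((1 / 2 + h : ℝ) + t * I) -
          logDeriv (DirichletCharacter.LFunction χ) ((σ : ℝ) + t * I))).im| ≤
      h ^ 2 * (∑' ρ, (zeroMult χ ρ : ℝ) / ‖((1 / 2 + h : ℝ) + t * I : ℂ) - ρ‖ ^ 2) * (π / 2) +
        1 / 4 * (∑' j : ℕ, 1 / ((j : ℝ) + 1 / 4) ^ 2) * h := by
  set s : ℂ := (1 / 2 + h : ℝ) + t * I with hs
  set S := ∑' j : ℕ, 1 / ((j : ℝ) + 1 / 4) ^ 2 with hS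
  have hS0 : 0 ≤ S := tsum_nonneg fun j => by positivity
  have hsre : s.re = 1 / 2 + h := by simp [hs]
  have hsim : s.im = t := by simp [hs]
  have hsum := hasSum_zeroMult_subtype hq hχ hG (s := s) (by rw [hsre]; linarith)
  set T := ∑' ρ, (zeroMult χ ρ : ℝ) / ‖s - ρ‖ ^ 2 with hT
  have hT0 : 0 ≤ T := tsum_nonneg fun j => by positivity
  have := countable_zeroMult_ne_zero hq hχ hG
  set f : ℝ → ℂ := fun σ => logDeriv (DirichletCharacter.LFunction χ) s -
    logDeriv (DirichletCharacter.LFunction χ) ((σ : ℝ) + t * I) with hf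
  change |(∫ σ in (1 / 2 : ℝ)..(1 / 2 + h : ℝ), f σ).im| ≤ _
  by_cases hInt : IntervalIntegrable f volume (1 / 2) (1 / 2 + h)
  swap
  · rw [intervalIntegral.integral_undef hInt]
    simp only [Complex.zero_im, abs_zero]
    positivity
  rw [intervalIntegral.integral_of_le (by linarith)]
  have him : (∫ σ in Set.Ioc (1 / 2) (1 / 2 + h), f σ).im =
      ∫ σ in Set.Ioc (1 / 2) (1 / 2 + h), (f σ).im :=
    (integral_im (𝕜 := ℂ) ((intervalIntegrable_iff_integrableOn_Ioc_of_le (by linarith)).1 hInt)).symm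
  rw [him, ← Real.norm_eq_abs]
  refine (norm_integral_le_lintegral_norm _).trans (ENNReal.toReal_le_of_le_ofReal (by positivity) ?_)
  have hle : ∀ σ ∈ Set.Ioc (1 / 2) (1 / 2 + h), ENNReal.ofReal ‖(f σ).im‖ ≤
      ∑' ρ : {ρ : ℂ // zeroMult χ ρ ≠ 0}, ENNReal.ofReal
        (h ^ 2 * ((zeroMult χ ρ : ℝ) / ‖s - ρ‖ ^ 2)) * ENNReal.ofReal
          (|t - (ρ : ℂ).im| / ((σ - 1 / 2) ^ 2 + (t - (ρ : ℂ).im) ^ 2)) +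
      ENNReal.ofReal (1 / 4 * S) := by
    intro σ hσ
    have := abs_im_logDeriv_sub_le hq hχ hG (s := s) (z := (σ : ℝ) + t * I)
      (by simpa using hσ.1) (by rw [hsre]; simpa using hσ.2) (by rw [hsre]; linarith) (by simp [hs])
    have hzre : ((σ : ℂ) + t * I).re = σ := by simp
    rw [hsre, hsim, hzre, add_sub_cancel_left] at this
    exact this
  refine (setLIntegral_mono' measurableSet_Ioc hle).trans ?_
  rw [lintegral_add_right _ measurable_const, lintegral_tsum fun ρ =>
    (Measurable.const_mul (by fun_prop) _).aemeasurable]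
  rw [ENNReal.ofReal_add (by positivity) (by positivity)]
  refine add_le_add ?_ ?_
  · calc
      _ ≤ ∑' ρ : {ρ : ℂ // zeroMult χ ρ ≠ 0}, ENNReal.ofReal
          (h ^ 2 * ((zeroMult χ ρ : ℝ) / ‖s - ρ‖ ^ 2)) * ENNReal.ofReal (π / 2) := by
          refine ENNReal.tsum_le_tsum fun ρ => ?_
          rw [lintegral_const_mul _ (by fun_prop)]
          gcongr
          exact lintegral_abs_div_sq_add_sq_le _ _ _ hh.le
      _ = _ := by
          rw [ENNReal.tsum_mul_right, ← ENNReal.ofReal_tsum_of_nonneg (fun ρ => by positivity)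
            (hsum.summable.mul_left _), tsum_mul_left, hsum.tsum_eq,
            ← ENNReal.ofReal_mul (by positivity)]
  · rw [lintegral_const, Measure.restrict_apply_univ, Real.volume_Ioc, add_sub_cancel_left,
      ← ENNReal.ofReal_mul (by positivity)]

theorem tsum_zeroMult_le {t x : ℝ} (ht : 2 ≤ t) (hx : 4 ≤ x) :
    (1 - 1 / Real.exp 1 * (1 + 1 / Real.exp 1)) * (1 / Real.log x * ∑' ρ, (zeroMult χ ρ : ℝ) /
      ‖((1 / 2 + 1 / Real.log x : ℝ) + t * I : ℂ) - ρ‖ ^ 2) ≤ Real.log (q * (t + 1)) / 2 +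
        ‖Dpoly χ x ((1 / 2 + 1 / Real.log x : ℝ) + t * I)‖ +
          ∑' j : ℕ, 1 / ((j : ℝ) + 1 / 4) ^ 2 := by
  have hlog : 1 ≤ Real.log x := by
    have h1 : Real.log 4 = 2 * Real.log 2 := by
      rw [show (4 : ℝ) = 2 ^ 2 by norm_num, Real.log_pow]; norm_num
    linarith [Real.log_two_gt_d9, Real.log_le_log (by norm_num) hx]
  have hh1 : 1 / Real.log x ≤ 1 := (div_le_one (by linarith)).2 hlog
  have hh0 : 0 < 1 / Real.log x := by positivity
  set s : ℂ := (1 / 2 + 1 / Real.log x : ℝ) + t * I with hs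
  have hsre : s.re = 1 / 2 + 1 / Real.log x := by simp [hs]
  have hs2 : 1 / 2 < s.re := by rw [hsre]; linarith
  have hS0 : 0 ≤ ∑' j : ℕ, 1 / ((j : ℝ) + 1 / 4) ^ 2 := tsum_nonneg fun j => by positivity
  have hF := mul_tsum_zeroMult_eq hq hχ hG hs2
  have hD := norm_logDeriv_add_Dpoly_le hq hχ hG (x := x) (by linarith) hs2
  have hpow : x ^ (1 / 2 - s.re) = 1 / Real.exp 1 := by
    rw [hsre, Real.rpow_def_of_pos (by linarith), one_div (Real.exp 1), ← Real.exp_neg]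
    congr 1
    field_simp
    ring
  rw [hpow] at hD
  rw [show s.re - 1 / 2 = 1 / Real.log x by rw [hsre]; ring] at hF
  have hψ := re_digamma_le (half_parity_re (χ := χ) hs2)
  have hnorm : ‖(s + parity χ) / 2‖ ≤ t + 1 := by
    have h1 := norm_add_le (((1 / 2 + 1 / Real.log x : ℝ) : ℂ) + t * I) (parity χ : ℂ)
    have h2 := norm_add_le ((1 / 2 + 1 / Real.log x : ℝ) : ℂ) (t * I)
    rw [Complex.norm_real, Real.norm_eq_abs, abs_of_nonneg (parity_nonneg χ)] at h1
    rw [Complex.norm_real, Real.norm_eq_abs, abs_of_nonneg (by positivity), norm_mul,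
      Complex.norm_I, mul_one, Complex.norm_real, Real.norm_eq_abs, abs_of_nonneg (by linarith)]
      at h2
    rw [norm_div, Complex.norm_ofNat]
    linarith [parity_le_one χ]
  have hpos : 0 < ‖(s + parity χ) / 2‖ := by
    have := Complex.re_le_norm ((s + parity χ) / 2)
    linarith [half_parity_re (χ := χ) hs2]
  have hlogn := Real.log_le_log hpos hnorm
  have hq0 : (0 : ℝ) < q := by exact_mod_cast (by omega : 0 < q)
  have hπ : 0 ≤ Real.log π := Real.log_nonneg (by linarith [Real.pi_gt_three])
  rw [Real.log_mul hq0.ne' (by linarith)]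
  have hre : (logDeriv (DirichletCharacter.LFunction χ) s).re ≤
      ‖logDeriv (DirichletCharacter.LFunction χ) s + Dpoly χ x s‖ + ‖Dpoly χ x s‖ := by
    refine (Complex.re_le_norm _).trans ?_
    have := norm_sub_le (logDeriv (DirichletCharacter.LFunction χ) s + Dpoly χ x s) (Dpoly χ x s)
    rwa [add_sub_cancel_right] at this
  have hD' := mul_le_mul_of_nonneg_left hD hh0.le
  rw [show 1 / Real.log x * (‖logDeriv (DirichletCharacter.LFunction χ) s + Dpoly χ x s‖ *
    Real.log x) = ‖logDeriv (DirichletCharacter.LFunction χ) s + Dpoly χ x s‖ by field_simp] at hD'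
  nlinarith

end

end

theorem M3_estimate :
    ∃ C : ℝ, 0 < C ∧
      ∀ (q : ℕ) [NeZero q] (χ : DirichletCharacter ℂ q), 1 < q → χ.IsPrimitive → GRH χ →
        ∀ t : ℝ, 2 ≤ t → ∀ x : ℝ, 4 ≤ x → x ≤ t ^ 2 →
          ∃ w' : ℝ, -1 ≤ w' ∧ w' ≤ 1 ∧
            |(∫ sg in (1 / 2 : ℝ)..(1 / 2 + 1 / Real.log x : ℝ),
                (logDeriv (DirichletCharacter.LFunction χ)
                    ((1 / 2 + 1 / Real.log x : ℝ) + t * Complex.I)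
                  - logDeriv (DirichletCharacter.LFunction χ)
                      ((sg : ℝ) + t * Complex.I))).im|
              ≤ (π / 4) * (1 / (1 - (1 / Real.exp 1) * (1 + 1 / Real.exp 1) * w'))
                  * (Real.log (q * (t + 1)) / Real.log x)
                + C * (1 / Real.log x)
                    * ‖Dpoly χ x ((1 / 2 + 1 / Real.log x : ℝ) + t * Complex.I)‖
                + C * (1 / Real.log x) := by
  set S := ∑' j : ℕ, 1 / ((j : ℝ) + 1 / 4) ^ 2 with hS
  have hS0 : 0 ≤ S := tsum_nonneg fun j => by positivity
  set κ := 1 / (1 - 1 / Real.exp 1 * (1 + 1 / Real.exp 1)) with hκ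
  have hκ1 : 0 < 1 - 1 / Real.exp 1 * (1 + 1 / Real.exp 1) := by
    linarith [one_div_exp_one_mul_lt]
  have hκ0 : 0 < κ := by positivity
  refine ⟨π / 2 * κ * (1 + S) + 1 / 4 * S, by positivity,
    fun q _ χ hq hχ hG t ht x hx _ => ⟨1, by norm_num, le_rfl, ?_⟩⟩
  rw [mul_one, ← hκ]
  have hlog : 1 ≤ Real.log x := by
    have h1 : Real.log 4 = 2 * Real.log 2 := by
      rw [show (4 : ℝ) = 2 ^ 2 by norm_num, Real.log_pow]; norm_num
    linarith [Real.log_two_gt_d9, Real.log_le_log (by norm_num) hx]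
  have hh1 : 1 / Real.log x ≤ 1 := (div_le_one (by linarith)).2 hlog
  have hh0 : 0 < 1 / Real.log x := by positivity
  have h1 := abs_im_integral_logDeriv_sub_le hq hχ hG hh0 hh1 t
  have h2 := tsum_zeroMult_le hq hχ hG ht hx
  refine h1.trans ?_
  set N := ‖Dpoly χ x ((1 / 2 + 1 / Real.log x : ℝ) + t * I)‖ with hN
  have hN0 : 0 ≤ N := norm_nonneg _
  set T := ∑' ρ, (zeroMult χ ρ : ℝ) / ‖((1 / 2 + 1 / Real.log x : ℝ) + t * I : ℂ) - ρ‖ ^ 2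
  have h3 : 1 / Real.log x * T ≤ κ * (Real.log (q * (t + 1)) / 2 + N + S) := by
    rw [hκ, one_div_mul_eq_div (1 - _), le_div_iff₀ hκ1]
    linarith
  set h := 1 / Real.log x with hh
  rw [div_eq_mul_one_div (Real.log _) (Real.log x), ← hh, ← hS]
  have h4 : h ^ 2 * T * (π / 2) ≤ h * (κ * (Real.log (q * (t + 1)) / 2 + N + S)) * (π / 2) := by
    rw [sq, mul_assoc h h]
    gcongr
  have h5 : 0 ≤ (π / 2 * κ * S + 1 / 4 * S) * h * N + π / 2 * κ * h := by positivity
  nlinarith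
end

section
/- Assume GRH for L(s,χ), χ primitive mod q > 1. Let t ≥ 2 with t ≠ γ for every zero ordinate γ, let 4 ≤ x ≤ t² and σ₁ = 1/2 + 1/log x. Then ∫_{1/2}^{σ₁} |∑_{γ} (t-γ)·[(σ-1/2)² - (σ₁-1/2)²] / ({(σ₁-1/2)²+(t-γ)²}·{(σ-1/2)²+(t-γ)²})| dσ ≤ (π/(2 log x))·∑_{γ} (σ₁-1/2)/((σ₁-1/2)² + (t-γ)²), where γ runs over the ordinates of the nontrivial zeros 1/2+iγ of L(s,χ). -/
open Complex Real ArithmeticFunction MeasureTheory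

open Metric in
theorem card_zeros_le_of_norm_le {f : ℂ → ℂ} (hf : Differentiable ℂ f) {c : ℂ} {r R M : ℝ}
    (hr : 0 < r) (hrR : r < R) (hM : 1 ≤ M) (hc : f c ≠ 0)
    (hbound : ∀ z ∈ sphere c R, ‖f z‖ ≤ M) (s : Finset ℂ)
    (hs : ∀ z ∈ s, z ∈ closedBall c r ∧ f z = 0) :
    (s.card : ℝ) ≤ Real.log (M / ‖f c‖) / Real.log (R / r) := by
  have hR : 0 < R := hr.trans hrR
  have han : ∀ U : Set ℂ, AnalyticOnNhd ℂ f U := fun U z _ ↦ hf.analyticAt z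
  have key := AnalyticOnNhd.sum_divisor_le (f := f) (c := c) (r := r) (R := R)
    (by rwa [abs_of_pos hr]) (by rwa [abs_of_pos hr, abs_of_pos hR]) hM (han _) hc
    (by rwa [abs_of_pos hR])
  refine le_trans ?_ key
  rw [abs_of_pos hr]
  set D := MeromorphicOn.divisor f (closedBall c r)
  have hfin := D.finiteSupport (isCompact_closedBall c r)
  have hne : ∀ z, analyticOrderAt f z ≠ ⊤ := by
    intro z hz
    rw [analyticOrderAt_eq_top] at hz
    exact hc ((han Set.univ).eqOn_of_preconnected_of_eventuallyEq (g := 0)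
      (fun _ _ ↦ analyticAt_const) isPreconnected_univ (Set.mem_univ z) hz (Set.mem_univ c))
  have h1 : ∀ z ∈ s, 1 ≤ D z := by
    intro z hz
    obtain ⟨hzr, hz0⟩ := hs z hz
    have h0 : analyticOrderAt f z ≠ 0 := (han Set.univ z trivial).analyticOrderAt_ne_zero.mpr hz0
    rw [MeromorphicOn.AnalyticOnNhd.divisor_apply (han _) hzr]
    obtain ⟨n, hn⟩ := ENat.ne_top_iff_exists.mp (hne z)
    rw [← hn] at h0 ⊢
    have : n ≠ 0 := by simpa using h0
    simp
    omega
  have hsub : s ⊆ hfin.toFinset := by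
    intro z hz
    have := h1 z hz
    simp only [Set.Finite.mem_toFinset, Function.mem_support]
    omega
  rw [finsum_eq_sum_of_support_subset _ (s := hfin.toFinset) (by simp)]
  have : (s.card : ℤ) ≤ ∑ z ∈ hfin.toFinset, D z := by
    calc (s.card : ℤ) = ∑ z ∈ s, 1 := by simp
      _ ≤ ∑ z ∈ s, D z := Finset.sum_le_sum h1
      _ ≤ _ := Finset.sum_le_sum_of_subset_of_nonneg hsub
        fun z _ _ ↦ MeromorphicOn.AnalyticOnNhd.divisor_nonneg (han _) z
  exact_mod_cast this

namespace DirichletCharacter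

variable {q : ℕ} [NeZero q] {χ : DirichletCharacter ℂ q}

theorem sum_range_add_eq_zero (hχ : χ ≠ 1) (n : ℕ) :
    ∑ i ∈ Finset.range q, χ ((n + i : ℕ) : ZMod q) = 0 := by
  rw [← MulChar.sum_eq_zero_of_ne_one hχ, ← Equiv.sum_comp (Equiv.addLeft (n : ZMod q))]
  refine Finset.sum_bij' (fun i _ ↦ (i : ZMod q)) (fun a _ ↦ a.val) ?_ ?_ ?_ ?_ ?_
  · simp
  · simp [ZMod.val_lt]
  · intro i hi
    exact ZMod.val_cast_of_lt (Finset.mem_range.mp hi)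
  · simp
  · simp

theorem norm_sum_range_le (hχ : χ ≠ 1) (n : ℕ) :
    ‖∑ i ∈ Finset.range n, χ (i : ZMod q)‖ ≤ q := by
  induction n using Nat.strong_induction_on with
  | _ n ih =>
    by_cases h : n < q
    · refine (norm_sum_le_of_le _ fun i _ ↦ χ.norm_le_one _).trans ?_
      simpa using h.le
    · obtain ⟨m, rfl⟩ := Nat.exists_eq_add_of_le' (not_lt.mp h)
      rw [Finset.sum_range_add, sum_range_add_eq_zero hχ, add_zero]
      exact ih m (by have := NeZero.pos q; omega)

theorem norm_sum_Icc_le (hχ : χ ≠ 1) (n : ℕ) :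
    ‖∑ k ∈ Finset.Icc 1 n, χ (k : ZMod q)‖ ≤ q := by
  have h0 : q ≠ 1 := by
    rintro rfl
    exact hχ (Subsingleton.elim _ _)
  have h1 : ∑ k ∈ Finset.Icc 1 n, χ (k : ZMod q) = ∑ i ∈ Finset.range (n + 1), χ (i : ZMod q) := by
    rw [Finset.range_eq_Ico, Finset.sum_eq_sum_Ico_succ_bot (by omega)]
    rw [Nat.cast_zero, χ.map_zero' h0, zero_add]
    rfl
  rw [h1]
  exact norm_sum_range_le hχ _

open Set Filter Asymptotics Topology in
theorem LFunction_eq_mul_integral (hχ : χ ≠ 1) {s : ℂ} (hs : 0 < s.re) :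
    LFunction χ s = s * ∫ t in Ioi (1 : ℝ),
      (∑ k ∈ Finset.Icc 1 ⌊t⌋₊, χ (k : ZMod q)) * (t : ℂ) ^ (-(s + 1)) := by
  set S : ℝ → ℂ := fun t ↦ ∑ k ∈ Finset.Icc 1 ⌊t⌋₊, χ (k : ZMod q) with hS
  have hSzero : ∀ t < 1, S t = 0 := by
    intro t ht
    simp [hS, Nat.floor_eq_zero.mpr ht]
  have hmellin : ∀ s : ℂ, ∫ t in Ioi (1 : ℝ), S t * (t : ℂ) ^ (-(s + 1)) = mellin S (-s) := by
    intro s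
    rw [mellin, ← integral_Ici_eq_integral_Ioi]
    symm
    rw [setIntegral_eq_of_subset_of_forall_sdiff_eq_zero measurableSet_Ioi
      (s := Ici 1) (fun t ht ↦ zero_lt_one.trans_le (mem_Ici.mp ht))]
    · refine setIntegral_congr_fun measurableSet_Ici fun t _ ↦ ?_
      simp only [smul_eq_mul, mul_comm (S t)]
      ring_nf
    · intro t ht
      rw [hSzero t (not_le.mp ht.2), smul_zero]
  have hmeas : Measurable S :=
    (measurable_from_nat (f := fun n ↦ ∑ k ∈ Finset.Icc 1 n, χ (k : ZMod q))).comp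
      Nat.measurable_floor
  have hdiff : ∀ s : ℂ, 0 < s.re → DifferentiableAt ℂ (fun s ↦ s * mellin S (-s)) s := by
    intro s hs
    have : DifferentiableAt ℂ (mellin S) (-s) := by
      refine mellin_differentiableAt_of_isBigO_rpow (a := 0) (b := -s.re - 1) ?_ ?_
        (by simpa) ?_ (by simp)
      · refine LocallyIntegrable.locallyIntegrableOn ?_ _
        refine (locallyIntegrable_const (q : ℝ)).mono hmeas.aestronglyMeasurable ?_
        refine .of_forall fun t ↦ ?_
        simpa using norm_sum_Icc_le hχ ⌊t⌋₊
      · refine IsBigO.of_bound q (.of_forall fun t ↦ ?_)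
        simpa using norm_sum_Icc_le hχ ⌊t⌋₊
      · refine IsBigO.of_bound 0 ?_
        filter_upwards [Ioo_mem_nhdsGT (zero_lt_one' ℝ)] with t ht
        simp [hSzero t ht.2]
    exact differentiableAt_id.mul (this.comp s differentiableAt_id.neg)
  rw [hmellin]
  have hopen : IsOpen {s : ℂ | 0 < s.re} := isOpen_lt continuous_const continuous_re
  refine AnalyticOnNhd.eqOn_of_preconnected_of_eventuallyEq
    (f := LFunction χ) (g := fun s ↦ s * mellin S (-s)) (U := {s : ℂ | 0 < s.re}) (z₀ := 2)
    (fun z _ ↦ (differentiable_LFunction hχ).analyticAt z) ?_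
    (convex_halfSpace_re_gt 0).isPreconnected (by simp) ?_ hs
  · exact DifferentiableOn.analyticOnNhd
      (fun z hz ↦ (hdiff z hz).differentiableWithinAt) hopen
  · have : {s : ℂ | 1 < s.re} ∈ 𝓝 (2 : ℂ) :=
      (isOpen_lt continuous_const continuous_re).mem_nhds (by simp)
    filter_upwards [this] with z hz
    rw [← hmellin, LFunction_eq_LSeries χ hz]
    refine LSeries_eq_mul_integral _ le_rfl (zero_lt_one.trans hz)
      (LSeriesSummable_of_one_lt_re χ hz) ?_
    refine IsBigO.of_bound q (.of_forall fun n ↦ ?_)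
    simpa using norm_sum_Icc_le hχ n

open Set in
theorem norm_LFunction_le (hχ : χ ≠ 1) {s : ℂ} (hs : 0 < s.re) :
    ‖LFunction χ s‖ ≤ q * ‖s‖ / s.re := by
  rw [LFunction_eq_mul_integral hχ hs, norm_mul]
  have hint : IntegrableOn (fun t : ℝ ↦ (q : ℝ) * t ^ (-(s.re + 1))) (Ioi 1) :=
    (integrableOn_Ioi_rpow_of_lt (by linarith) zero_lt_one).const_mul _
  have := norm_integral_le_of_norm_le (μ := volume.restrict (Ioi (1 : ℝ)))
    (f := fun t : ℝ ↦ (∑ k ∈ Finset.Icc 1 ⌊t⌋₊, χ (k : ZMod q)) * (t : ℂ) ^ (-(s + 1))) hint ?_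
  · rw [integral_const_mul, integral_Ioi_rpow_of_lt (by linarith) zero_lt_one] at this
    refine (mul_le_mul_of_nonneg_left this (norm_nonneg _)).trans_eq ?_
    simp
    field_simp
  · refine (ae_restrict_mem measurableSet_Ioi).mono fun t ht ↦ ?_
    rw [norm_mul, norm_cpow_eq_rpow_re_of_pos (zero_lt_one.trans ht)]
    refine mul_le_mul (norm_sum_Icc_le hχ _) (by simp) (Real.rpow_nonneg (zero_le_one.trans (le_of_lt ht)) _)
      (by positivity)

theorem one_third_le_norm_LFunction (χ : DirichletCharacter ℂ q) {s : ℂ} (hs : s.re = 2) :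
    1 / 3 ≤ ‖LFunction χ s‖ := by
  have h1 : 1 < s.re := by linarith
  rw [LFunction_eq_LSeries χ h1]
  have hsum := LSeriesSummable_of_one_lt_re χ h1
  have hz := hasSum_zeta_two
  rw [← hasSum_nat_add_iff' 2] at hz
  simp [Finset.sum_range_succ] at hz
  rw [LSeries, ← hsum.sum_add_tsum_nat_add 2]
  have hb := tsum_of_norm_bounded (f := fun n ↦ LSeries.term (fun n ↦ χ n) s (n + 2)) hz ?_
  · simp [Finset.sum_range_succ, LSeries.term] at hb ⊢
    have h3 := norm_sub_le_norm_add (1:ℂ) (∑' n : ℕ, χ (n + 2) / ((n:ℂ) + 2) ^ s)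
    have : π ^ 2 < 10 := by nlinarith [pi_lt_d2, pi_pos]
    rw [norm_one] at h3
    linarith
  · intro n
    rw [LSeries.norm_term_eq, if_neg (by omega), hs]
    push_cast
    rw [← one_div, Real.rpow_two]
    gcongr
    exact χ.norm_le_one _

open Metric in
theorem exists_card_zeros_le (hχ : χ ≠ 1) :
    ∃ C : ℝ, ∀ (k : ℤ) (s : Finset ℂ),
      (∀ ρ ∈ s, LFunction χ ρ = 0 ∧ ρ.re = 1 / 2 ∧ ⌊ρ.im⌋ = k) →
      (s.card : ℝ) ≤ C * (|(k : ℝ)| + 5) ^ (1 / 2 : ℝ) := by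
  have hq : (1 : ℝ) ≤ q := by exact_mod_cast NeZero.one_le
  have hlog : 0 < Real.log ((7 / 4) / (8 / 5)) := Real.log_pos (by norm_num)
  refine ⟨(12 * q) ^ (1 / 2 : ℝ) / (1 / 2) / Real.log ((7 / 4) / (8 / 5)), fun k s hs ↦ ?_⟩
  set c : ℂ := ⟨2, k + 1 / 2⟩ with hc
  have hk := abs_nonneg (k : ℝ)
  have hlow : 1 / 3 ≤ ‖LFunction χ c‖ := one_third_le_norm_LFunction χ rfl
  have hpos : 0 < ‖LFunction χ c‖ := by linarith
  have hnormc : ‖c‖ ≤ 2 + (|(k : ℝ)| + 1 / 2) := by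
    refine (norm_le_abs_re_add_abs_im c).trans ?_
    have := abs_add_le (k : ℝ) (1 / 2)
    simp only [hc]
    rw [abs_of_pos (two_pos : (0 : ℝ) < 2)]
    rw [abs_of_pos (by norm_num : (0 : ℝ) < 1 / 2)] at this
    linarith
  have hbound : ∀ z ∈ sphere c (7 / 4), ‖LFunction χ z‖ ≤ 4 * q * (|(k : ℝ)| + 5) := by
    intro z hz
    rw [mem_sphere, dist_eq_norm] at hz
    have h1 : |z.re - 2| ≤ 7 / 4 := by
      have := abs_re_le_norm (z - c)
      rw [hz] at this
      simpa [hc] using this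
    have hre : 1 / 4 ≤ z.re := by linarith [(abs_le.mp h1).1]
    have hz' : ‖z‖ ≤ |(k : ℝ)| + 5 := by
      have := norm_le_norm_add_norm_sub' z c
      linarith
    refine (norm_LFunction_le hχ (by linarith)).trans ?_
    rw [div_le_iff₀ (by linarith)]
    nlinarith [mul_le_mul_of_nonneg_left hz' (zero_le_one.trans hq),
      mul_le_mul_of_nonneg_left hre (by positivity : (0 : ℝ) ≤ 4 * q * (|(k : ℝ)| + 5))]
  have hmem : ∀ ρ ∈ s, ρ ∈ closedBall c (8 / 5) ∧ LFunction χ ρ = 0 := by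
    intro ρ hρ
    obtain ⟨h0, hre, him⟩ := hs ρ hρ
    refine ⟨?_, h0⟩
    rw [Int.floor_eq_iff] at him
    rw [mem_closedBall, Complex.dist_eq_re_im, Real.sqrt_le_left (by norm_num), hre]
    simp only [hc]
    nlinarith
  have hcard := card_zeros_le_of_norm_le (differentiable_LFunction hχ) (by norm_num)
    (by norm_num) (by nlinarith) (norm_pos_iff.mp hpos) hbound s hmem
  refine hcard.trans ?_
  rw [div_mul_eq_mul_div]
  gcongr
  calc Real.log (4 * q * (|(k : ℝ)| + 5) / ‖LFunction χ c‖)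
      ≤ Real.log (12 * q * (|(k : ℝ)| + 5)) := by
        gcongr
        rw [div_le_iff₀ hpos]
        nlinarith [mul_le_mul_of_nonneg_left hlow
          (by positivity : (0 : ℝ) ≤ 12 * q * (|(k : ℝ)| + 5))]
    _ ≤ (12 * q * (|(k : ℝ)| + 5)) ^ (1 / 2 : ℝ) / (1 / 2) :=
        Real.log_le_rpow_div (by positivity) (by norm_num)
    _ = _ := by
        rw [Real.mul_rpow (by positivity) (by positivity)]
        ring

theorem summable_sqrt_div_one_add_sq :
    Summable fun k : ℤ ↦ (|(k : ℝ)| + 5) ^ (1 / 2 : ℝ) / (1 + (k : ℝ) ^ 2) := by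
  have h : Summable fun k : ℤ ↦ 6 ^ (1 / 2 : ℝ) * |(k : ℝ)| ^ (-(3 / 2) : ℝ) :=
    (Real.summable_abs_int_rpow (by norm_num)).mul_left _
  refine h.of_norm_bounded_eventually ?_
  rw [Filter.eventually_cofinite]
  refine (Set.finite_singleton (0 : ℤ)).subset fun k hk ↦ ?_
  by_contra h0
  refine hk ?_
  have h1 : (1 : ℝ) ≤ |(k : ℝ)| := by exact_mod_cast Int.one_le_abs h0
  rw [Real.norm_of_nonneg (by positivity), div_le_iff₀ (by positivity)]
  calc (|(k : ℝ)| + 5) ^ (1 / 2 : ℝ) ≤ (6 * |(k : ℝ)|) ^ (1 / 2 : ℝ) := by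
        gcongr
        linarith
    _ = 6 ^ (1 / 2 : ℝ) * |(k : ℝ)| ^ (-(3 / 2) : ℝ) * |(k : ℝ)| ^ (2 : ℝ) := by
        rw [Real.mul_rpow (by norm_num) (by positivity), mul_assoc,
          ← Real.rpow_add (by linarith)]
        norm_num
    _ ≤ _ := by
        rw [Real.rpow_two, sq_abs]
        gcongr
        linarith

theorem summable_inv_sq_add_sq_of_GRH (hχ : χ ≠ 1) (hGRH : GRH χ) (t : ℝ) {η : ℝ} (hη : 0 < η) :
    Summable fun ρ : {ρ : ℂ // LFunction χ ρ = 0 ∧ 0 < ρ.re ∧ ρ.re < 1} ↦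
      1 / (η ^ 2 + (t - ρ.1.im) ^ 2) := by
  classical
  obtain ⟨C, hC⟩ := exists_card_zeros_le hχ
  set K : ℝ := 2 + (1 + 2 * (|t| + 1) ^ 2) / η ^ 2 with hK
  have hKpos : 0 < K := by positivity
  have hterm : ∀ y : ℝ, 1 / (η ^ 2 + (t - y) ^ 2) ≤ K / (1 + (⌊y⌋ : ℝ) ^ 2) := by
    intro y
    rw [div_le_div_iff₀ (by positivity) (by positivity)]
    have h1 : |(⌊y⌋ : ℝ)| ≤ |t - y| + (|t| + 1) := by
      have h2 := Int.floor_le y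
      have h3 := Int.lt_floor_add_one y
      rw [abs_le]
      constructor <;>
        linarith [neg_abs_le t, le_abs_self t, neg_abs_le (t - y), le_abs_self (t - y)]
    have h2 : (⌊y⌋ : ℝ) ^ 2 ≤ (|t - y| + (|t| + 1)) ^ 2 := by
      rw [← sq_abs]
      gcongr
    have h3 : K * η ^ 2 = 2 * η ^ 2 + (1 + 2 * (|t| + 1) ^ 2) := by
      rw [hK]
      field_simp
    have h4 : 2 ≤ K := by
      rw [hK]
      linarith [(by positivity : 0 ≤ (1 + 2 * (|t| + 1) ^ 2) / η ^ 2)]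
    nlinarith [sq_abs (t - y), sq_nonneg (|t - y| - (|t| + 1)), sq_nonneg (t - y), sq_nonneg η]
  set g : ℤ → ℝ := fun k ↦ C * K * ((|(k : ℝ)| + 5) ^ (1 / 2 : ℝ) / (1 + (k : ℝ) ^ 2)) with hg
  have hgsum : Summable g := summable_sqrt_div_one_add_sq.mul_left _
  have hfiber : ∀ (k : ℤ) (u : Finset {ρ : ℂ // LFunction χ ρ = 0 ∧ 0 < ρ.re ∧ ρ.re < 1}),
      (∀ ρ ∈ u, ⌊ρ.1.im⌋ = k) → ∑ ρ ∈ u, 1 / (η ^ 2 + (t - ρ.1.im) ^ 2) ≤ g k := by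
    intro k u hu
    have h1 := hC k (u.map (Function.Embedding.subtype _)) ?_
    · rw [Finset.card_map] at h1
      calc ∑ ρ ∈ u, 1 / (η ^ 2 + (t - ρ.1.im) ^ 2)
          ≤ ∑ ρ ∈ u, K / (1 + (k : ℝ) ^ 2) :=
            Finset.sum_le_sum fun ρ hρ ↦ hu ρ hρ ▸ hterm ρ.1.im
        _ = u.card * (K / (1 + (k : ℝ) ^ 2)) := by rw [Finset.sum_const, nsmul_eq_mul]
        _ ≤ C * (|(k : ℝ)| + 5) ^ (1 / 2 : ℝ) * (K / (1 + (k : ℝ) ^ 2)) := by gcongr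
        _ = g k := by rw [hg]; ring
    · intro ρ hρ
      obtain ⟨ρ, hρu, rfl⟩ := Finset.mem_map.mp hρ
      exact ⟨ρ.2.1, hGRH _ ρ.2.1 ρ.2.2.1 ρ.2.2.2, hu ρ hρu⟩
  have hgnonneg : ∀ k, 0 ≤ g k := fun k ↦ by simpa using hfiber k ∅ (by simp)
  refine summable_of_sum_le (c := ∑' k, g k) (fun ρ ↦ by positivity) fun u ↦ ?_
  rw [← Finset.sum_fiberwise_of_maps_to (t := u.image fun ρ ↦ ⌊ρ.1.im⌋)
    fun ρ hρ ↦ Finset.mem_image_of_mem _ hρ]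
  refine (Finset.sum_le_sum fun k _ ↦ hfiber k _ fun ρ hρ ↦ (Finset.mem_filter.mp hρ).2).trans ?_
  exact hgsum.sum_le_tsum _ fun k _ ↦ hgnonneg k

end DirichletCharacter

theorem integral_abs_div_sq_add_sq_le {d : ℝ} (hd : d ≠ 0) (a b : ℝ) :
    ∫ s in a..b, |d| / ((s - a) ^ 2 + d ^ 2) ≤ π / 2 := by
  have hderiv : ∀ s : ℝ, HasDerivAt (fun s ↦ Real.arctan ((s - a) / |d|))
      (|d| / ((s - a) ^ 2 + d ^ 2)) s := by
    intro s
    convert! (((hasDerivAt_id s).sub_const a).div_const |d|).arctan using 1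
    have := abs_pos.mpr hd
    rw [← sq_abs d, id]
    field_simp
    ring
  rw [intervalIntegral.integral_eq_sub_of_hasDerivAt (fun s _ ↦ hderiv s)]
  · simpa using (Real.arctan_lt_pi_div_two _).le
  · refine Continuous.intervalIntegrable (Continuous.div (by fun_prop) (by fun_prop) fun s ↦ ?_) _ _
    positivity

theorem integral_abs_mul_sub_div_le {d η : ℝ} (hd : d ≠ 0) (hη : 0 < η) (a : ℝ) :
    ∫ s in a..a + η, |d * ((s - a) ^ 2 - η ^ 2) / ((η ^ 2 + d ^ 2) * ((s - a) ^ 2 + d ^ 2))| ≤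
      π / 2 * η * (η / (η ^ 2 + d ^ 2)) := by
  have hle : a ≤ a + η := by linarith
  have hcont : Continuous fun s ↦ |d| / ((s - a) ^ 2 + d ^ 2) :=
    Continuous.div (by fun_prop) (by fun_prop) fun s ↦ by positivity
  calc ∫ s in a..a + η, |d * ((s - a) ^ 2 - η ^ 2) / ((η ^ 2 + d ^ 2) * ((s - a) ^ 2 + d ^ 2))|
      ≤ ∫ s in a..a + η, η ^ 2 / (η ^ 2 + d ^ 2) * (|d| / ((s - a) ^ 2 + d ^ 2)) := by
        refine intervalIntegral.integral_mono_on hle ?_ ?_ fun s hs ↦ ?_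
        · exact Continuous.intervalIntegrable
            (Continuous.div (by fun_prop) (by fun_prop) fun s ↦ by positivity).abs _ _
        · exact (continuous_const.mul hcont).intervalIntegrable _ _
        · rw [abs_div, abs_mul, abs_of_pos
            (by positivity : 0 < (η ^ 2 + d ^ 2) * ((s - a) ^ 2 + d ^ 2)), div_mul_div_comm,
            mul_comm |d|]
          gcongr
          rw [abs_le]
          constructor <;> nlinarith [hs.1, hs.2]
    _ = η ^ 2 / (η ^ 2 + d ^ 2) * ∫ s in a..a + η, |d| / ((s - a) ^ 2 + d ^ 2) := by
        rw [intervalIntegral.integral_const_mul]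
    _ ≤ η ^ 2 / (η ^ 2 + d ^ 2) * (π / 2) := by
        gcongr
        exact integral_abs_div_sq_add_sq_le hd _ _
    _ = _ := by ring

theorem integral_abs_tsum_mul_sub_div_le {ι : Type*} {d : ι → ℝ} {η : ℝ} (hd : ∀ i, d i ≠ 0)
    (hη : 0 < η) (hsum : Summable fun i ↦ 1 / (η ^ 2 + d i ^ 2)) (a : ℝ) :
    ∫ s in a..a + η,
        |∑' i, d i * ((s - a) ^ 2 - η ^ 2) / ((η ^ 2 + d i ^ 2) * ((s - a) ^ 2 + d i ^ 2))| ≤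
      π / 2 * η * ∑' i, η / (η ^ 2 + d i ^ 2) := by
  have hle : a ≤ a + η := by linarith
  have hcount : Countable ι := by
    have := hsum.countable_support
    rw [Function.support_eq_univ fun i ↦ by positivity] at this
    exact Set.countable_univ_iff.mp this
  set f : ι → ℝ → ℝ := fun i s ↦
    d i * ((s - a) ^ 2 - η ^ 2) / ((η ^ 2 + d i ^ 2) * ((s - a) ^ 2 + d i ^ 2)) with hf
  have hcont : ∀ i, Continuous (f i) := fun i ↦
    Continuous.div (by fun_prop) (by fun_prop) fun s ↦ by have := hd i; positivity
  have hsum' : Summable fun i ↦ π / 2 * η * (η / (η ^ 2 + d i ^ 2)) := by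
    refine (hsum.mul_left (π / 2 * η * η)).congr fun i ↦ ?_
    ring
  have hnonneg : ∀ i, 0 ≤ π / 2 * η * (η / (η ^ 2 + d i ^ 2)) := fun i ↦ by positivity
  rw [intervalIntegral.integral_of_le hle, ← tsum_mul_left]
  refine (Real.le_norm_self _).trans ((norm_integral_le_lintegral_norm _).trans ?_)
  refine ENNReal.toReal_le_of_le_ofReal (tsum_nonneg hnonneg) ?_
  calc ∫⁻ s in Set.Ioc a (a + η), ENNReal.ofReal ‖|∑' i, f i s|‖
      ≤ ∫⁻ s in Set.Ioc a (a + η), ∑' i, ENNReal.ofReal |f i s| := by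
        refine lintegral_mono fun s ↦ ?_
        by_cases hs : Summable fun i ↦ |f i s|
        · have h : |∑' i, f i s| ≤ ∑' i, |f i s| := by
            simp only [← Real.norm_eq_abs] at hs ⊢
            exact norm_tsum_le_tsum_norm hs
          rw [norm_abs_eq_norm, Real.norm_eq_abs, ← ENNReal.ofReal_tsum_of_nonneg (fun i ↦ abs_nonneg _) hs]
          exact ENNReal.ofReal_le_ofReal h
        · rw [tsum_eq_zero_of_not_summable (mt Summable.abs hs)]
          simp
    _ = ∑' i, ∫⁻ s in Set.Ioc a (a + η), ENNReal.ofReal |f i s| :=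
        lintegral_tsum fun i ↦ (hcont i).abs.measurable.ennreal_ofReal.aemeasurable
    _ ≤ ∑' i, ENNReal.ofReal (π / 2 * η * (η / (η ^ 2 + d i ^ 2))) := by
        refine ENNReal.tsum_le_tsum fun i ↦ ?_
        rw [← ofReal_integral_eq_lintegral_ofReal
          ((hcont i).abs.integrableOn_Ioc) (.of_forall fun s ↦ abs_nonneg _),
          ← intervalIntegral.integral_of_le hle]
        exact ENNReal.ofReal_le_ofReal (integral_abs_mul_sub_div_le (hd i) hη a)
    _ = _ := (ENNReal.ofReal_tsum_of_nonneg hnonneg hsum').symm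

theorem N_gamma_estimate
    (q : ℕ) [NeZero q] (χ : DirichletCharacter ℂ q) (hq : 1 < q) (hχ : χ.IsPrimitive)
    (hGRH : GRH χ) (t : ℝ) (ht : 2 ≤ t)
    (htγ : ∀ ρ : ℂ, DirichletCharacter.LFunction χ ρ = 0 → 0 < ρ.re → ρ.re < 1 → t ≠ ρ.im)
    (x : ℝ) (hx4 : 4 ≤ x) (hxt : x ≤ t ^ 2) :
    (∫ sg in (1 / 2 : ℝ)..(1 / 2 + 1 / Real.log x : ℝ),
        |∑' ρ : {ρ : ℂ // DirichletCharacter.LFunction χ ρ = 0 ∧ 0 < ρ.re ∧ ρ.re < 1},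
            (t - ρ.1.im) * ((sg - 1 / 2) ^ 2 - ((1 / 2 + 1 / Real.log x) - 1 / 2) ^ 2)
              / ((((1 / 2 + 1 / Real.log x) - 1 / 2) ^ 2 + (t - ρ.1.im) ^ 2)
                  * ((sg - 1 / 2) ^ 2 + (t - ρ.1.im) ^ 2))|)
      ≤ (π / (2 * Real.log x)) *
          ∑' ρ : {ρ : ℂ // DirichletCharacter.LFunction χ ρ = 0 ∧ 0 < ρ.re ∧ ρ.re < 1},
            ((1 / 2 + 1 / Real.log x) - 1 / 2) /
              (((1 / 2 + 1 / Real.log x) - 1 / 2) ^ 2 + (t - ρ.1.im) ^ 2) := by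
  have hη : 0 < 1 / Real.log x := one_div_pos.mpr (Real.log_pos (by linarith))
  have hχ1 : χ ≠ 1 := by
    rintro rfl
    rw [DirichletCharacter.isPrimitive_def, DirichletCharacter.conductor_one] at hχ
    exact hq.ne hχ
  have hsum := DirichletCharacter.summable_inv_sq_add_sq_of_GRH hχ1 hGRH t hη
  have hconst : π / 2 * (1 / Real.log x) = π / (2 * Real.log x) := by ring
  have key := integral_abs_tsum_mul_sub_div_le
    (d := fun ρ : {ρ : ℂ // DirichletCharacter.LFunction χ ρ = 0 ∧ 0 < ρ.re ∧ ρ.re < 1} ↦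
      t - ρ.1.im)
    (fun ρ ↦ sub_ne_zero.mpr (htγ ρ.1 ρ.2.1 ρ.2.2.1 ρ.2.2.2)) hη hsum (1 / 2)
  rw [hconst] at key
  rw [add_sub_cancel_left]
  exact key
end

section
/- For any Dirichlet character χ, any real t, and any x ≥ 4, with σ₁ = 1/2 + 1/log x, one has |∑_{2≤n<x²} Λ_x(n)χ(n) n^{-(σ₁+it)} / log n| = O(x/(log x)²), with an absolute implied constant. -/
open Complex Real ArithmeticFunction

theorem sum_Icc_mul_le_of_antitone {a f : ℕ → ℝ} {C : ℝ}
    (hf : AntitoneOn f (Set.Ici 1)) (hf0 : ∀ n, 0 ≤ f n)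
    (ha : ∀ N : ℕ, ∑ n ∈ Finset.Icc 1 N, a n ≤ C * N) (N : ℕ) :
    ∑ n ∈ Finset.Icc 1 N, a n * f n ≤ C * ∑ n ∈ Finset.Icc 1 N, f n := by
  have key : ∀ N : ℕ, ∑ n ∈ Finset.Icc 1 N, a n * f n - C * ∑ n ∈ Finset.Icc 1 N, f n
      ≤ f N * (∑ n ∈ Finset.Icc 1 N, a n - C * N) := by
    intro N
    induction N with
    | zero => simp
    | succ N ih =>
      rw [Finset.sum_Icc_succ_top (by omega), Finset.sum_Icc_succ_top (by omega),
        Finset.sum_Icc_succ_top (by omega)]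
      have hstep : f N * (∑ n ∈ Finset.Icc 1 N, a n - C * N)
          ≤ f (N + 1) * (∑ n ∈ Finset.Icc 1 N, a n - C * N) := by
        rcases Nat.eq_zero_or_pos N with rfl | hN
        · simp
        · exact mul_le_mul_of_nonpos_right
            (hf (Set.mem_Ici.2 hN) (Set.mem_Ici.2 (by omega)) (Nat.le_succ N))
            (sub_nonpos.2 (ha N))
      push_cast
      linarith
  have := mul_nonpos_of_nonneg_of_nonpos (hf0 N) (sub_nonpos.2 (ha N))
  linarith [key N]

theorem sum_Icc_inv_sqrt_sqrt_pow_three_le (N : ℕ) :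
    ∑ n ∈ Finset.Icc 1 N, (√√(n : ℝ) ^ 3)⁻¹ ≤ 4 * √√(N : ℝ) := by
  induction N with
  | zero => simp
  | succ N ih =>
    rw [Finset.sum_Icc_succ_top (by omega)]
    have pow_four : ∀ m : ℕ, √√(m : ℝ) ^ 4 = m := fun m => by
      rw [show 4 = 2 * 2 from rfl, pow_mul, Real.sq_sqrt (Real.sqrt_nonneg _),
        Real.sq_sqrt m.cast_nonneg]
    have ha := pow_four (N + 1)
    have hb := pow_four N
    have ha0 : 0 < √√((N + 1 : ℕ) : ℝ) := by positivity
    have hb0 : 0 ≤ √√(N : ℝ) := Real.sqrt_nonneg _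
    have hba : √√(N : ℝ) ≤ √√((N + 1 : ℕ) : ℝ) := by gcongr; simp
    set a := √√((N + 1 : ℕ) : ℝ)
    set b := √√(N : ℝ)
    have hab : a ^ 4 - b ^ 4 = 1 := by rw [ha, hb]; push_cast; ring
    have : (a ^ 3)⁻¹ ≤ 4 * (a - b) := by
      rw [inv_le_iff_one_le_mul₀ (by positivity), ← hab]
      have h1 : b ^ 3 ≤ a ^ 3 := by gcongr
      have h2 : a * b ^ 2 ≤ a * a ^ 2 := by gcongr
      have h3 : a ^ 2 * b ≤ a ^ 2 * a := by gcongr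
      calc a ^ 4 - b ^ 4 = (a - b) * (a ^ 3 + a ^ 2 * b + a * b ^ 2 + b ^ 3) := by ring
        _ ≤ (a - b) * (4 * a ^ 3) :=
          mul_le_mul_of_nonneg_left (by linarith) (sub_nonneg.2 hba)
        _ = 4 * (a - b) * a ^ 3 := by ring
    linarith

theorem sum_Icc_vonMangoldt_mul_inv_sqrt_sqrt_pow_three_le (N : ℕ) :
    ∑ n ∈ Finset.Icc 1 N, vonMangoldt n * (√√(n : ℝ) ^ 3)⁻¹
      ≤ (Real.log 4 + 4) * (4 * √√(N : ℝ)) := by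
  refine (sum_Icc_mul_le_of_antitone (C := Real.log 4 + 4) ?_ (fun n => by positivity)
    (fun M => ?_) N).trans ?_
  · intro m hm n _ hmn
    have : (0 : ℝ) < m := Nat.cast_pos.2 hm
    dsimp only
    gcongr
  · have h := Chebyshev.psi_le_const_mul_self (x := (M : ℝ)) M.cast_nonneg
    rw [Chebyshev.psi, Nat.floor_natCast] at h
    exact h
  · have := Real.log_nonneg (by norm_num : (1 : ℝ) ≤ 4)
    gcongr
    exact sum_Icc_inv_sqrt_sqrt_pow_three_le N

theorem log_le_four_mul_sqrt_sqrt {y : ℝ} (hy : 0 < y) : Real.log y ≤ 4 * √√y := by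
  have h : Real.log √√y = Real.log y / 4 := by
    rw [Real.log_sqrt (Real.sqrt_nonneg _), Real.log_sqrt hy.le]; ring
  have := Real.log_le_self (Real.sqrt_nonneg √y)
  linarith

theorem Lambdax_nonneg {x : ℝ} (hx : 1 ≤ x) (n : ℕ) : 0 ≤ Lambdax x n := by
  unfold Lambdax
  split_ifs with h1 h2
  · exact vonMangoldt_nonneg
  · have hn : (0 : ℝ) < n := by linarith
    exact mul_nonneg vonMangoldt_nonneg
      (div_nonneg (Real.log_nonneg ((one_le_div hn).2 h2)) (Real.log_nonneg hx))
  · exact le_rfl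

theorem Lambdax_div_le {x : ℝ} (hx : 4 ≤ x) {n : ℕ} (hn : 2 ≤ n) :
    Lambdax x n / (√(n : ℝ) * Real.log n) ≤
      (if (n : ℝ) ≤ x then √√x * (√√(n : ℝ) ^ 3)⁻¹ else 0) +
        4 * √x / Real.log x ^ 2 * (vonMangoldt n * (√√(n : ℝ) ^ 3)⁻¹) := by
  have hn1 : (1 : ℝ) < n := by exact_mod_cast hn
  have hn0 : (0 : ℝ) < n := by linarith
  have hln : 0 < Real.log n := Real.log_pos hn1
  have hlx : 0 < Real.log x := Real.log_pos (by linarith)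
  have hΛ : 0 ≤ vonMangoldt n := vonMangoldt_nonneg
  have hg : 0 < √√(n : ℝ) := by positivity
  have hgg (y : ℝ) : √(n : ℝ) * y = √√(n : ℝ) ^ 2 * y := by
    rw [Real.sq_sqrt (Real.sqrt_nonneg _)]
  unfold Lambdax
  split_ifs with h1 h2
  · refine le_add_of_le_of_nonneg ?_ (by positivity)
    have hgx : √√(n : ℝ) ≤ √√x := by gcongr
    calc vonMangoldt n / (√(n : ℝ) * Real.log n)
        ≤ Real.log n / (√(n : ℝ) * Real.log n) := by gcongr; exact vonMangoldt_le_log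
      _ = √√(n : ℝ) * (√√(n : ℝ) ^ 3)⁻¹ := by rw [hgg (Real.log n)]; field_simp
      _ ≤ _ := by gcongr
  · rw [zero_add]
    have hlog : Real.log (x ^ 2 / n) ≤ 4 * (√x / √√(n : ℝ)) := by
      have h := log_le_four_mul_sqrt_sqrt (y := x ^ 2 / n) (by positivity)
      rwa [Real.sqrt_div (by positivity), Real.sqrt_sq (by linarith),
        Real.sqrt_div (by linarith)] at h
    calc vonMangoldt n * (Real.log (x ^ 2 / n) / Real.log x) / (√(n : ℝ) * Real.log n)
        ≤ vonMangoldt n * (4 * (√x / √√(n : ℝ)) / Real.log x) / (√(n : ℝ) * Real.log x) := by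
          gcongr
          linarith
      _ = _ := by rw [hgg (Real.log x)]; field_simp
  · rw [zero_div, zero_add]
    positivity

theorem norm_Lambdax_mul_character_div_le {q : ℕ} (χ : DirichletCharacter ℂ q) (t : ℝ) {x : ℝ}
    (hx : 4 ≤ x) {n : ℕ} (hn : 2 ≤ n) :
    ‖(Lambdax x n : ℂ) * χ n /
        ((n : ℂ) ^ (((1 / 2 + 1 / Real.log x : ℝ) : ℂ) + t * Complex.I) * (Real.log n : ℂ))‖
      ≤ Lambdax x n / (√(n : ℝ) * Real.log n) := by
  have hn1 : (1 : ℝ) < n := by exact_mod_cast hn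
  have hn0 : (0 : ℝ) < n := by linarith
  have hln : 0 < Real.log n := Real.log_pos hn1
  have hlx : 0 < Real.log x := Real.log_pos (by linarith)
  have hΛ := Lambdax_nonneg (by linarith : 1 ≤ x) n
  rw [norm_div, norm_mul, norm_mul, Complex.norm_natCast_cpow_of_pos (by omega),
    Complex.norm_real, Complex.norm_real, Real.norm_of_nonneg hΛ, Real.norm_of_nonneg hln.le]
  have hre : ((((1 / 2 + 1 / Real.log x : ℝ) : ℂ) + t * Complex.I)).re
      = 1 / 2 + 1 / Real.log x := by simp
  rw [hre, Real.sqrt_eq_rpow]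
  gcongr
  · exact mul_le_of_le_one_right hΛ (χ.norm_le_one _)
  · exact hn1.le
  · exact le_add_of_nonneg_right (by positivity)

theorem Dpoly_log_bound :
    ∃ C : ℝ, 0 < C ∧
      ∀ (q : ℕ) (χ : DirichletCharacter ℂ q) (t : ℝ) (x : ℝ), 4 ≤ x →
        ‖∑ n ∈ Finset.filter (fun n : ℕ => 2 ≤ n ∧ (n : ℝ) < x ^ 2)
              (Finset.range (⌈x ^ 2⌉₊ + 1)),
            (Lambdax x n : ℂ) * χ n /
              ((n : ℂ) ^ (((1 / 2 + 1 / Real.log x : ℝ) : ℂ) + t * Complex.I)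
                * (Real.log n : ℂ))‖
          ≤ C * (x / (Real.log x) ^ 2) := by
  have hlog4 : 0 ≤ Real.log 4 := Real.log_nonneg (by norm_num)
  refine ⟨64 + 16 * (Real.log 4 + 4), by positivity, fun q χ t x hx => ?_⟩
  have hx0 : 0 < x := by linarith
  have hlx : 0 < Real.log x := Real.log_pos (by linarith)
  have hsq : √√x * √√x = √x := Real.mul_self_sqrt (Real.sqrt_nonneg _)
  have hxx : √x * √x = x := Real.mul_self_sqrt hx0.le
  have hsmall : ∑ n ∈ Finset.Icc 1 ⌊x ^ 2⌋₊,
      (if (n : ℝ) ≤ x then √√x * (√√(n : ℝ) ^ 3)⁻¹ else 0) ≤ 4 * √x := by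
    rw [← Finset.sum_filter]
    calc _ ≤ ∑ n ∈ Finset.Icc 1 ⌊x⌋₊, √√x * (√√(n : ℝ) ^ 3)⁻¹ := by
          refine Finset.sum_le_sum_of_subset_of_nonneg (fun n hn => ?_)
            fun n _ _ => by positivity
          simp only [Finset.mem_filter, Finset.mem_Icc] at hn ⊢
          exact ⟨hn.1.1, Nat.le_floor hn.2⟩
      _ ≤ √√x * (4 * √√(⌊x⌋₊ : ℝ)) := by
          rw [← Finset.mul_sum]
          gcongr
          exact sum_Icc_inv_sqrt_sqrt_pow_three_le _
      _ ≤ √√x * (4 * √√x) := by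
          gcongr
          exact Nat.floor_le hx0.le
      _ = 4 * √x := by linear_combination 4 * hsq
  have hlarge : ∑ n ∈ Finset.Icc 1 ⌊x ^ 2⌋₊, vonMangoldt n * (√√(n : ℝ) ^ 3)⁻¹
      ≤ (Real.log 4 + 4) * (4 * √x) := by
    refine (sum_Icc_vonMangoldt_mul_inv_sqrt_sqrt_pow_three_le _).trans ?_
    have h : √(⌊x ^ 2⌋₊ : ℝ) ≤ x :=
      (Real.sqrt_le_sqrt (Nat.floor_le (by positivity))).trans_eq (Real.sqrt_sq hx0.le)
    gcongr
  have hsqrt : √x ≤ 16 * (x / Real.log x ^ 2) := by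
    rw [← mul_div_assoc, le_div_iff₀ (by positivity)]
    have h := pow_le_pow_left₀ hlx.le (log_le_four_mul_sqrt_sqrt hx0) 2
    calc √x * Real.log x ^ 2 ≤ √x * (4 * √√x) ^ 2 := by gcongr
      _ = 16 * (√x * (√√x * √√x)) := by ring
      _ = 16 * x := by rw [hsq, hxx]
  calc _ ≤ ∑ n ∈ Finset.filter (fun n : ℕ => 2 ≤ n ∧ (n : ℝ) < x ^ 2)
            (Finset.range (⌈x ^ 2⌉₊ + 1)),
          ((if (n : ℝ) ≤ x then √√x * (√√(n : ℝ) ^ 3)⁻¹ else 0) +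
            4 * √x / Real.log x ^ 2 * (vonMangoldt n * (√√(n : ℝ) ^ 3)⁻¹)) :=
        norm_sum_le_of_le _ fun n hn =>
          have h2 := (Finset.mem_filter.1 hn).2.1
          (norm_Lambdax_mul_character_div_le χ t hx h2).trans (Lambdax_div_le hx h2)
    _ ≤ ∑ n ∈ Finset.Icc 1 ⌊x ^ 2⌋₊,
          ((if (n : ℝ) ≤ x then √√x * (√√(n : ℝ) ^ 3)⁻¹ else 0) +
            4 * √x / Real.log x ^ 2 * (vonMangoldt n * (√√(n : ℝ) ^ 3)⁻¹)) := by
        refine Finset.sum_le_sum_of_subset_of_nonneg (fun n hn => ?_) fun n _ _ => ?_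
        · obtain ⟨-, h2, hlt⟩ := Finset.mem_filter.1 hn
          exact Finset.mem_Icc.2 ⟨by omega, Nat.le_floor hlt.le⟩
        · have : 0 ≤ vonMangoldt n := vonMangoldt_nonneg
          split_ifs <;> positivity
    _ ≤ 4 * √x + 4 * √x / Real.log x ^ 2 * ((Real.log 4 + 4) * (4 * √x)) := by
        rw [Finset.sum_add_distrib, ← Finset.mul_sum]
        gcongr
    _ = 4 * √x + 16 * (Real.log 4 + 4) * ((√x * √x) / Real.log x ^ 2) := by ring
    _ ≤ _ := by rw [hxx]; linarith
end
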